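/- Let n ≥ 3 and let Ω ⊂ ℝⁿ be a smooth bounded and simply connected domain endowed with a C¹ Riemannian metric g. There exists ε₀(n) ∈ (0, 1/(n+1)) such that for every ε ∈ (0, ε₀(n)), with θ = θ(n,ε), the set of isometric embeddings of (Ω̄, g) into ℝ^{2n} of class C^{1,θ} (i.e. injective isometric immersions u ∈ C^{1,θ}(Ω̄, ℝ^{2n})) is infinite. -/

import Mathlib

open MeasureTheory

attribute [local instance] Matrix.normedAddCommGroup Matrix.normedSpace

noncomputable section

/-- The partial derivative `∂_i f` in the `i`-th coordinate direction. -/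
def pder {n : ℕ} {E : Type*} [NormedAddCommGroup E] [NormedSpace ℝ E]
    (i : Fin n) (f : (Fin n → ℝ) → E) : (Fin n → ℝ) → E :=
  fun x => fderiv ℝ f x (Pi.single i 1)

/-- Iterated partial derivatives along a list of coordinate directions. -/
def derivList {n : ℕ} {E : Type*} [NormedAddCommGroup E] [NormedSpace ℝ E] :
    List (Fin n) → ((Fin n → ℝ) → E) → ((Fin n → ℝ) → E)
  | [], f => f
  | i :: l, f => derivList l (pder i f)

/-- The multi-index partial derivative `∂^β f`. -/
def mderiv {n : ℕ} {E : Type*} [NormedAddCommGroup E] [NormedSpace ℝ E]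
    (β : Fin n → ℕ) (f : (Fin n → ℝ) → E) : (Fin n → ℝ) → E :=
  derivList (((List.finRange n).map fun i => List.replicate (β i) i).flatten) f

/-- The sup norm `‖f‖₀` over a set `D`. -/
def sNorm {n : ℕ} {E : Type*} [NormedAddCommGroup E]
    (D : Set (Fin n → ℝ)) (f : (Fin n → ℝ) → E) : ℝ :=
  ⨆ x : D, ‖f x.1‖

/-- The seminorm `[f]_k = Σ_{|β| = k} ‖∂^β f‖₀` over a set `D`. -/
def semK {n : ℕ} {E : Type*} [NormedAddCommGroup E] [NormedSpace ℝ E]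
    (D : Set (Fin n → ℝ)) (k : ℕ) (f : (Fin n → ℝ) → E) : ℝ :=
  ∑ β ∈ Finset.Nat.antidiagonalTuple n k, sNorm D (mderiv β f)

/-- The norm `‖f‖_k = Σ_{j ≤ k} [f]_j` over a set `D`. -/
def nrm {n : ℕ} {E : Type*} [NormedAddCommGroup E] [NormedSpace ℝ E]
    (D : Set (Fin n → ℝ)) (k : ℕ) (f : (Fin n → ℝ) → E) : ℝ :=
  ∑ j ∈ Finset.range (k + 1), semK D j f

/-- The pullback metric `u^♯e = (∇u)ᵀ ∇u`, i.e. `(u^♯e)_{ij} = ∂_i u · ∂_j u`. -/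
def pullback {n d : ℕ} (u : (Fin n → ℝ) → (Fin d → ℝ)) (x : Fin n → ℝ) :
    Matrix (Fin n) (Fin n) ℝ :=
  Matrix.of fun i j => ∑ a, pder i u x a * pder j u x a

/-- `u ∈ C^{1,θ}(D, ℝ^d)`: `u` is `C¹` with `θ`-Hölder continuous first derivatives on `D`. -/
def MemC1Holder {n d : ℕ} (D : Set (Fin n → ℝ)) (θ : ℝ)
    (u : (Fin n → ℝ) → (Fin d → ℝ)) : Prop :=
  ContDiff ℝ 1 u ∧ ∃ C : ℝ, ∀ i : Fin n, ∀ x ∈ D, ∀ y ∈ D,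
    ‖pder i u x - pder i u y‖ ≤ C * ‖x - y‖ ^ θ

/-- The Hölder exponent `θ(n, ε)`: `1/n − ε` for odd `n` and `1/(n+1) − ε` for even `n`. -/
def thetaExp (n : ℕ) (ε : ℝ) : ℝ := if Odd n then 1 / n - ε else 1 / (n + 1) - ε

set_option linter.all false

namespace CI
open scoped ContDiff

/-- Smooth scalar functions. -/
abbrev Smo {n : ℕ} (f : (Fin n → ℝ) → ℝ) : Prop := ContDiff ℝ ∞ f

section pd
variable {n : ℕ} {f g : (Fin n → ℝ) → ℝ}

lemma Smo.diffAt (hf : Smo f) (x : Fin n → ℝ) : DifferentiableAt ℝ f x :=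
  (hf.differentiable (by simp)) x

lemma Smo.pder (hf : Smo f) (i : Fin n) : Smo (pder i f) := by
  have h : ContDiff ℝ ∞ (fderiv ℝ f) := hf.fderiv_right (by simp)
  exact h.clm_apply contDiff_const

lemma pder_add (hf : Smo f) (hg : Smo g) (i : Fin n) :
    pder i (fun x => f x + g x) = fun x => pder i f x + pder i g x := by
  funext x
  simp only [_root_.pder]
  rw [fderiv_fun_add (hf.diffAt x) (hg.diffAt x)]; rfl

lemma pder_sub (hf : Smo f) (hg : Smo g) (i : Fin n) :
    pder i (fun x => f x - g x) = fun x => pder i f x - pder i g x := by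
  funext x
  simp only [_root_.pder]
  rw [fderiv_fun_sub (hf.diffAt x) (hg.diffAt x)]; rfl

lemma pder_neg (i : Fin n) :
    pder i (fun x => - f x) = fun x => - pder i f x := by
  funext x
  simp only [_root_.pder]
  rw [fderiv_fun_neg]; rfl

lemma pder_mul (hf : Smo f) (hg : Smo g) (i : Fin n) :
    pder i (fun x => f x * g x) = fun x => pder i f x * g x + f x * pder i g x := by
  funext x
  simp only [_root_.pder]
  rw [fderiv_fun_mul (hf.diffAt x) (hg.diffAt x)]
  simp; ring

lemma pder_const (c : ℝ) (i : Fin n) : pder i (fun _ : Fin n → ℝ => c) = fun _ => 0 := by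
  funext x
  simp [_root_.pder]

lemma pder_const_mul (c : ℝ) (hf : Smo f) (i : Fin n) :
    pder i (fun x => c * f x) = fun x => c * pder i f x := by
  rw [pder_mul contDiff_const hf, pder_const]; funext x; ring

lemma pder_sum {ι : Type*} (s : Finset ι) {F : ι → (Fin n → ℝ) → ℝ} (hF : ∀ j, Smo (F j))
    (i : Fin n) :
    pder i (fun x => ∑ j ∈ s, F j x) = fun x => ∑ j ∈ s, pder i (F j) x := by
  funext x
  simp only [_root_.pder]
  rw [fderiv_fun_sum (fun j _ => (hF j).diffAt x)]
  simp

/-- Derivative of a composition with a function of several variables. -/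
lemma pder_comp {ι : Type} [Fintype ι] [DecidableEq ι] {F : (ι → ℝ) → ℝ} {φ : ι → (Fin n → ℝ) → ℝ}
    (hφ : ∀ j, Smo (φ j)) {x : Fin n → ℝ} (hF : DifferentiableAt ℝ F (fun j => φ j x))
    (i : Fin n) :
    pder i (fun y => F (fun j => φ j y)) x =
      ∑ j, fderiv ℝ F (fun j => φ j x) (Pi.single j 1) * pder i (φ j) x := by
  have h1 : HasFDerivAt (fun y => (fun j => φ j y))
      (ContinuousLinearMap.pi fun j => fderiv ℝ (φ j) x) x :=
    hasFDerivAt_pi.2 fun j => ((hφ j).diffAt x).hasFDerivAt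
  have h2 := (hF.hasFDerivAt.comp x h1).fderiv
  simp only [_root_.pder]
  have h3 : (F ∘ fun y => (fun j => φ j y)) = fun y => F (fun j => φ j y) := rfl
  rw [h3] at h2
  rw [h2]
  simp only [ContinuousLinearMap.comp_apply]
  set v : ι → ℝ := (ContinuousLinearMap.pi fun j => fderiv ℝ (φ j) x) (Pi.single i 1) with hv
  have h4 : v = ∑ j, (fderiv ℝ (φ j) x (Pi.single i 1)) • (Pi.single j (1:ℝ) : ι → ℝ) := by
    funext k
    simp [hv, Finset.sum_apply, Pi.single_apply]
  rw [h4, map_sum]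
  refine Finset.sum_congr rfl fun j _ => ?_
  rw [map_smul, smul_eq_mul, mul_comm]

end pd

/-- Families of scalar functions on `ℝⁿ`. -/
abbrev Fam (P : Type) (n : ℕ) : Type := P → (Fin n → ℝ) → ℝ

/-- Order-`k` symbol bounds at the points of `S p`. -/
def SO {P : Type} {n : ℕ} (S : P → Set (Fin n → ℝ)) (μ : P → ℝ) :
    ℕ → (P → ℝ) → Fam P n → Prop
  | 0, A, f => ∃ C : ℝ, ∀ p, ∀ x ∈ S p, |f p x| ≤ C * A p
  | k + 1, A, f => (∃ C : ℝ, ∀ p, ∀ x ∈ S p, |f p x| ≤ C * A p) ∧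
      ∀ i, SO S μ k (fun p => A p * μ p) (fun p => pder i (f p))

/-- Symbol class: smooth families with `|∂^β f| ≤ C_β A μ^{|β|}`. -/
def SC {P : Type} {n : ℕ} (μ A : P → ℝ) (f : Fam P n) : Prop :=
  (∀ p, Smo (f p)) ∧ ∀ k, SO (fun _ => Set.univ) μ k A f

section so
variable {P : Type} {n : ℕ} {S : P → Set (Fin n → ℝ)} {μ A B : P → ℝ} {f g : Fam P n}

lemma SO.bd {k : ℕ} (h : SO S μ k A f) : ∃ C : ℝ, ∀ p, ∀ x ∈ S p, |f p x| ≤ C * A p := by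
  cases k with
  | zero => exact h
  | succ k => exact h.1

lemma SO.pred {k : ℕ} (h : SO S μ (k+1) A f) : SO S μ k A f := by
  induction k generalizing A f with
  | zero => exact h.1
  | succ k ih => exact ⟨h.1, fun i => ih (h.2 i)⟩

lemma SO.add {k : ℕ} (hfs : ∀ p, Smo (f p)) (hgs : ∀ p, Smo (g p))
    (hf : SO S μ k A f) (hg : SO S μ k A g) : SO S μ k A (fun p x => f p x + g p x) := by
  induction k generalizing A f g with
  | zero =>
    obtain ⟨C, hC⟩ := hf; obtain ⟨C', hC'⟩ := hg
    exact ⟨C + C', fun p x hx => (abs_add_le _ _).trans (by linarith [hC p x hx, hC' p x hx])⟩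
  | succ k ih =>
    refine ⟨?_, fun i => ?_⟩
    · obtain ⟨C, hC⟩ := hf.bd; obtain ⟨C', hC'⟩ := hg.bd
      exact ⟨C + C', fun p x hx => (abs_add_le _ _).trans (by linarith [hC p x hx, hC' p x hx])⟩
    · have := ih (fun p => (hfs p).pder i) (fun p => (hgs p).pder i) (hf.2 i) (hg.2 i)
      simpa only [pder_add (hfs _) (hgs _)] using this

lemma SO.neg {k : ℕ} (hf : SO S μ k A f) : SO S μ k A (fun p x => - f p x) := by
  induction k generalizing A f with
  | zero => obtain ⟨C, hC⟩ := hf; exact ⟨C, fun p x hx => by simpa using hC p x hx⟩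
  | succ k ih =>
    refine ⟨?_, fun i => ?_⟩
    · obtain ⟨C, hC⟩ := hf.bd; exact ⟨C, fun p x hx => by simpa using hC p x hx⟩
    · simpa only [pder_neg] using ih (hf.2 i)

lemma bd_mul (hf : ∃ C : ℝ, ∀ p, ∀ x ∈ S p, |f p x| ≤ C * A p)
    (hg : ∃ C : ℝ, ∀ p, ∀ x ∈ S p, |g p x| ≤ C * B p) :
    ∃ C : ℝ, ∀ p, ∀ x ∈ S p, |f p x * g p x| ≤ C * (A p * B p) := by
  obtain ⟨C, hC⟩ := hf; obtain ⟨C', hC'⟩ := hg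
  refine ⟨C * C', fun p x hx => ?_⟩
  rw [abs_mul]
  calc |f p x| * |g p x| ≤ (C * A p) * (C' * B p) :=
        mul_le_mul (hC p x hx) (hC' p x hx) (abs_nonneg _) ((abs_nonneg _).trans (hC p x hx))
    _ = _ := by ring

lemma SO.mul {k : ℕ} (hfs : ∀ p, Smo (f p)) (hgs : ∀ p, Smo (g p))
    (hf : SO S μ k A f) (hg : SO S μ k B g) :
    SO S μ k (fun p => A p * B p) (fun p x => f p x * g p x) := by
  induction k generalizing A B f g with
  | zero => exact bd_mul hf hg
  | succ k ih =>
    refine ⟨bd_mul hf.bd hg.bd, fun i => ?_⟩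
    have h1 := ih (fun p => (hfs p).pder i) hgs (hf.2 i) hg.pred
    have h2 := ih hfs (fun p => (hgs p).pder i) hf.pred (hg.2 i)
    have e1 : (fun p => A p * μ p * B p) = fun p => A p * B p * μ p := by funext p; ring
    have e2 : (fun p => A p * (B p * μ p)) = fun p => A p * B p * μ p := by funext p; ring
    rw [e1] at h1; rw [e2] at h2
    have := SO.add (fun p => ((hfs p).pder i).mul (hgs p)) (fun p => (hfs p).mul ((hgs p).pder i)) h1 h2
    simpa only [pder_mul (hfs _) (hgs _)] using this

lemma SO.weaken {k : ℕ} {ν : P → ℝ} {c : ℝ} (hA : ∀ p, 0 ≤ A p) (hAB : ∀ p, A p ≤ c * B p)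
    (hμ : ∀ p, 0 ≤ μ p) (hν : ∀ p, μ p ≤ ν p) (hB : ∀ p, 0 ≤ B p)
    (hf : SO S μ k A f) : SO S ν k B f := by
  have key : ∀ {A B : P → ℝ} {f : Fam P n}, (∀ p, 0 ≤ A p) → (∀ p, A p ≤ c * B p) →
      (∃ C : ℝ, ∀ p, ∀ x ∈ S p, |f p x| ≤ C * A p) →
      (∃ C : ℝ, ∀ p, ∀ x ∈ S p, |f p x| ≤ C * B p) := by
    intro A B f hA hAB ⟨C, hC⟩
    refine ⟨|C| * c, fun p x hx => (hC p x hx).trans ?_⟩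
    calc C * A p ≤ |C| * A p := mul_le_mul_of_nonneg_right (le_abs_self C) (hA p)
      _ ≤ |C| * (c * B p) := mul_le_mul_of_nonneg_left (hAB p) (abs_nonneg _)
      _ = _ := by ring
  induction k generalizing A B f with
  | zero => exact key hA hAB hf
  | succ k ih =>
    refine ⟨key hA hAB hf.1, fun i => ih (fun p => mul_nonneg (hA p) (hμ p)) (fun p => ?_)
      (fun p => mul_nonneg (hB p) ((hμ p).trans (hν p))) (hf.2 i)⟩
    calc A p * μ p ≤ (c * B p) * ν p :=
          mul_le_mul (hAB p) (hν p) (hμ p) ((hA p).trans (hAB p))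
      _ = _ := by ring

lemma SO.reindex {Q : Type} (ι : Q → P) {k : ℕ} (hf : SO S μ k A f) :
    SO (fun q => S (ι q)) (fun q => μ (ι q)) k (fun q => A (ι q)) (fun q => f (ι q)) := by
  induction k generalizing A f with
  | zero => obtain ⟨C, hC⟩ := hf; exact ⟨C, fun q => hC (ι q)⟩
  | succ k ih =>
    obtain ⟨⟨C, hC⟩, h⟩ := hf
    exact ⟨⟨C, fun q => hC (ι q)⟩, fun i => ih (h i)⟩

end so

section sc
variable {P : Type} {n : ℕ} {μ A B : P → ℝ} {f g : Fam P n}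

lemma SC.smo (h : SC μ A f) (p : P) : Smo (f p) := h.1 p

lemma SC.bd (h : SC μ A f) : ∃ C : ℝ, 0 ≤ C ∧ ∀ p x, |f p x| ≤ C * |A p| := by
  obtain ⟨C, hC⟩ := (h.2 0).bd
  refine ⟨|C|, abs_nonneg _, fun p x => (hC p x trivial).trans ?_⟩
  rw [← abs_mul]; exact le_abs_self _

lemma SC.pd (h : SC μ A f) (i : Fin n) : SC μ (fun p => A p * μ p) (fun p => pder i (f p)) :=
  ⟨fun p => (h.1 p).pder i, fun k => (h.2 (k+1)).2 i⟩

lemma SC.intro (hs : ∀ p, Smo (f p)) (hb : ∃ C : ℝ, ∀ p x, |f p x| ≤ C * A p)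
    (hd : ∀ i, SC μ (fun p => A p * μ p) (fun p => pder i (f p))) : SC μ A f := by
  refine ⟨hs, fun k => ?_⟩
  obtain ⟨C, hC⟩ := hb
  cases k with
  | zero => exact ⟨C, fun p x _ => hC p x⟩
  | succ k => exact ⟨⟨C, fun p x _ => hC p x⟩, fun i => (hd i).2 k⟩

lemma SC.add (hf : SC μ A f) (hg : SC μ A g) : SC μ A (fun p x => f p x + g p x) :=
  ⟨fun p => (hf.1 p).add (hg.1 p), fun k => (hf.2 k).add hf.1 hg.1 (hg.2 k)⟩

lemma SC.neg (hf : SC μ A f) : SC μ A (fun p x => - f p x) :=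
  ⟨fun p => (hf.1 p).neg, fun k => (hf.2 k).neg⟩

lemma SC.sub (hf : SC μ A f) (hg : SC μ A g) : SC μ A (fun p x => f p x - g p x) := by
  simpa only [sub_eq_add_neg] using hf.add hg.neg

lemma SC.mul (hf : SC μ A f) (hg : SC μ B g) :
    SC μ (fun p => A p * B p) (fun p x => f p x * g p x) :=
  ⟨fun p => (hf.1 p).mul (hg.1 p), fun k => (hf.2 k).mul hf.1 hg.1 (hg.2 k)⟩

lemma SC.weaken {ν : P → ℝ} (c : ℝ) (hf : SC μ A f) (hA : ∀ p, 0 ≤ A p)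
    (hAB : ∀ p, A p ≤ c * B p)
    (hμ : ∀ p, 0 ≤ μ p) (hν : ∀ p, μ p ≤ ν p) (hB : ∀ p, 0 ≤ B p) : SC ν B f :=
  ⟨hf.1, fun k => (hf.2 k).weaken hA hAB hμ hν hB⟩

lemma SC.reindex {Q : Type} (ι : Q → P) (hf : SC μ A f) :
    SC (fun q => μ (ι q)) (fun q => A (ι q)) (fun q => f (ι q)) :=
  ⟨fun q => hf.1 (ι q), fun k => (hf.2 k).reindex ι⟩

lemma SC.zero : SC μ A (fun (_ : P) (_ : Fin n → ℝ) => (0:ℝ)) := by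
  refine ⟨fun p => contDiff_const, fun k => ?_⟩
  induction k generalizing A with
  | zero => exact ⟨0, fun p x _ => by simp⟩
  | succ k ih => exact ⟨⟨0, fun p x _ => by simp⟩, fun i => by simpa only [pder_const] using ih⟩

/-- Families of constants. -/
lemma SC.cst {c : P → ℝ} (hc : ∃ C : ℝ, ∀ p, |c p| ≤ C * A p) :
    SC μ A (fun (p : P) (_ : Fin n → ℝ) => c p) := by
  refine SC.intro (fun p => contDiff_const) ?_ fun i => ?_
  · obtain ⟨C, hC⟩ := hc; exact ⟨C, fun p _ => hC p⟩
  · simpa only [pder_const] using SC.zero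

lemma SC.const (c : ℝ) : SC μ (fun _ => 1) (fun (_ : P) (_ : Fin n → ℝ) => c) :=
  SC.cst ⟨|c|, fun _ => by simp⟩

lemma SC.congrA (hf : SC μ A f) (h : ∀ p, A p = B p) : SC μ B f := by
  rwa [show B = A from funext fun p => (h p).symm]

lemma SC.congr (hf : SC μ A f) (h : ∀ p x, f p x = g p x) : SC μ A g := by
  rwa [show g = f from funext fun p => funext fun x => (h p x).symm]

lemma SC.const_mul (c : ℝ) (hf : SC μ A f) : SC μ A (fun p x => c * f p x) :=
  ((SC.const c).mul hf).congrA fun p => one_mul _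

/-- Multiplication by a parameter-dependent nonnegative constant. -/
lemma SC.scale (c : P → ℝ) (hc : ∀ p, 0 ≤ c p) (hf : SC μ A f) :
    SC μ (fun p => c p * A p) (fun p x => c p * f p x) :=
  (SC.cst (A := c) ⟨1, fun p => by rw [abs_of_nonneg (hc p), one_mul]⟩).mul hf

lemma SC.sum {ι : Type*} (s : Finset ι) {F : ι → Fam P n} (h : ∀ j ∈ s, SC μ A (F j)) :
    SC μ A (fun p x => ∑ j ∈ s, F j p x) := by
  classical
  induction s using Finset.induction_on with
  | empty => simpa using SC.zero
  | insert a s ha ih =>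
    have := (h a (by simp)).add (ih fun j hj => h j (by simp [hj]))
    simpa only [Finset.sum_insert ha] using this

end sc
end CI

namespace CI
open scoped ContDiff

section comp
variable {P : Type} {n : ℕ} {S : P → Set (Fin n → ℝ)} {μ A B : P → ℝ}

lemma SO.zero {k : ℕ} : SO S μ k A (fun (_ : P) (_ : Fin n → ℝ) => (0:ℝ)) := by
  induction k generalizing A with
  | zero => exact ⟨0, fun p x _ => by simp⟩
  | succ k ih => exact ⟨⟨0, fun p x _ => by simp⟩, fun i => by simpa only [pder_const] using ih⟩

lemma SO.sum {ι : Type*} (s : Finset ι) {F : ι → Fam P n} {k : ℕ} (hs : ∀ j p, Smo (F j p))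
    (h : ∀ j, SO S μ k A (F j)) :
    SO S μ k A (fun p x => ∑ j ∈ s, F j p x) := by
  classical
  induction s using Finset.induction_on with
  | empty => simpa using SO.zero
  | insert a s ha ih =>
    have := (h a).add (hs a) (fun p => ContDiff.sum fun j _ => hs j p) ih
    simpa only [Finset.sum_insert ha] using this

lemma contDiffAt_pd {ι : Type} [Fintype ι] [DecidableEq ι] {F : (ι → ℝ) → ℝ} {z : ι → ℝ}
    (h : ContDiffAt ℝ ∞ F z) (j : ι) :
    ContDiffAt ℝ ∞ (fun z => fderiv ℝ F z (Pi.single j 1)) z :=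
  (h.fderiv_right (m := ∞) (by simp)).clm_apply contDiffAt_const

lemma smo_comp {ι : Type} [Fintype ι] {F : (ι → ℝ) → ℝ} {K : Set (ι → ℝ)}
    (hF : ∀ z ∈ K, ContDiffAt ℝ ∞ F z) {φ : ι → (Fin n → ℝ) → ℝ} (hφ : ∀ j, Smo (φ j))
    (hK : ∀ x, (fun j => φ j x) ∈ K) : Smo (fun x => F (fun j => φ j x)) := by
  rw [Smo, contDiff_iff_contDiffAt]
  intro x
  exact (hF _ (hK x)).comp x (f := fun x => fun j => φ j x) (contDiff_pi.2 hφ).contDiffAt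

/-- Composition with a function smooth near a compact set. -/
lemma SC.comp {ι : Type} [Fintype ι] [DecidableEq ι] {K : Set (ι → ℝ)} (hKc : IsCompact K)
    {F : (ι → ℝ) → ℝ}
    (hF : ∀ z ∈ K, ContDiffAt ℝ ∞ F z) {φ : ι → Fam P n} (hφ : ∀ j, SC μ (fun _ => 1) (φ j))
    (hK : ∀ p x, (fun j => φ j p x) ∈ K) : SC μ (fun _ => 1) (fun p x => F (fun j => φ j p x)) := by
  refine ⟨fun p => smo_comp hF (fun j => (hφ j).1 p) (hK p), fun k => ?_⟩
  induction k generalizing F with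
  | zero =>
    have hc : ContinuousOn F K := fun z hz => (hF z hz).continuousAt.continuousWithinAt
    obtain ⟨C, hC⟩ := (hKc.image_of_continuousOn hc).isBounded.exists_norm_le
    exact ⟨C, fun p x _ => by simpa using hC _ ⟨_, hK p x, rfl⟩⟩
  | succ k ih =>
    refine ⟨(ih hF).bd, fun i => ?_⟩
    have e : (fun p => pder i (fun x => F (fun j => φ j p x))) = fun p x =>
        ∑ j, fderiv ℝ F (fun j => φ j p x) (Pi.single j 1) * pder i (φ j p) x := by
      funext p x
      exact pder_comp (fun j => (hφ j).1 p) ((hF _ (hK p x)).differentiableAt (by simp)) i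
    rw [e]
    have hs : ∀ j p, Smo (fun x => fderiv ℝ F (fun j => φ j p x) (Pi.single j 1)) := fun j p =>
      smo_comp (F := fun z => fderiv ℝ F z (Pi.single j 1)) (fun z hz => contDiffAt_pd (hF z hz) j)
        (fun j => (hφ j).1 p) (hK p)
    refine SO.sum _ (fun j p => (hs j p).mul (((hφ j).1 p).pder i)) fun j => ?_
    have h1 := ih (F := fun z => fderiv ℝ F z (Pi.single j 1))
      (fun z hz => contDiffAt_pd (hF z hz) j)
    have h2 := h1.mul (hs j) (fun p => ((hφ j).1 p).pder i) (((hφ j).2 (k+1)).2 i)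
    simpa only [one_mul] using h2

lemma SC.comp_pd {ι : Type} [Fintype ι] [DecidableEq ι] {K : Set (ι → ℝ)} (hKc : IsCompact K)
    {F : (ι → ℝ) → ℝ}
    (hF : ∀ z ∈ K, ContDiffAt ℝ ∞ F z) {φ : ι → Fam P n} (hφ : ∀ j, SC μ (fun _ => 1) (φ j))
    (hK : ∀ p x, (fun j => φ j p x) ∈ K) {i : Fin n}
    (hd : ∀ j, SC μ B (fun p => pder i (φ j p))) :
    SC μ B (fun p => pder i (fun x => F (fun j => φ j p x))) := by
  have e : (fun p => pder i (fun x => F (fun j => φ j p x))) = fun p x =>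
      ∑ j, fderiv ℝ F (fun j => φ j p x) (Pi.single j 1) * pder i (φ j p) x := by
    funext p x
    exact pder_comp (fun j => (hφ j).1 p) ((hF _ (hK p x)).differentiableAt (by simp)) i
  rw [e]
  refine SC.sum _ fun j _ => ?_
  have h1 := SC.comp hKc (F := fun z => fderiv ℝ F z (Pi.single j 1))
      (fun z hz => contDiffAt_pd (hF z hz) j) hφ hK
  exact (h1.mul (hd j)).congrA fun p => one_mul _

/-- One-variable version. -/
lemma SC.comp1 {F : ℝ → ℝ} {a b : ℝ} (hF : ∀ t ∈ Set.Icc a b, ContDiffAt ℝ ∞ F t) {φ : Fam P n}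
    (hφ : SC μ (fun _ => 1) φ) (hK : ∀ p x, φ p x ∈ Set.Icc a b) :
    SC μ (fun _ => 1) (fun p x => F (φ p x)) := by
  have hc : IsCompact (Set.image (fun t : ℝ => fun _ : Unit => t) (Set.Icc a b)) :=
    isCompact_Icc.image (by fun_prop)
  refine SC.comp (ι := Unit) hc (F := fun z => F (z ())) ?_ (φ := fun _ => φ) (fun _ => hφ)
    (fun p x => ⟨_, hK p x, rfl⟩)
  rintro z ⟨t, ht, rfl⟩
  exact (hF t ht).comp (fun _ : Unit => t) (f := fun z : Unit → ℝ => z ()) (contDiff_apply ℝ ℝ ()).contDiffAt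

/-- Square roots: if `f/s²` takes values in `[a,b]`, `0<a`, then `√f ∈ S(s)`. -/
lemma SC.sqrt {s : P → ℝ} (hs : ∀ p, 0 < s p) {f : Fam P n} (hf : SC μ (fun p => s p ^ 2) f)
    {a b : ℝ} (ha : 0 < a) (h1 : ∀ p x, a * s p ^ 2 ≤ f p x) (h2 : ∀ p x, f p x ≤ b * s p ^ 2) :
    SC μ s (fun p x => √(f p x)) := by
  have hg : SC μ (fun _ => 1) (fun p x => (s p ^ 2)⁻¹ * f p x) :=
    (hf.scale (fun p => (s p ^ 2)⁻¹) (fun p => by positivity)).congrA fun p => by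
      have := (hs p).ne'; field_simp
  have h3 := SC.comp1 (F := Real.sqrt) (a := a) (b := b) (fun t ht => by
    exact Real.contDiffAt_sqrt (by linarith [ht.1])) hg (fun p x => by
      have := hs p
      have h5 : (0:ℝ) < s p ^ 2 := by positivity
      constructor
      · rw [← div_eq_inv_mul, le_div_iff₀ h5]; exact h1 p x
      · rw [← div_eq_inv_mul, div_le_iff₀ h5]; exact h2 p x)
  refine ((h3.scale s (fun p => (hs p).le)).congrA fun p => mul_one _).congr fun p x => ?_
  rw [Real.sqrt_mul (by positivity), Real.sqrt_inv, Real.sqrt_sq (hs p).le]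
  have := (hs p).ne'
  field_simp

end comp

/-- The linear phase `ξ · x`. -/
def ph {n : ℕ} (ξ x : Fin n → ℝ) : ℝ := ∑ i, ξ i * x i

section phase
variable {n : ℕ} {P : Type}

lemma smo_ph (ξ : Fin n → ℝ) : Smo (ph ξ) := by
  unfold ph
  exact ContDiff.sum fun i _ => contDiff_const.mul (contDiff_apply ℝ ℝ i)

lemma hasFDerivAt_ph (ξ x : Fin n → ℝ) :
    HasFDerivAt (ph ξ) (∑ i, ξ i • (ContinuousLinearMap.proj i : (Fin n → ℝ) →L[ℝ] ℝ)) x := by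
  have : ph ξ = fun x => (∑ i, ξ i • (ContinuousLinearMap.proj i : (Fin n → ℝ) →L[ℝ] ℝ)) x := by
    funext x; simp [ph]
  rw [this]
  exact ContinuousLinearMap.hasFDerivAt _

lemma smo_cos (l : ℝ) (ξ : Fin n → ℝ) : Smo (fun x => Real.cos (l * ph ξ x)) :=
  Real.contDiff_cos.comp (contDiff_const.mul (smo_ph ξ))

lemma smo_sin (l : ℝ) (ξ : Fin n → ℝ) : Smo (fun x => Real.sin (l * ph ξ x)) :=
  Real.contDiff_sin.comp (contDiff_const.mul (smo_ph ξ))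

lemma pder_cos (l : ℝ) (ξ : Fin n → ℝ) (i : Fin n) :
    pder i (fun x => Real.cos (l * ph ξ x)) = fun x => - (l * ξ i) * Real.sin (l * ph ξ x) := by
  funext x
  have := (((hasFDerivAt_ph ξ x).const_mul l).cos).fderiv
  simp only [pder]
  rw [this]
  simp [Pi.single_apply]; ring

lemma pder_sin (l : ℝ) (ξ : Fin n → ℝ) (i : Fin n) :
    pder i (fun x => Real.sin (l * ph ξ x)) = fun x => (l * ξ i) * Real.cos (l * ph ξ x) := by
  funext x
  have := (((hasFDerivAt_ph ξ x).const_mul l).sin).fderiv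
  simp only [pder]
  rw [this]
  simp [Pi.single_apply]; ring

lemma SO.trig {lam : P → ℝ} (hl : ∀ p, 0 ≤ lam p) (ξ : Fin n → ℝ) (k : ℕ) :
    ∀ (A : P → ℝ) (c : ℝ), (∀ p, 0 ≤ A p) →
    SO (fun _ => Set.univ) lam k A (fun p x => A p * c * Real.cos (lam p * ph ξ x)) ∧
    SO (fun _ => Set.univ) lam k A (fun p x => A p * c * Real.sin (lam p * ph ξ x)) := by
  have key : ∀ (a c t : ℝ), 0 ≤ a → |t| ≤ 1 → |a * c * t| ≤ |c| * a := by
    intro a c t ha ht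
    rw [abs_mul, abs_mul, abs_of_nonneg ha]
    nlinarith [mul_nonneg ha (abs_nonneg c), abs_nonneg t]
  induction k with
  | zero =>
    intro A c hA
    exact ⟨⟨|c|, fun p x _ => key _ _ _ (hA p) (Real.abs_cos_le_one _)⟩,
      ⟨|c|, fun p x _ => key _ _ _ (hA p) (Real.abs_sin_le_one _)⟩⟩
  | succ k ih =>
    intro A c hA
    refine ⟨⟨⟨|c|, fun p x _ => key _ _ _ (hA p) (Real.abs_cos_le_one _)⟩, fun i => ?_⟩,
      ⟨⟨|c|, fun p x _ => key _ _ _ (hA p) (Real.abs_sin_le_one _)⟩, fun i => ?_⟩⟩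
    · have := (ih (fun p => A p * lam p) (-(c * ξ i)) (fun p => mul_nonneg (hA p) (hl p))).2
      convert this using 3 with p x
      rw [pder_const_mul _ (smo_cos _ _), pder_cos]; beta_reduce; ring
    · have := (ih (fun p => A p * lam p) (c * ξ i) (fun p => mul_nonneg (hA p) (hl p))).1
      convert this using 3 with p x
      rw [pder_const_mul _ (smo_sin _ _), pder_sin]; beta_reduce; ring

lemma SC.cosph {lam : P → ℝ} (hl : ∀ p, 0 ≤ lam p) (ξ : Fin n → ℝ) :
    SC lam (fun _ => 1) (fun p x => Real.cos (lam p * ph ξ x)) :=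
  ⟨fun p => smo_cos _ _, fun k => by simpa using (SO.trig hl ξ k (fun _ => 1) 1 (by simp)).1⟩

lemma SC.sinph {lam : P → ℝ} (hl : ∀ p, 0 ≤ lam p) (ξ : Fin n → ℝ) :
    SC lam (fun _ => 1) (fun p x => Real.sin (lam p * ph ξ x)) :=
  ⟨fun p => smo_sin _ _, fun k => by simpa using (SO.trig hl ξ k (fun _ => 1) 1 (by simp)).2⟩

end phase
end CI

namespace CI
open scoped ContDiff

/-- Abstract oscillating symbol classes with slow frequency `μ` and fast frequency `lam`. -/
structure OCl (P : Type) (n : ℕ) (μ lam : P → ℝ) (Ξ : Set (Fin n → ℝ)) where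
  O : (P → ℝ) → Fam P n → Prop
  toSC : ∀ {A f}, (∀ p, 0 ≤ A p) → O A f → SC lam A f
  add : ∀ {A f g}, O A f → O A g → O A (fun p x => f p x + g p x)
  mul : ∀ {A B f g}, O A f → O B g → O (fun p => A p * B p) (fun p x => f p x * g p x)
  weaken : ∀ {A B f} (c : ℝ), O A f → (∀ p, 0 ≤ A p) → (∀ p, A p ≤ c * B p) → (∀ p, 0 ≤ B p) → O B f
  slow : ∀ {A f}, SC μ A f → O A f
  pd : ∀ {A f} (i : Fin n), (∀ p, 0 ≤ A p) → O A f → O (fun p => A p * lam p) (fun p => pder i (f p))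
  cos : ∀ ξ ∈ Ξ, O (fun _ => 1) (fun p x => Real.cos (lam p * ph ξ x))
  sin : ∀ ξ ∈ Ξ, O (fun _ => 1) (fun p x => Real.sin (lam p * ph ξ x))

/-- The symbol class at the fast frequency is such a class. -/
def OCl.ofSC {P : Type} {n : ℕ} {μ lam : P → ℝ} (hμ : ∀ p, 0 ≤ μ p) (hl : ∀ p, μ p ≤ lam p)
    (Ξ : Set (Fin n → ℝ)) : OCl P n μ lam Ξ where
  O A f := SC lam (fun p => |A p|) f
  toSC hA h := h.congrA fun p => abs_of_nonneg (hA p)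
  add h1 h2 := h1.add h2
  mul h1 h2 := (h1.mul h2).congrA fun p => (abs_mul _ _).symm
  weaken c h hA hAB hB := h.weaken c (fun p => abs_nonneg _)
    (fun p => by rw [abs_of_nonneg (hA p), abs_of_nonneg (hB p)]; exact hAB p)
    (fun p => (hμ p).trans (hl p)) (fun p => le_rfl) (fun p => abs_nonneg _)
  slow h := by
    refine ⟨h.1, fun k => ?_⟩
    have key : ∀ k {A A' : P → ℝ} {f : Fam P n}, (∀ p, |A p| ≤ A' p) →
        SO (fun _ => Set.univ) μ k A f → SO (fun _ => Set.univ) lam k A' f := by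
      intro k
      have b : ∀ {A A' : P → ℝ} {f : Fam P n}, (∀ p, |A p| ≤ A' p) →
        (∃ C : ℝ, ∀ p, ∀ x ∈ (Set.univ : Set (Fin n → ℝ)), |f p x| ≤ C * A p) →
        (∃ C : ℝ, ∀ p, ∀ x ∈ (Set.univ : Set (Fin n → ℝ)), |f p x| ≤ C * A' p) := by
        rintro A A' f hA ⟨C, hC⟩
        refine ⟨|C|, fun p x hx => (hC p x hx).trans ((le_abs_self _).trans ?_)⟩
        rw [abs_mul]; exact mul_le_mul_of_nonneg_left (hA p) (abs_nonneg _)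
      induction k with
      | zero => intro A A' f hA h; exact b hA h
      | succ k ih =>
        intro A A' f hA h
        refine ⟨b hA h.1, fun i => ih (fun p => ?_) (h.2 i)⟩
        rw [abs_mul, abs_of_nonneg (hμ p)]
        exact mul_le_mul (hA p) (hl p) (hμ p) ((abs_nonneg _).trans (hA p))
    exact key k (fun p => le_rfl) (h.2 k)
  pd i hA h := (h.pd i).congrA fun p => by
    rw [abs_mul, abs_of_nonneg ((hμ p).trans (hl p))]
  cos ξ _ := (SC.cosph (fun p => (hμ p).trans (hl p)) ξ).congrA fun p => by simp
  sin ξ _ := (SC.sinph (fun p => (hμ p).trans (hl p)) ξ).congrA fun p => by simp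

section ocl
variable {P : Type} {n d : ℕ} {μ lam : P → ℝ} {Ξ : Set (Fin n → ℝ)} (W : OCl P n μ lam Ξ)
  {A B : P → ℝ} {f g : Fam P n}

lemma OCl.congr (h : W.O A f) (e : ∀ p x, f p x = g p x) : W.O A g := by
  rwa [show g = f from funext fun p => funext fun x => (e p x).symm]

lemma OCl.congrA (h : W.O A f) (e : ∀ p, A p = B p) : W.O B f := by
  rwa [show B = A from funext fun p => (e p).symm]

lemma OCl.cmul (c : ℝ) (h : W.O A f) : W.O A (fun p x => c * f p x) :=
  W.congrA (W.mul (W.slow (SC.const c)) h) fun p => one_mul _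

lemma OCl.neg (h : W.O A f) : W.O A (fun p x => - f p x) :=
  W.congr (W.cmul (-1) h) fun p x => by ring

lemma OCl.sub (h : W.O A f) (h' : W.O A g) : W.O A (fun p x => f p x - g p x) :=
  W.congr (W.add h (W.neg h')) fun p x => by ring

lemma OCl.zero : W.O A (fun _ _ => 0) := W.slow SC.zero

lemma OCl.sum {ι : Type*} (s : Finset ι) {F : ι → Fam P n} (h : ∀ j ∈ s, W.O A (F j)) :
    W.O A (fun p x => ∑ j ∈ s, F j p x) := by
  classical
  induction s using Finset.induction_on with
  | empty => simpa using W.zero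
  | insert a s ha ih =>
    have := W.add (h a (by simp)) (ih fun j hj => h j (by simp [hj]))
    simpa only [Finset.sum_insert ha] using this

lemma OCl.dot {F G : Fin d → Fam P n} (hF : ∀ a, W.O A (F a)) (hG : ∀ a, W.O B (G a)) :
    W.O (fun p => A p * B p) (fun p x => ∑ a, F a p x * G a p x) :=
  W.sum _ fun a _ => W.mul (hF a) (hG a)

end ocl

/-- An immersion family with normal frame `ν` and dual tangent frame `θ`. -/
structure Geo {P : Type} {n d : ℕ} (s μ : P → ℝ) (u : Fin d → Fam P n)
    (ν θ : Fin n → Fin d → Fam P n) : Prop where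
  us : ∀ a p, Smo (u a p)
  u1 : ∀ i a, SC μ (fun _ => 1) (fun p => pder i (u a p))
  u2 : ∀ i j a, SC μ (fun p => s p * μ p) (fun p => pder j (pder i (u a p)))
  n1 : ∀ k a, SC μ (fun _ => 1) (ν k a)
  n2 : ∀ j k a, SC μ (fun p => s p * μ p) (fun p => pder j (ν k a p))
  t1 : ∀ k a, SC μ (fun _ => 1) (θ k a)
  t2 : ∀ j k a, SC μ (fun p => s p * μ p) (fun p => pder j (θ k a p))
  un : ∀ p x i k, ∑ a, pder i (u a p) x * ν k a p x = 0
  nn : ∀ p x k l, ∑ a, ν k a p x * ν l a p x = if k = l then 1 else 0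
  ut : ∀ p x i l, ∑ a, pder i (u a p) x * θ l a p x = if i = l then 1 else 0

/-- The corrugation profile `√2 sin(lam ξ·x)/lam`. -/
def Gam {P : Type} {n : ℕ} (lam : P → ℝ) (ξ : Fin n → ℝ) : Fam P n :=
  fun p x => √2 / lam p * Real.sin (lam p * ph ξ x)

/-- The perturbation `V(a,w)`. -/
def VV {P : Type} {n d : ℕ} (lam : P → ℝ) (ξ : Fin n → Fin n → ℝ) (ν θ : Fin n → Fin d → Fam P n)
    (a w : Fin n → Fam P n) (b : Fin d) : Fam P n :=
  fun p x => (∑ k, a k p x * Gam lam (ξ k) p x * ν k b p x) + ∑ l, w l p x * θ l b p x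

/-- Main part of `∂_i V`. -/
def MM {P : Type} {n d : ℕ} (lam : P → ℝ) (ξ : Fin n → Fin n → ℝ) (ν : Fin n → Fin d → Fam P n)
    (a : Fin n → Fam P n) (i : Fin n) (b : Fin d) : Fam P n :=
  fun p x => ∑ k, a k p x * (√2 * ξ k i * Real.cos (lam p * ph (ξ k) x)) * ν k b p x

/-- Remainder of `∂_i V`. -/
def YY {P : Type} {n d : ℕ} (lam : P → ℝ) (ξ : Fin n → Fin n → ℝ) (ν θ : Fin n → Fin d → Fam P n)
    (a w : Fin n → Fam P n) (i : Fin n) (b : Fin d) : Fam P n :=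
  fun p x => (∑ k, Gam lam (ξ k) p x *
      (pder i (a k p) x * ν k b p x + a k p x * pder i (ν k b p) x)) +
    ∑ l, (pder i (w l p) x * θ l b p x + w l p x * pder i (θ l b p) x)

/-- The metric increment of `V`. -/
def XX {P : Type} {n d : ℕ} (u V : Fin d → Fam P n) (i j : Fin n) : Fam P n :=
  fun p x => ∑ b, (pder i (u b p) x * pder j (V b p) x + pder i (V b p) x * pder j (u b p) x
    + pder i (V b p) x * pder j (V b p) x)

/-- The mixed error. -/
def QQ {P : Type} {n d : ℕ} (lam : P → ℝ) (ξ : Fin n → Fin n → ℝ) (u : Fin d → Fam P n)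
    (ν θ : Fin n → Fin d → Fam P n)
    (a w : Fin n → Fam P n) (i j : Fin n) : Fam P n :=
  fun p x => (∑ k, Gam lam (ξ k) p x * (a k p x * ∑ b, pder i (u b p) x * pder j (ν k b p) x)) +
    ∑ l, (w l p x * ∑ b, pder i (u b p) x * pder j (θ l b p) x)

section step
variable {P : Type} {n d : ℕ} {s μ lam ρ : P → ℝ} {u : Fin d → Fam P n}
  {ν θ : Fin n → Fin d → Fam P n} {ξ : Fin n → Fin n → ℝ} {a w : Fin n → Fam P n}

lemma smo_Gam (ξ : Fin n → ℝ) (p : P) : Smo (Gam lam ξ p) :=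
  contDiff_const.mul (smo_sin _ _)

lemma pder_Gam (hl : ∀ p, lam p ≠ 0) (ξ : Fin n → ℝ) (p : P) (i : Fin n) :
    pder i (Gam lam ξ p) = fun x => √2 * ξ i * Real.cos (lam p * ph ξ x) := by
  unfold Gam
  rw [pder_const_mul _ (smo_sin _ _), pder_sin]
  funext x
  have := hl p
  field_simp

lemma smo_VV (G : Geo s μ u ν θ) (ha : ∀ k p, Smo (a k p)) (hw : ∀ k p, Smo (w k p)) (b : Fin d)
    (p : P) : Smo (VV lam ξ ν θ a w b p) :=
  (ContDiff.sum fun k _ => ((ha k p).mul (smo_Gam _ p)).mul ((G.n1 k b).1 p)).add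
    (ContDiff.sum fun l _ => (hw l p).mul ((G.t1 l b).1 p))

lemma pder_VV (hl : ∀ p, lam p ≠ 0) (G : Geo s μ u ν θ) (ha : ∀ k p, Smo (a k p))
    (hw : ∀ k p, Smo (w k p)) (b : Fin d)
    (p : P) (i : Fin n) (x : Fin n → ℝ) : pder i (VV lam ξ ν θ a w b p) x =
      MM lam ξ ν a i b p x + YY lam ξ ν θ a w i b p x := by
  unfold VV
  have hn := fun k => (G.n1 k b).1 p
  have ht := fun k => (G.t1 k b).1 p
  rw [pder_add (ContDiff.sum fun k _ => ((ha k p).mul (smo_Gam _ p)).mul (hn k))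
    (ContDiff.sum fun l _ => (hw l p).mul (ht l)),
    pder_sum _ (fun k => ((ha k p).mul (smo_Gam _ p)).mul (hn k)),
    pder_sum _ (fun l => (hw l p).mul (ht l))]
  simp only [MM, YY]
  have e1 : ∀ k, pder i (fun x => a k p x * Gam lam (ξ k) p x * ν k b p x) x =
      a k p x * (√2 * ξ k i * Real.cos (lam p * ph (ξ k) x)) * ν k b p x +
      Gam lam (ξ k) p x * (pder i (a k p) x * ν k b p x + a k p x * pder i (ν k b p) x) := by
    intro k
    rw [pder_mul ((ha k p).mul (smo_Gam _ p)) (hn k), pder_mul (ha k p) (smo_Gam _ p),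
      pder_Gam hl]
    ring
  have e2 : ∀ l, pder i (fun x => w l p x * θ l b p x) x =
      pder i (w l p) x * θ l b p x + w l p x * pder i (θ l b p) x := by
    intro l; rw [pder_mul (hw l p) (ht l)]
  simp only [e1, e2, Finset.sum_add_distrib]
  ring

lemma dot_uV (hl : ∀ p, lam p ≠ 0) (G : Geo s μ u ν θ) (ha : ∀ k p, Smo (a k p))
    (hw : ∀ k p, Smo (w k p)) (p : P) (i j : Fin n) (x : Fin n → ℝ) :
    ∑ b, pder i (u b p) x * pder j (VV lam ξ ν θ a w b p) x =
      pder j (w i p) x + QQ lam ξ u ν θ a w i j p x := by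
  simp only [pder_VV hl G ha hw, MM, YY, QQ]
  simp only [mul_add, Finset.mul_sum, Finset.sum_add_distrib]
  have e0 : ∀ k, ∑ b, pder i (u b p) x * ν k b p x = 0 := G.un p x i
  have e1 : ∑ b, ∑ k, pder i (u b p) x * (a k p x * (√2 * ξ k i * Real.cos (lam p * ph (ξ k) x)) * ν k b p x) = 0 := by
    rw [Finset.sum_comm]
    refine Finset.sum_eq_zero fun k _ => ?_
    have : ∀ b, pder i (u b p) x * (a k p x * (√2 * ξ k i * Real.cos (lam p * ph (ξ k) x)) * ν k b p x)
      = (a k p x * (√2 * ξ k i * Real.cos (lam p * ph (ξ k) x))) * (pder i (u b p) x * ν k b p x) := fun b => by ring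
    simp only [this, ← Finset.mul_sum, e0, mul_zero]
  have e1' : ∑ b, ∑ k, pder i (u b p) x * (a k p x * (√2 * ξ k j * Real.cos (lam p * ph (ξ k) x)) * ν k b p x) = 0 := by
    rw [Finset.sum_comm]
    refine Finset.sum_eq_zero fun k _ => ?_
    have : ∀ b, pder i (u b p) x * (a k p x * (√2 * ξ k j * Real.cos (lam p * ph (ξ k) x)) * ν k b p x)
      = (a k p x * (√2 * ξ k j * Real.cos (lam p * ph (ξ k) x))) * (pder i (u b p) x * ν k b p x) := fun b => by ring
    simp only [this, ← Finset.mul_sum, e0, mul_zero]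
  have e2 : ∑ b, ∑ k, pder i (u b p) x * (Gam lam (ξ k) p x * (pder j (a k p) x * ν k b p x)) = 0 := by
    rw [Finset.sum_comm]
    refine Finset.sum_eq_zero fun k _ => ?_
    have : ∀ b, pder i (u b p) x * (Gam lam (ξ k) p x * (pder j (a k p) x * ν k b p x))
      = (Gam lam (ξ k) p x * pder j (a k p) x) * (pder i (u b p) x * ν k b p x) := fun b => by ring
    simp only [this, ← Finset.mul_sum, e0, mul_zero]
  have e3 : ∑ b, ∑ l, pder i (u b p) x * (pder j (w l p) x * θ l b p x) = pder j (w i p) x := by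
    rw [Finset.sum_comm]
    have : ∀ l, ∑ b, pder i (u b p) x * (pder j (w l p) x * θ l b p x)
      = pder j (w l p) x * ∑ b, (pder i (u b p) x * θ l b p x) := fun l => by
        rw [Finset.mul_sum]; exact Finset.sum_congr rfl fun b _ => by ring
    simp only [this, G.ut, mul_ite, mul_one, mul_zero, Finset.sum_ite_eq, Finset.mem_univ, if_true]
  rw [e1', e2, e3, Finset.sum_comm, Finset.sum_comm (s := Finset.univ (α := Fin d))]
  simp only [zero_add]
  have e4 : ∀ k b, pder i (u b p) x * (Gam lam (ξ k) p x * (a k p x * pder j (ν k b p) x)) =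
    Gam lam (ξ k) p x * (a k p x * (pder i (u b p) x * pder j (ν k b p) x)) := fun k b => by ring
  have e5 : ∀ l b, pder i (u b p) x * (w l p x * pder j (θ l b p) x) =
    w l p x * (pder i (u b p) x * pder j (θ l b p) x) := fun k b => by ring
  simp only [e4, e5]
  ring

lemma dot_MM (G : Geo s μ u ν θ) (p : P) (i j : Fin n) (x : Fin n → ℝ) :
    ∑ b, MM lam ξ ν a i b p x * MM lam ξ ν a j b p x =
      ∑ k, a k p x ^ 2 * (2 * Real.cos (lam p * ph (ξ k) x) ^ 2) * (ξ k i * ξ k j) := by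
  simp only [MM, Finset.sum_mul_sum]
  rw [Finset.sum_comm]
  refine Finset.sum_congr rfl fun k _ => ?_
  rw [Finset.sum_comm]
  have : ∀ l, ∑ b, a k p x * (√2 * ξ k i * Real.cos (lam p * ph (ξ k) x)) * ν k b p x *
      (a l p x * (√2 * ξ l j * Real.cos (lam p * ph (ξ l) x)) * ν l b p x) =
      a k p x * (√2 * ξ k i * Real.cos (lam p * ph (ξ k) x)) *
      (a l p x * (√2 * ξ l j * Real.cos (lam p * ph (ξ l) x))) * ∑ b, ν k b p x * ν l b p x := by
    intro l; rw [Finset.mul_sum]; exact Finset.sum_congr rfl fun b _ => by ring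
  simp only [this, G.nn, mul_ite, mul_one, mul_zero, Finset.sum_ite_eq, Finset.mem_univ, if_true]
  have h2 : √2 * √2 = 2 := Real.mul_self_sqrt (by norm_num)
  linear_combination (a k p x ^ 2 * Real.cos (lam p * ph (ξ k) x) ^ 2 * ξ k i * ξ k j) * h2

end step
end CI

namespace CI
open scoped ContDiff

/-- The quadratic-and-mixed remainder of the metric increment. -/
def RR {P : Type} {n d : ℕ} (lam : P → ℝ) (ξ : Fin n → Fin n → ℝ) (u : Fin d → Fam P n)
    (ν θ : Fin n → Fin d → Fam P n)
    (a w : Fin n → Fam P n) (i j : Fin n) : Fam P n :=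
  fun p x => QQ lam ξ u ν θ a w i j p x + QQ lam ξ u ν θ a w j i p x
    + ∑ b, (MM lam ξ ν a i b p x * YY lam ξ ν θ a w j b p x
      + YY lam ξ ν θ a w i b p x * MM lam ξ ν a j b p x
      + YY lam ξ ν θ a w i b p x * YY lam ξ ν θ a w j b p x)

section stepd
variable {P : Type} {n d : ℕ} {s μ lam ρ : P → ℝ} {u : Fin d → Fam P n}
  {ν θ : Fin n → Fin d → Fam P n} {ξ : Fin n → Fin n → ℝ} {a w a' w' : Fin n → Fam P n}
  {Ξ : Set (Fin n → ℝ)}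

lemma XX_eq (hl : ∀ p, lam p ≠ 0) (G : Geo s μ u ν θ) (ha : ∀ k p, Smo (a k p))
    (hw : ∀ k p, Smo (w k p)) (p : P) (i j : Fin n) (x : Fin n → ℝ) :
    XX u (VV lam ξ ν θ a w) i j p x = pder j (w i p) x + pder i (w j p) x
      + ∑ k, a k p x ^ 2 * (2 * Real.cos (lam p * ph (ξ k) x) ^ 2) * (ξ k i * ξ k j)
      + RR lam ξ u ν θ a w i j p x := by
  have h1 := dot_uV (ξ := ξ) hl G ha hw p i j x
  have h2 := dot_uV (ξ := ξ) hl G ha hw p j i x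
  have h3 := dot_MM (lam := lam) (ξ := ξ) (a := a) G p i j x
  have h4 : ∑ b, pder i (VV lam ξ ν θ a w b p) x * pder j (VV lam ξ ν θ a w b p) x =
    ∑ b, MM lam ξ ν a i b p x * MM lam ξ ν a j b p x
      + ∑ b, (MM lam ξ ν a i b p x * YY lam ξ ν θ a w j b p x
      + YY lam ξ ν θ a w i b p x * MM lam ξ ν a j b p x
      + YY lam ξ ν θ a w i b p x * YY lam ξ ν θ a w j b p x) := by
    rw [← Finset.sum_add_distrib]
    refine Finset.sum_congr rfl fun b _ => ?_
    rw [pder_VV hl G ha hw, pder_VV hl G ha hw]; ring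
  have h5 : ∑ b, pder i (VV lam ξ ν θ a w b p) x * pder j (u b p) x =
      ∑ b, pder j (u b p) x * pder i (VV lam ξ ν θ a w b p) x :=
    Finset.sum_congr rfl fun b _ => mul_comm _ _
  simp only [XX, Finset.sum_add_distrib]
  rw [h5, h1, h2, h4, h3]
  simp only [RR, Finset.sum_add_distrib]
  ring

/-- Standing size hypotheses for a step. -/
structure Siz (s μ lam : P → ℝ) : Prop where
  s0 : ∀ p, 0 ≤ s p
  m0 : ∀ p, 0 < μ p
  ml : ∀ p, μ p ≤ lam p
  sl : ∀ p, s p * lam p ≤ μ p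

lemma Siz.l0 (Z : Siz s μ lam) (p : P) : 0 < lam p := (Z.m0 p).trans_le (Z.ml p)

lemma Siz.se (Z : Siz s μ lam) (p : P) : s p ≤ μ p / lam p := by
  rw [le_div_iff₀ (Z.l0 p)]; exact Z.sl p

lemma Siz.e0 (Z : Siz s μ lam) (p : P) : 0 < μ p / lam p := div_pos (Z.m0 p) (Z.l0 p)

lemma Siz.e1 (Z : Siz s μ lam) (p : P) : μ p / lam p ≤ 1 := by
  rw [div_le_one (Z.l0 p)]; exact Z.ml p

lemma Siz.s1 (Z : Siz s μ lam) (p : P) : s p ≤ 1 := (Z.se p).trans (Z.e1 p)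

variable (W : OCl P n μ lam Ξ) (Z : Siz s μ lam) (hξ : ∀ k, ξ k ∈ Ξ) (G : Geo s μ u ν θ)

lemma O_Gam (Z : Siz s μ lam) {η : Fin n → ℝ} (hη : η ∈ Ξ) : W.O (fun p => 1 / lam p) (Gam lam η) := by
  have h1 : SC μ (fun p => 1 / lam p) (fun (p : P) (_ : Fin n → ℝ) => √2 / lam p) :=
    SC.cst ⟨√2, fun p => by
      rw [abs_of_nonneg (div_nonneg (Real.sqrt_nonneg _) (Z.l0 p).le)]; exact le_of_eq (by ring)⟩
  exact W.congrA (W.mul (W.slow h1) (W.sin η hη)) fun p => mul_one _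

lemma O_MM (hξ : ∀ k, ξ k ∈ Ξ) (G : Geo s μ u ν θ) {A : P → ℝ} (ha : ∀ k, SC μ A (a k)) (i : Fin n) (b : Fin d) :
    W.O A (MM lam ξ ν a i b) := by
  refine W.sum _ fun k _ => ?_
  refine W.congrA (W.mul (W.mul (W.slow (ha k)) (W.cmul (√2 * ξ k i) (W.cos _ (hξ k))))
    (W.slow (G.n1 k b))) fun p => by ring

lemma O_YY (Z : Siz s μ lam) (hξ : ∀ k, ξ k ∈ Ξ) (G : Geo s μ u ν θ) (hρ0 : ∀ p, 0 ≤ ρ p) (ha : ∀ k, SC μ (fun p => s p * ρ p) (a k))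
    (hw : ∀ k, W.O (fun p => s p ^ 2 * ρ p / lam p) (w k)) (i : Fin n) (b : Fin d) :
    W.O (fun p => s p * ρ p * (μ p / lam p)) (YY lam ξ ν θ a w i b) := by
  have hB : ∀ p, 0 ≤ s p * ρ p * (μ p / lam p) := fun p =>
    mul_nonneg (mul_nonneg (Z.s0 p) (hρ0 p)) (Z.e0 p).le
  refine W.add (W.sum _ fun k _ => ?_) (W.sum _ fun l _ => ?_)
  · have h1 : SC μ (fun p => s p * ρ p * μ p)
        (fun p x => pder i (a k p) x * ν k b p x + a k p x * pder i (ν k b p) x) := by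
      refine SC.add (((ha k).pd i).mul (G.n1 k b) |>.congrA fun p => by ring) ?_
      refine ((ha k).mul (G.n2 i k b)).weaken 1 (fun p => ?_) (fun p => ?_) (fun p => (Z.m0 p).le)
        (fun p => le_rfl) (fun p => ?_)
      · have := Z.s0 p; have := hρ0 p; have := (Z.m0 p).le; positivity
      · have h0 : 0 ≤ s p * ρ p * μ p := mul_nonneg (mul_nonneg (Z.s0 p) (hρ0 p)) (Z.m0 p).le
        nlinarith [Z.s1 p]
      · have := Z.s0 p; have := hρ0 p; have := (Z.m0 p).le; positivity
    exact W.congrA (W.mul (O_Gam W Z (hξ k)) (W.slow h1)) fun p => by ring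
  · have hA : ∀ p, 0 ≤ s p ^ 2 * ρ p / lam p := fun p =>
      div_nonneg (mul_nonneg (sq_nonneg _) (hρ0 p)) (Z.l0 p).le
    refine W.add ?_ ?_
    · refine W.weaken 1 (W.mul (W.pd i hA (hw l)) (W.slow (G.t1 l b))) (fun p => ?_) (fun p => ?_) hB
      · have := hA p; have := (Z.l0 p).le; positivity
      · have := (Z.l0 p).ne'
        have e : s p ^ 2 * ρ p / lam p * lam p * 1 = s p * ρ p * s p := by field_simp
        rw [e, one_mul]
        exact mul_le_mul_of_nonneg_left (Z.se p) (mul_nonneg (Z.s0 p) (hρ0 p))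
    · refine W.weaken 1 (W.mul (hw l) (W.slow (G.t2 i l b))) (fun p => ?_) (fun p => ?_) hB
      · have := hA p; have := (Z.m0 p).le; have := Z.s0 p; positivity
      · have e : s p ^ 2 * ρ p / lam p * (s p * μ p) = s p * ρ p * (μ p / lam p) * s p ^ 2 := by ring
        rw [e, one_mul]
        exact mul_le_of_le_one_right (hB p) (pow_le_one₀ (Z.s0 p) (Z.s1 p))

lemma O_QQ (Z : Siz s μ lam) (hξ : ∀ k, ξ k ∈ Ξ) (G : Geo s μ u ν θ) (hρ0 : ∀ p, 0 ≤ ρ p) (ha : ∀ k, SC μ (fun p => s p * ρ p) (a k))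
    (hw : ∀ k, W.O (fun p => s p ^ 2 * ρ p / lam p) (w k)) (i j : Fin n) :
    W.O (fun p => s p ^ 2 * ρ p * (μ p / lam p)) (QQ lam ξ u ν θ a w i j) := by
  have hB : ∀ p, 0 ≤ s p ^ 2 * ρ p * (μ p / lam p) := fun p =>
    mul_nonneg (mul_nonneg (sq_nonneg _) (hρ0 p)) (Z.e0 p).le
  refine W.add (W.sum _ fun k _ => ?_) (W.sum _ fun l _ => ?_)
  · refine W.congrA (W.mul (O_Gam W Z (hξ k)) (W.slow ((ha k).mul
      (SC.sum _ fun b _ => (G.u1 i b).mul (G.n2 j k b))))) fun p => by ring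
  · refine W.weaken 1 (W.mul (hw l) (W.slow (SC.sum _ fun b _ => (G.u1 i b).mul (G.t2 j l b))))
      (fun p => ?_) (fun p => ?_) hB
    · have := hρ0 p; have := (Z.m0 p).le; have := Z.s0 p; have := (Z.l0 p).le; positivity
    · have e : s p ^ 2 * ρ p / lam p * (1 * (s p * μ p)) = s p ^2 * ρ p * (μ p / lam p) * s p := by ring
      rw [e, one_mul]
      exact mul_le_of_le_one_right (hB p) (Z.s1 p)

lemma MM_sub (p : P) (x : Fin n → ℝ) (i : Fin n) (b : Fin d) :
    MM lam ξ ν a' i b p x - MM lam ξ ν a i b p x =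
      MM lam ξ ν (fun k p x => a' k p x - a k p x) i b p x := by
  simp only [MM, ← Finset.sum_sub_distrib]
  exact Finset.sum_congr rfl fun k _ => by ring

lemma YY_sub (ha : ∀ k p, Smo (a k p)) (ha' : ∀ k p, Smo (a' k p))
    (hw : ∀ k p, Smo (w k p)) (hw' : ∀ k p, Smo (w' k p))
    (p : P) (x : Fin n → ℝ) (i : Fin n) (b : Fin d) :
    YY lam ξ ν θ a' w' i b p x - YY lam ξ ν θ a w i b p x =
      YY lam ξ ν θ (fun k p x => a' k p x - a k p x) (fun k p x => w' k p x - w k p x) i b p x := by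
  simp only [YY, pder_sub (ha' _ _) (ha _ _), pder_sub (hw' _ _) (hw _ _)]
  rw [add_sub_add_comm, ← Finset.sum_sub_distrib, ← Finset.sum_sub_distrib]
  congr 1 <;> exact Finset.sum_congr rfl fun k _ => by ring

lemma QQ_sub (p : P) (x : Fin n → ℝ) (i j : Fin n) :
    QQ lam ξ u ν θ a' w' i j p x - QQ lam ξ u ν θ a w i j p x =
      QQ lam ξ u ν θ (fun k p x => a' k p x - a k p x) (fun k p x => w' k p x - w k p x) i j p x := by
  simp only [QQ]
  rw [add_sub_add_comm, ← Finset.sum_sub_distrib, ← Finset.sum_sub_distrib]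
  congr 1 <;> exact Finset.sum_congr rfl fun k _ => by ring

lemma O_RR (Z : Siz s μ lam) (hξ : ∀ k, ξ k ∈ Ξ) (G : Geo s μ u ν θ) (ha : ∀ k, SC μ s (a k))
    (hw : ∀ k, W.O (fun p => s p ^ 2 / lam p) (w k)) (i j : Fin n) :
    W.O (fun p => s p ^ 2 * (μ p / lam p)) (RR lam ξ u ν θ a w i j) := by
  have ha1 : ∀ k, SC μ (fun p => s p * 1) (a k) := fun k => (ha k).congrA fun p => by ring
  have hw1 : ∀ k, W.O (fun p => s p ^ 2 * 1 / lam p) (w k) := fun k => W.congrA (hw k) fun p => by ring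
  have hQ := O_QQ (ρ := fun _ => 1) W Z hξ G (by simp) ha1 hw1
  have hY := O_YY (ρ := fun _ => 1) W Z hξ G (by simp) ha1 hw1
  have hM := O_MM W hξ G ha
  refine W.add (W.add (W.congrA (hQ i j) fun p => by ring) (W.congrA (hQ j i) fun p => by ring))
    (W.sum _ fun b _ => ?_)
  refine W.add (W.add (W.congrA (W.mul (hM i b) (hY j b)) fun p => by ring)
    (W.congrA (W.mul (hY i b) (hM j b)) fun p => by ring)) ?_
  refine W.weaken 1 (W.mul (hY i b) (hY j b)) (fun p => ?_) (fun p => ?_) (fun p => ?_)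
  · have := (Z.e0 p).le; have := Z.s0 p; positivity
  · have h0 : 0 ≤ s p ^ 2 * (μ p / lam p) := mul_nonneg (sq_nonneg _) (Z.e0 p).le
    calc _ = s p ^ 2 * (μ p / lam p) * (μ p / lam p) := by ring
      _ ≤ s p ^ 2 * (μ p / lam p) := mul_le_of_le_one_right h0 (Z.e1 p)
      _ = _ := by ring
  · exact mul_nonneg (sq_nonneg _) (Z.e0 p).le

lemma O_RRdiff (Z : Siz s μ lam) (hξ : ∀ k, ξ k ∈ Ξ) (G : Geo s μ u ν θ) (hρ0 : ∀ p, 0 ≤ ρ p) (ha : ∀ k, SC μ s (a k)) (ha' : ∀ k, SC μ s (a' k))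
    (hw : ∀ k, W.O (fun p => s p ^ 2 / lam p) (w k))
    (hw' : ∀ k, W.O (fun p => s p ^ 2 / lam p) (w' k))
    (hda : ∀ k, SC μ (fun p => s p * ρ p) (fun p x => a' k p x - a k p x))
    (hdw : ∀ k, W.O (fun p => s p ^ 2 * ρ p / lam p) (fun p x => w' k p x - w k p x)) (i j : Fin n) :
    W.O (fun p => s p ^ 2 * ρ p * (μ p / lam p))
      (fun p x => RR lam ξ u ν θ a' w' i j p x - RR lam ξ u ν θ a w i j p x) := by
  have hA0 : ∀ p, 0 ≤ s p ^ 2 / lam p := fun p => div_nonneg (sq_nonneg _) (Z.l0 p).le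
  have sw : ∀ k p, Smo (w k p) := fun k => (W.toSC hA0 (hw k)).1
  have sw' : ∀ k p, Smo (w' k p) := fun k => (W.toSC hA0 (hw' k)).1
  have one : ∀ {v : Fin n → Fam P n}, (∀ k, SC μ s (v k)) → ∀ k, SC μ (fun p => s p * 1) (v k) :=
    fun h k => (h k).congrA fun p => by ring
  have onew : ∀ {v : Fin n → Fam P n}, (∀ k, W.O (fun p => s p ^ 2 / lam p) (v k)) →
    ∀ k, W.O (fun p => s p ^ 2 * 1 / lam p) (v k) := fun h k => W.congrA (h k) fun p => by ring
  have hQ := O_QQ W Z hξ G hρ0 hda hdw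
  have hdY := O_YY W Z hξ G hρ0 hda hdw
  have hdM := O_MM W hξ G hda
  have hM := O_MM W hξ G ha
  have hM' := O_MM W hξ G ha'
  have hY := O_YY (ρ := fun _ => 1) W Z hξ G (by simp) (one ha) (onew hw)
  have hY' := O_YY (ρ := fun _ => 1) W Z hξ G (by simp) (one ha') (onew hw')
  have hB : ∀ p, 0 ≤ s p ^ 2 * ρ p * (μ p / lam p) := fun p =>
    mul_nonneg (mul_nonneg (sq_nonneg _) (hρ0 p)) (Z.e0 p).le
  have yy : ∀ {f : Fam P n}, W.O (fun p => s p * ρ p * (μ p / lam p) * (s p * 1 * (μ p / lam p))) f →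
      W.O (fun p => s p ^ 2 * ρ p * (μ p / lam p)) f := by
    intro f h
    refine W.weaken 1 h (fun p => ?_) (fun p => ?_) hB
    · have := (Z.e0 p).le; have := Z.s0 p; have := hρ0 p; positivity
    · calc _ = s p ^ 2 * ρ p * (μ p / lam p) * (μ p / lam p) := by ring
        _ ≤ s p ^ 2 * ρ p * (μ p / lam p) := mul_le_of_le_one_right (hB p) (Z.e1 p)
        _ = _ := by ring
  have key : W.O (fun p => s p ^ 2 * ρ p * (μ p / lam p)) (fun p x =>
      QQ lam ξ u ν θ (fun k p x => a' k p x - a k p x) (fun k p x => w' k p x - w k p x) i j p x +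
      QQ lam ξ u ν θ (fun k p x => a' k p x - a k p x) (fun k p x => w' k p x - w k p x) j i p x +
      ∑ b, ((MM lam ξ ν (fun k p x => a' k p x - a k p x) i b p x * YY lam ξ ν θ a' w' j b p x
       + MM lam ξ ν a i b p x *
        YY lam ξ ν θ (fun k p x => a' k p x - a k p x) (fun k p x => w' k p x - w k p x) j b p x)
      + (MM lam ξ ν (fun k p x => a' k p x - a k p x) j b p x * YY lam ξ ν θ a' w' i b p x
       + MM lam ξ ν a j b p x *
        YY lam ξ ν θ (fun k p x => a' k p x - a k p x) (fun k p x => w' k p x - w k p x) i b p x)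
      + (YY lam ξ ν θ (fun k p x => a' k p x - a k p x) (fun k p x => w' k p x - w k p x) i b p x *
          YY lam ξ ν θ a' w' j b p x +
        YY lam ξ ν θ (fun k p x => a' k p x - a k p x) (fun k p x => w' k p x - w k p x) j b p x *
          YY lam ξ ν θ a w i b p x))) := by
    refine W.add (W.add (hQ i j) (hQ j i)) (W.sum _ fun b _ => W.add (W.add (W.add ?_ ?_) (W.add ?_ ?_))
      (W.add ?_ ?_))
    · exact W.congrA (W.mul (hdM i b) (hY' j b)) fun p => by ring
    · exact W.congrA (W.mul (hM i b) (hdY j b)) fun p => by ring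
    · exact W.congrA (W.mul (hdM j b) (hY' i b)) fun p => by ring
    · exact W.congrA (W.mul (hM j b) (hdY i b)) fun p => by ring
    · exact yy (W.mul (hdY i b) (hY' j b))
    · exact yy (W.mul (hdY j b) (hY i b))
  refine W.congr key fun p x => ?_
  simp only [← QQ_sub, ← MM_sub, ← YY_sub (fun k => (ha k).1) (fun k => (ha' k).1) sw sw', RR]
  rw [add_sub_add_comm, add_sub_add_comm, ← Finset.sum_sub_distrib]
  congr 1
  exact Finset.sum_congr rfl fun b _ => by ring

end stepd
end CI

namespace CI
open scoped ContDiff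

/-- Integer vectors as real vectors. -/
def mz {n : ℕ} (m : Fin n → ℤ) : Fin n → ℝ := fun i => (m i : ℝ)

lemma ph_add {n : ℕ} (m k : Fin n → ℤ) (x : Fin n → ℝ) : ph (mz (m + k)) x = ph (mz m) x + ph (mz k) x := by
  simp only [ph, mz, Pi.add_apply, Int.cast_add, add_mul, Finset.sum_add_distrib]

lemma ph_sub {n : ℕ} (m k : Fin n → ℤ) (x : Fin n → ℝ) : ph (mz (m - k)) x = ph (mz m) x - ph (mz k) x := by
  simp only [ph, mz, Pi.sub_apply, Int.cast_sub, sub_mul, Finset.sum_sub_distrib]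

lemma ph_zero {n : ℕ} (x : Fin n → ℝ) : ph (mz (0 : Fin n → ℤ)) x = 0 := by
  simp [ph, mz]

/-- Trigonometric polynomials in `lam x` with slow coefficients of size `A`. -/
inductive Osc {P : Type} {n : ℕ} (μ lam A : P → ℝ) (Q : (Fin n → ℤ) → Prop) : Fam P n → Prop
  | zero : Osc μ lam A Q (fun _ _ => 0)
  | cos (m : Fin n → ℤ) (hm : Q m) {α : Fam P n} (hα : SC μ A α) {f : Fam P n}
      (hf : Osc μ lam A Q f) :
      Osc μ lam A Q (fun p x => α p x * Real.cos (lam p * ph (mz m) x) + f p x)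
  | sin (m : Fin n → ℤ) (hm : Q m) {α : Fam P n} (hα : SC μ A α) {f : Fam P n}
      (hf : Osc μ lam A Q f) :
      Osc μ lam A Q (fun p x => α p x * Real.sin (lam p * ph (mz m) x) + f p x)

section osc
variable {P : Type} {n : ℕ} {μ lam A B : P → ℝ} {Q Q' : (Fin n → ℤ) → Prop} {f g α : Fam P n}

lemma Osc.congr (h : Osc μ lam A Q f) (e : ∀ p x, f p x = g p x) : Osc μ lam A Q g := by
  rwa [show g = f from funext fun p => funext fun x => (e p x).symm]

lemma Osc.congrA (h : Osc μ lam A Q f) (e : ∀ p, A p = B p) : Osc μ lam B Q f := by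
  rwa [show B = A from funext fun p => (e p).symm]

lemma Osc.add (h : Osc μ lam A Q f) (h' : Osc μ lam A Q g) :
    Osc μ lam A Q (fun p x => f p x + g p x) := by
  induction h with
  | zero => exact h'.congr fun p x => by ring
  | cos m hm hα hf ih => exact (Osc.cos m hm hα ih).congr fun p x => by ring
  | sin m hm hα hf ih => exact (Osc.sin m hm hα ih).congr fun p x => by ring

lemma Osc.cos1 (m : Fin n → ℤ) (hm : Q m) (hα : SC μ A α) :
    Osc μ lam A Q (fun p x => α p x * Real.cos (lam p * ph (mz m) x)) :=
  (Osc.cos m hm hα .zero).congr fun p x => by ring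

lemma Osc.sin1 (m : Fin n → ℤ) (hm : Q m) (hα : SC μ A α) :
    Osc μ lam A Q (fun p x => α p x * Real.sin (lam p * ph (mz m) x)) :=
  (Osc.sin m hm hα .zero).congr fun p x => by ring

lemma Osc.slowmul (hα : SC μ B α) (h : Osc μ lam A Q f) :
    Osc μ lam (fun p => B p * A p) Q (fun p x => α p x * f p x) := by
  induction h with
  | zero => exact Osc.zero.congr fun p x => by ring
  | cos m hm hβ hf ih => exact (Osc.cos m hm (hα.mul hβ) ih).congr fun p x => by ring
  | sin m hm hβ hf ih => exact (Osc.sin m hm (hα.mul hβ) ih).congr fun p x => by ring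

lemma Osc.cosmul (k : Fin n → ℤ) (h : Osc μ lam A (fun _ => True) f) :
    Osc μ lam A (fun _ => True) (fun p x => Real.cos (lam p * ph (mz k) x) * f p x) := by
  induction h with
  | zero => exact Osc.zero.congr fun p x => by ring
  | cos m hm hβ hf ih =>
    refine (((Osc.cos1 (k - m) trivial (hβ.const_mul (1/2))).add
      (Osc.cos1 (k + m) trivial (hβ.const_mul (1/2)))).add ih).congr fun p x => ?_
    rw [ph_sub, ph_add, mul_sub, mul_add, Real.cos_sub, Real.cos_add]; ring
  | sin m hm hβ hf ih =>
    refine (((Osc.sin1 (k - m) trivial (hβ.const_mul (-1/2))).add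
      (Osc.sin1 (k + m) trivial (hβ.const_mul (1/2)))).add ih).congr fun p x => ?_
    rw [ph_sub, ph_add, mul_sub, mul_add, Real.sin_sub, Real.sin_add]; ring

lemma Osc.sinmul (k : Fin n → ℤ) (h : Osc μ lam A (fun _ => True) f) :
    Osc μ lam A (fun _ => True) (fun p x => Real.sin (lam p * ph (mz k) x) * f p x) := by
  induction h with
  | zero => exact Osc.zero.congr fun p x => by ring
  | cos m hm hβ hf ih =>
    refine (((Osc.sin1 (k - m) trivial (hβ.const_mul (1/2))).add
      (Osc.sin1 (k + m) trivial (hβ.const_mul (1/2)))).add ih).congr fun p x => ?_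
    rw [ph_sub, ph_add, mul_sub, mul_add, Real.sin_sub, Real.sin_add]; ring
  | sin m hm hβ hf ih =>
    refine (((Osc.cos1 (k - m) trivial (hβ.const_mul (1/2))).add
      (Osc.cos1 (k + m) trivial (hβ.const_mul (-1/2)))).add ih).congr fun p x => ?_
    rw [ph_sub, ph_add, mul_sub, mul_add, Real.cos_sub, Real.cos_add]; ring

lemma Osc.mul (h : Osc μ lam A (fun _ => True) f) (h' : Osc μ lam B (fun _ => True) g) :
    Osc μ lam (fun p => A p * B p) (fun _ => True) (fun p x => f p x * g p x) := by
  induction h with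
  | zero => exact Osc.zero.congr fun p x => by ring
  | cos m hm hα hf ih => exact ((Osc.cosmul m (h'.slowmul hα)).add ih).congr fun p x => by ring
  | sin m hm hα hf ih => exact ((Osc.sinmul m (h'.slowmul hα)).add ih).congr fun p x => by ring

lemma Osc.slow (hα : SC μ A α) : Osc μ lam A (fun _ => True) α :=
  (Osc.cos1 0 trivial hα).congr fun p x => by rw [ph_zero]; simp

lemma Osc.weaken (c : ℝ) (h : Osc μ lam A Q f) (hA : ∀ p, 0 ≤ A p)
    (hAB : ∀ p, A p ≤ c * B p) (hμ : ∀ p, 0 ≤ μ p) (hB : ∀ p, 0 ≤ B p) : Osc μ lam B Q f := by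
  induction h with
  | zero => exact .zero
  | cos m hm hα hf ih => exact .cos m hm (hα.weaken c hA hAB hμ (fun p => le_rfl) hB) ih
  | sin m hm hα hf ih => exact .sin m hm (hα.weaken c hA hAB hμ (fun p => le_rfl) hB) ih

lemma Osc.toSC (h : Osc μ lam A Q f) (hμ : ∀ p, 0 ≤ μ p) (hl : ∀ p, μ p ≤ lam p)
    (hA : ∀ p, 0 ≤ A p) : SC lam A f := by
  have h0 : ∀ p, 0 ≤ lam p := fun p => (hμ p).trans (hl p)
  induction h with
  | zero => exact SC.zero
  | cos m hm hα hf ih =>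
    exact (((hα.weaken 1 hA (fun p => by simp) hμ hl hA).mul (SC.cosph h0 _)).congrA
      fun p => mul_one _).add ih
  | sin m hm hα hf ih =>
    exact (((hα.weaken 1 hA (fun p => by simp) hμ hl hA).mul (SC.sinph h0 _)).congrA
      fun p => mul_one _).add ih

lemma Osc.pd (h : Osc μ lam A Q f) (hμ : ∀ p, 0 ≤ μ p) (hl : ∀ p, μ p ≤ lam p)
    (hA : ∀ p, 0 ≤ A p) (i : Fin n) :
    Osc μ lam (fun p => A p * lam p) Q (fun p => pder i (f p)) := by
  have h0 : ∀ p, 0 ≤ lam p := fun p => (hμ p).trans (hl p)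
  have hw : ∀ {α : Fam P n}, SC μ A α → SC μ (fun p => A p * lam p) (fun p => pder i (α p)) :=
    fun hα => (hα.pd i).weaken 1 (fun p => mul_nonneg (hA p) (hμ p))
      (fun p => by rw [one_mul]; exact mul_le_mul_of_nonneg_left (hl p) (hA p)) hμ (fun p => le_rfl)
      (fun p => mul_nonneg (hA p) (h0 p))
  have hs : ∀ {α : Fam P n} (c : ℝ), SC μ A α →
      SC μ (fun p => A p * lam p) (fun p x => c * lam p * α p x) := by
    intro α c hα
    refine ((SC.cst (c := fun p => c * lam p) (A := lam) ⟨|c|, fun p => ?_⟩).mul hα).congrA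
      fun p => mul_comm _ _
    rw [abs_mul, abs_of_nonneg (h0 p)]
  induction h with
  | zero => exact Osc.zero.congr fun p x => by rw [pder_const]
  | @cos m hm α hα f hf ih =>
    refine (Osc.cos m hm (hw hα) (Osc.sin m hm (hs (-(mz m i)) hα) ih)).congr fun p x => ?_
    rw [pder_add ((hα.1 p).mul (smo_cos _ _)) ((hf.toSC hμ hl hA).1 p),
      pder_mul (hα.1 p) (smo_cos _ _), pder_cos]
    ring
  | @sin m hm α hα f hf ih =>
    refine (Osc.sin m hm (hw hα) (Osc.cos m hm (hs (mz m i) hα) ih)).congr fun p x => ?_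
    rw [pder_add ((hα.1 p).mul (smo_sin _ _)) ((hf.toSC hμ hl hA).1 p),
      pder_mul (hα.1 p) (smo_sin _ _), pder_sin]
    ring

lemma Osc.split (h : Osc μ lam A (fun _ => True) f) : ∃ f0 f1 : Fam P n, SC μ A f0 ∧
    Osc μ lam A (fun m => m ≠ 0) f1 ∧ ∀ p x, f p x = f0 p x + f1 p x := by
  induction h with
  | zero => exact ⟨_, _, SC.zero, .zero, fun p x => by simp⟩
  | @cos m hm α hα f hf ih =>
    obtain ⟨f0, f1, h0, h1, e⟩ := ih
    by_cases hm0 : m = 0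
    · subst hm0
      refine ⟨_, _, hα.add h0, h1, fun p x => ?_⟩
      simp only [ph_zero, e]; simp; ring
    · exact ⟨_, _, h0, .cos m hm0 hα h1, fun p x => by simp only [e]; ring⟩
  | @sin m hm α hα f hf ih =>
    obtain ⟨f0, f1, h0, h1, e⟩ := ih
    by_cases hm0 : m = 0
    · subst hm0
      refine ⟨_, _, h0, h1, fun p x => ?_⟩
      simp only [ph_zero, e]; simp
    · exact ⟨_, _, h0, .sin m hm0 hα h1, fun p x => by simp only [e]; ring⟩

/-- The symbol class of trigonometric polynomials. -/
def OCl.osc (hμ : ∀ p, 0 ≤ μ p) (hl : ∀ p, μ p ≤ lam p) :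
    OCl P n μ lam (Set.range mz) where
  O A f := Osc μ lam A (fun _ => True) f
  toSC hA h := h.toSC hμ hl hA
  add h1 h2 := h1.add h2
  mul h1 h2 := h1.mul h2
  weaken c h hA hAB hB := h.weaken c hA hAB hμ hB
  slow h := .slow h
  pd i hA h := h.pd hμ hl hA i
  cos ξ h := by
    obtain ⟨m, rfl⟩ := h
    exact (Osc.cos1 m trivial (SC.const 1)).congr fun p x => one_mul _
  sin ξ h := by
    obtain ⟨m, rfl⟩ := h
    exact (Osc.sin1 m trivial (SC.const 1)).congr fun p x => one_mul _

/-- Solving the oscillatory divergence-type equation in the direction `q`. -/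
lemma Osc.solve {q : Fin n → ℝ} (hq : ∀ m : Fin n → ℤ, m ≠ 0 → ∑ i, (m i : ℝ) * q i ≠ 0)
    (hμ : ∀ p, 0 ≤ μ p) (hl : ∀ p, μ p ≤ lam p) (hl0 : ∀ p, 0 < lam p)
    (hA : ∀ p, 0 ≤ A p)
    (h : Osc μ lam A (fun m => m ≠ 0) f) (l : Fin n) :
    ∃ w : Fin n → Fam P n, (∀ i, Osc μ lam (fun p => A p / lam p) (fun _ => True) (w i)) ∧
      ∀ i, Osc μ lam (fun p => A p * (μ p / lam p)) (fun _ => True)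
        (fun p x => (∑ j, (pder j (w i p) x + pder i (w j p) x) * q j)
          - if i = l then f p x else 0) := by
  have hA' : ∀ p, 0 ≤ A p / lam p := fun p => div_nonneg (hA p) (hl0 p).le
  have sm : ∀ {α : Fam P n} (c : ℝ), SC μ A α → SC μ (fun p => A p / lam p)
      (fun p x => c / lam p * α p x) := by
    intro α c hα
    refine ((SC.cst (c := fun p => c / lam p) (A := fun p => 1 / lam p) ⟨|c|, fun p => ?_⟩).mul hα).congrA
      fun p => by ring
    rw [abs_div, abs_of_pos (hl0 p)]; exact le_of_eq (by ring)
  have sd : ∀ {α : Fam P n} (c : ℝ) (j : Fin n), SC μ A α → SC μ (fun p => A p * (μ p / lam p))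
      (fun p x => c / lam p * pder j (α p) x) := by
    intro α c j hα
    refine ((SC.cst (c := fun p => c / lam p) (A := fun p => 1 / lam p) ⟨|c|, fun p => ?_⟩).mul
      (hα.pd j)).congrA fun p => by ring
    rw [abs_div, abs_of_pos (hl0 p)]; exact le_of_eq (by ring)
  have alg : ∀ m : Fin n → ℤ, m ≠ 0 → ∃ c : Fin n → ℝ, ∀ i,
      c i * (∑ j, (m j : ℝ) * q j) + m i * ∑ j, c j * q j = if i = l then 1 else 0 := by
    intro m hm
    have h0 := hq m hm
    set M := ∑ j, (m j : ℝ) * q j with hM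
    refine ⟨fun i => ((if i = l then 1 else 0) - m i * (q l / (2 * M))) / M, fun i => ?_⟩
    have e : ∑ j, ((if j = l then (1:ℝ) else 0) - m j * (q l / (2 * M))) / M * q j = q l / (2 * M) := by
      have : ∀ j, ((if j = l then (1:ℝ) else 0) - m j * (q l / (2 * M))) / M * q j =
        (if j = l then q j / M else 0) - (q l / (2 * M)) / M * (m j * q j) := by
          intro j; split_ifs <;> field_simp
          ring
      simp only [this, Finset.sum_sub_distrib, ← Finset.mul_sum, ← hM]
      simp only [Finset.sum_ite_eq', Finset.mem_univ, if_true]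
      field_simp
      ring
    rw [e]; field_simp; ring
  induction h with
  | zero =>
    refine ⟨fun _ _ _ => 0, fun i => .zero, fun i => Osc.zero.congr fun p x => ?_⟩
    simp [pder_const]
  | @cos m hm α hα f hf ih =>
    obtain ⟨w, hw, he⟩ := ih
    obtain ⟨c, hc⟩ := alg m hm
    refine ⟨fun i p x => (c i / lam p * α p x) * Real.sin (lam p * ph (mz m) x) + w i p x,
      fun i => .sin m trivial (sm (c i) hα) (hw i), fun i => ?_⟩
    refine ((Osc.sin1 m trivial (SC.sum Finset.univ fun j _ => (((sd (c i) j hα).add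
      (sd (c j) i hα)).const_mul (q j)))).add (he i)).congr fun p x => ?_
    have sw : ∀ k, Smo (w k p) := fun k => ((hw k).toSC hμ hl hA').1 p
    have e1 : ∀ k i, pder i (fun x => (c k / lam p * α p x) * Real.sin (lam p * ph (mz m) x) + w k p x) x
        = c k / lam p * pder i (α p) x * Real.sin (lam p * ph (mz m) x) +
          c k * m i * (α p x * Real.cos (lam p * ph (mz m) x)) + pder i (w k p) x := by
      intro k i
      rw [pder_add ((contDiff_const.mul (hα.1 p)).mul (smo_sin _ _)) (sw k),
        pder_mul (contDiff_const.mul (hα.1 p)) (smo_sin _ _), pder_const_mul _ (hα.1 p), pder_sin]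
      have := (hl0 p).ne'
      simp only [mz]
      field_simp
    simp only [e1]
    have e2 : ∀ j, (c i / lam p * pder j (α p) x * Real.sin (lam p * ph (mz m) x) +
          c i * m j * (α p x * Real.cos (lam p * ph (mz m) x)) + pder j (w i p) x +
          (c j / lam p * pder i (α p) x * Real.sin (lam p * ph (mz m) x) +
          c j * m i * (α p x * Real.cos (lam p * ph (mz m) x)) + pder i (w j p) x)) * q j =
        q j * (c i / lam p * pder j (α p) x + c j / lam p * pder i (α p) x) *
          Real.sin (lam p * ph (mz m) x) +
        (c i * (m j * q j) + m i * (c j * q j)) * (α p x * Real.cos (lam p * ph (mz m) x))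
        + (pder j (w i p) x + pder i (w j p) x) * q j := fun j => by ring
    simp only [e2, Finset.sum_add_distrib, ← Finset.sum_mul, ← Finset.mul_sum, hc i]
    split_ifs <;> ring
  | @sin m hm α hα f hf ih =>
    obtain ⟨w, hw, he⟩ := ih
    obtain ⟨c, hc⟩ := alg m hm
    refine ⟨fun i p x => ((-c i) / lam p * α p x) * Real.cos (lam p * ph (mz m) x) + w i p x,
      fun i => .cos m trivial (sm (-c i) hα) (hw i), fun i => ?_⟩
    refine ((Osc.cos1 m trivial (SC.sum Finset.univ fun j _ => (((sd (-c i) j hα).add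
      (sd (-c j) i hα)).const_mul (q j)))).add (he i)).congr fun p x => ?_
    have sw : ∀ k, Smo (w k p) := fun k => ((hw k).toSC hμ hl hA').1 p
    have e1 : ∀ k i, pder i (fun x => ((-c k) / lam p * α p x) * Real.cos (lam p * ph (mz m) x) + w k p x) x
        = (-c k) / lam p * pder i (α p) x * Real.cos (lam p * ph (mz m) x) +
          c k * m i * (α p x * Real.sin (lam p * ph (mz m) x)) + pder i (w k p) x := by
      intro k i
      rw [pder_add ((contDiff_const.mul (hα.1 p)).mul (smo_cos _ _)) (sw k),
        pder_mul (contDiff_const.mul (hα.1 p)) (smo_cos _ _), pder_const_mul _ (hα.1 p), pder_cos]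
      have := (hl0 p).ne'
      simp only [mz]
      field_simp
    simp only [e1]
    have e2 : ∀ j, ((-c i) / lam p * pder j (α p) x * Real.cos (lam p * ph (mz m) x) +
          c i * m j * (α p x * Real.sin (lam p * ph (mz m) x)) + pder j (w i p) x +
          ((-c j) / lam p * pder i (α p) x * Real.cos (lam p * ph (mz m) x) +
          c j * m i * (α p x * Real.sin (lam p * ph (mz m) x)) + pder i (w j p) x)) * q j =
        q j * ((-c i) / lam p * pder j (α p) x + (-c j) / lam p * pder i (α p) x) *
          Real.cos (lam p * ph (mz m) x) +
        (c i * (m j * q j) + m i * (c j * q j)) * (α p x * Real.sin (lam p * ph (mz m) x))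
        + (pder j (w i p) x + pder i (w j p) x) * q j := fun j => by ring
    simp only [e2, Finset.sum_add_distrib, ← Finset.sum_mul, ← Finset.mul_sum, hc i]
    split_ifs <;> ring

end osc
end CI

namespace CI
open scoped ContDiff

lemma exists_indep (n : ℕ) : ∃ q : Fin n → ℝ, ∀ m : Fin n → ℤ, m ≠ 0 → ∑ i, (m i : ℝ) * q i ≠ 0 := by
  have ht : Transcendental ℤ (liouvilleNumber ((2:ℕ):ℝ)) := transcendental_liouvilleNumber (le_refl 2)
  refine ⟨fun i => (liouvilleNumber ((2:ℕ):ℝ)) ^ (i : ℕ), fun m hm h0 => hm ?_⟩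
  have hp := (transcendental_iff.1 ht) (∑ i : Fin n, Polynomial.monomial (i:ℕ) (m i))
    (by simp only [map_sum, Polynomial.aeval_monomial]; simpa using h0)
  funext i
  have := congrArg (fun p => Polynomial.coeff p i) hp
  simpa [Polynomial.finsetSum_coeff, Polynomial.coeff_monomial, Fin.val_inj] using this

lemma sum_lt_half {n : ℕ} (F : Fin n → Fin n → ℝ) (hs : ∀ i j, F i j = F j i) (h0 : ∀ i, F i i = 0) :
    ∑ ij : {ij : Fin n × Fin n // ij.1 < ij.2}, F ij.1.1 ij.1.2 = (1/2) * ∑ i, ∑ j, F i j := by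
  have h1 : ∑ ij : {ij : Fin n × Fin n // ij.1 < ij.2}, F ij.1.1 ij.1.2
      = ∑ i, ∑ j, if i < j then F i j else 0 := by
    rw [← Fintype.sum_prod_type' (fun i j => if i < j then F i j else 0), ← Finset.sum_filter]
    exact (Finset.sum_subtype (Finset.univ.filter fun ij : Fin n × Fin n => ij.1 < ij.2)
      (by simp) (fun ij => F ij.1 ij.2)).symm
  have h2 : ∑ i, ∑ j, F i j = ∑ i, ∑ j, (if i < j then F i j else 0) +
      ∑ i, ∑ j, (if j < i then F j i else 0) := by
    rw [← Finset.sum_add_distrib]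
    refine Finset.sum_congr rfl fun i _ => ?_
    rw [← Finset.sum_add_distrib]
    refine Finset.sum_congr rfl fun j _ => ?_
    rcases lt_trichotomy i j with h | h | h
    · simp [h, h.not_gt]
    · subst h; simp [h0]
    · simp [h, h.not_gt, hs i j]
  rw [h1, h2, Finset.sum_comm (f := fun i j => if j < i then F j i else 0)]
  ring

/-- The primitive metric decomposition. -/
lemma exists_decomp (n N : ℕ) (hn : 2 ≤ n) (hN : n * (n - 1) ≤ 2 * (N * n)) :
    ∃ q : Fin n → ℝ, (∀ m : Fin n → ℤ, m ≠ 0 → ∑ i, (m i : ℝ) * q i ≠ 0) ∧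
    ∃ (ξ : Fin N → Fin n → Fin n → ℝ) (L : Fin N → Fin n → Fin n → Fin n → ℝ)
      (H0 : Fin n → Fin n → ℝ),
      (∀ Z : Fin n → Fin n → ℝ, (∀ i j, Z i j = Z j i) → ∀ i j, Z i j =
        (if i = j then (∑ l, Z i l * q l) / q i else 0) +
          ∑ r, ∑ k, (∑ a, ∑ b, L r k a b * Z a b) * (ξ r k i * ξ r k j)) ∧
      (∀ i j, H0 i j = (if i = j then 1 else 0) + ∑ r, ∑ k, ξ r k i * ξ r k j) ∧
      (∀ i, ∑ l, H0 i l * q l = q i) ∧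
      (∀ r k, ∑ a, ∑ b, L r k a b * H0 a b = 1) ∧ (∀ r k a, L r k a a = 0) := by
  classical
  obtain ⟨q, hq⟩ := exists_indep n
  refine ⟨q, hq, ?_⟩
  have q0 : ∀ i, q i ≠ 0 := by
    intro i
    have := hq (Pi.single i 1) (by intro h; simpa using congrFun h i)
    simpa [Pi.single_apply] using this
  set I := {ij : Fin n × Fin n // ij.1 < ij.2} with hI
  have hne : Nonempty I := ⟨⟨(⟨0, by omega⟩, ⟨1, by omega⟩), by simp⟩⟩
  have hcI : 2 * Fintype.card I = n * (n - 1) := by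
    have h := sum_lt_half (n := n) (fun i j => if i = j then 0 else 1)
      (fun i j => by simp [eq_comm]) (by simp)
    have h1 : ∑ ij : I, (if ij.1.1 = ij.1.2 then (0:ℝ) else 1) = Fintype.card I := by
      rw [Finset.sum_congr rfl (fun ij _ => if_neg (ne_of_lt ij.2))]; simp
    have h2 : ∀ i : Fin n, ∑ j, (if i = j then (0:ℝ) else 1) = n - 1 := by
      intro i
      have : ∀ j, (if i = j then (0:ℝ) else 1) = 1 - if i = j then 1 else 0 := by
        intro j; split_ifs <;> ring
      simp [this, Finset.sum_sub_distrib]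
    rw [h1] at h
    simp only [h2] at h
    have h3 : (2 * Fintype.card I : ℝ) = n * ((n - 1 : ℕ) : ℝ) := by
      rw [h, Nat.cast_sub (by omega)]; simp; ring
    exact_mod_cast h3
  have hcard : Fintype.card I ≤ Fintype.card (Fin N × Fin n) := by
    simp only [Fintype.card_prod, Fintype.card_fin]; omega
  obtain ⟨ι⟩ := Function.Embedding.nonempty_of_card_le hcard
  obtain ⟨e, he⟩ : ∃ e : Fin N × Fin n → I, Function.Surjective e :=
    ⟨Function.invFun ι, Function.invFun_surjective ι.injective⟩
  set mu : I → ℝ := fun z => ((Finset.univ.filter fun t => e t = z).card : ℝ) with hmu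
  have mu0 : ∀ z, mu z ≠ 0 := by
    intro z
    obtain ⟨t, ht⟩ := he z
    simp only [hmu, ne_eq, Nat.cast_eq_zero, Finset.card_eq_zero]
    exact fun h => Finset.notMem_empty t (h ▸ by simp [ht])
  have fib : ∀ F : I → ℝ, ∑ r, ∑ k, F (e (r, k)) = ∑ z, mu z * F z := by
    intro F
    rw [← Fintype.sum_prod_type' (fun r k => F (e (r, k)))]
    rw [← Finset.sum_fiberwise (s := Finset.univ) (g := e)]
    refine Finset.sum_congr rfl fun z _ => ?_
    rw [Finset.sum_congr rfl (g := fun _ => F z)]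
    · simp [hmu]
    · intro t ht; simp only [Finset.mem_filter] at ht; simp [ht.2]
  set X : Fin n → Fin n → Fin n → ℝ := fun i j a =>
    (if a = i then q j else 0) - (if a = j then q i else 0) with hX
  have Xs : ∀ i j a b, X i j a * X i j b = X j i a * X j i b := by
    intro i j a b; simp only [hX]; ring
  have X0 : ∀ i a, X i i a = 0 := by intro i a; simp [hX]
  have Xq : ∀ i j, ∑ l, X i j l * q l = 0 := by
    intro i j; simp only [hX, sub_mul, Finset.sum_sub_distrib, ite_mul, zero_mul, Finset.sum_ite_eq', Finset.mem_univ, if_true]; ring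
  have Xdec : ∀ Z : Fin n → Fin n → ℝ, (∀ i j, Z i j = Z j i) → ∀ a b,
      ∑ z : I, (-Z z.1.1 z.1.2 / (q z.1.1 * q z.1.2)) * (X z.1.1 z.1.2 a * X z.1.1 z.1.2 b) =
      Z a b - if a = b then (∑ l, Z a l * q l) / q a else 0 := by
    intro Z hZ a b
    rw [sum_lt_half (fun i j => (-Z i j / (q i * q j)) * (X i j a * X i j b))
      (fun i j => by simp only [Xs i j, hZ i j, mul_comm (q i)]) (fun i => by simp [X0])]
    have : ∀ i j, (-Z i j / (q i * q j)) * (X i j a * X i j b) =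
        (if a = i then (if b = i then - (Z i j * q j / q i) else 0) else 0)
        + (if a = j then (if b = j then - (Z i j * q i / q j) else 0) else 0)
        + (if a = i then (if b = j then Z i j else 0) else 0)
        + (if a = j then (if b = i then Z i j else 0) else 0) := by
      intro i j
      have := q0 i; have := q0 j
      simp only [hX]
      split_ifs <;> field_simp <;> ring
    simp only [this, Finset.sum_add_distrib]
    rw [Finset.sum_comm (f := fun i j => (if a = j then (if b = j then - (Z i j * q i / q j) else 0) else 0)),
      Finset.sum_comm (f := fun i j => (if a = j then (if b = i then Z i j else 0) else 0))]
    have e1 : ∑ i, ∑ j, (if a = i then (if b = i then - (Z i j * q j / q i) else 0) else 0) =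
        - if a = b then (∑ l, Z a l * q l) / q a else 0 := by
      have : ∀ i, ∑ j, (if a = i then (if b = i then - (Z i j * q j / q i) else 0) else 0) =
          if a = i then (if b = i then - ((∑ j, Z i j * q j) / q i) else 0) else 0 := by
        intro i; split_ifs <;> simp [Finset.sum_div]
      rw [Finset.sum_congr rfl fun i _ => this i, Finset.sum_ite_eq, if_pos (Finset.mem_univ _)]
      by_cases h : a = b
      · rw [if_pos h, if_pos h.symm]
      · rw [if_neg h, if_neg (Ne.symm h), neg_zero]
    have e2 : ∑ j, ∑ i, (if a = j then (if b = j then - (Z i j * q i / q j) else 0) else 0) =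
        - if a = b then (∑ l, Z a l * q l) / q a else 0 := by
      rw [← e1]
      exact Finset.sum_congr rfl fun i _ => Finset.sum_congr rfl fun j _ => by rw [hZ i j]
    rw [e1, e2]
    have e3 : ∑ i, ∑ j, (if a = i then (if b = j then Z i j else 0) else 0) = Z a b := by
      have : ∀ i, ∑ j, (if a = i then (if b = j then Z i j else 0) else 0) =
        if a = i then Z i b else 0 := by
          intro i; split_ifs <;> simp
      simp [this]
    have e4 : ∑ j, ∑ i, (if a = j then (if b = i then Z i j else 0) else 0) = Z a b := by
      rw [← e3]
      exact Finset.sum_congr rfl fun i _ => Finset.sum_congr rfl fun j _ => by rw [hZ i j]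
    rw [e3, e4]; ring
  have Lsum : ∀ (z : I) (c : ℝ) (Z : Fin n → Fin n → ℝ),
      ∑ a, ∑ b, (if a = z.1.1 then (if b = z.1.2 then c else 0) else 0) * Z a b
        = c * Z z.1.1 z.1.2 := by
    intro z c Z
    have : ∀ a, ∑ b, (if a = z.1.1 then (if b = z.1.2 then c else 0) else 0) * Z a b =
      if a = z.1.1 then c * Z a z.1.2 else 0 := by intro a; split_ifs <;> simp
    simp [this]
  refine ⟨fun r k => X (e (r,k)).1.1 (e (r,k)).1.2,
    fun r k a b => if a = (e (r,k)).1.1 then (if b = (e (r,k)).1.2 then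
      -1 / (mu (e (r,k)) * (q (e (r,k)).1.1 * q (e (r,k)).1.2)) else 0) else 0,
    fun i j => (if i = j then 1 else 0) + ∑ r, ∑ k, X (e (r,k)).1.1 (e (r,k)).1.2 i *
      X (e (r,k)).1.1 (e (r,k)).1.2 j, fun Z hZ i j => ?_, fun i j => rfl, fun i => ?_, fun r k => ?_, fun r k a => ?_⟩
  · simp only [Lsum]
    rw [fib (fun z => -1 / (mu z * (q z.1.1 * q z.1.2)) * Z z.1.1 z.1.2 *
      (X z.1.1 z.1.2 i * X z.1.1 z.1.2 j))]
    have := Xdec Z hZ i j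
    rw [Finset.sum_congr rfl (g := fun z : I => (-Z z.1.1 z.1.2 / (q z.1.1 * q z.1.2)) *
      (X z.1.1 z.1.2 i * X z.1.1 z.1.2 j)), this]
    · ring
    · intro z _
      have := mu0 z; have := q0 z.1.1; have := q0 z.1.2
      field_simp
  · simp only [add_mul, Finset.sum_add_distrib, Finset.sum_mul]
    have : ∑ l, ∑ r, ∑ k, X (e (r,k)).1.1 (e (r,k)).1.2 i *
      X (e (r,k)).1.1 (e (r,k)).1.2 l * q l = 0 := by
      rw [Finset.sum_comm]
      refine Finset.sum_eq_zero fun r _ => ?_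
      rw [Finset.sum_comm]
      refine Finset.sum_eq_zero fun k _ => ?_
      simp only [mul_assoc, ← Finset.mul_sum, Xq, mul_zero]
    rw [this]; simp
  · simp only [Lsum]
    set z := e (r, k)
    have hz : z.1.1 ≠ z.1.2 := ne_of_lt z.2
    rw [if_neg hz, fib (fun y => X y.1.1 y.1.2 z.1.1 * X y.1.1 y.1.2 z.1.2)]
    have : ∀ y : I, X y.1.1 y.1.2 z.1.1 * X y.1.1 y.1.2 z.1.2 =
        if y = z then - (q z.1.1 * q z.1.2) else 0 := by
      intro y
      split_ifs with h
      · subst h; simp [hX, hz, hz.symm]; ring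
      · simp only [hX]
        have hy := y.2
        have hz2 := z.2
        by_cases c1 : z.1.1 = y.1.1
        · have c2 : z.1.2 ≠ y.1.1 := fun h' => hz (c1.trans h'.symm)
          have c3 : z.1.2 ≠ y.1.2 := fun h2 => h (Subtype.ext (Prod.ext c1.symm h2.symm))
          rw [if_neg c2, if_neg c3]; ring
        · by_cases c4 : z.1.1 = y.1.2
          · have c2 : z.1.2 ≠ y.1.1 := fun h2 => by rw [c4, h2] at hz2; exact absurd hy hz2.not_gt
            have c3 : z.1.2 ≠ y.1.2 := fun h' => hz (c4.trans h'.symm)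
            rw [if_neg c2, if_neg c3]; ring
          · rw [if_neg c1, if_neg c4]; ring
    have hsum : ∑ y, mu y * (X y.1.1 y.1.2 z.1.1 * X y.1.1 y.1.2 z.1.2) =
        mu z * (-(q z.1.1 * q z.1.2)) := by
      rw [Finset.sum_eq_single z]
      · rw [this, if_pos rfl]
      · intro y _ hy; rw [this, if_neg hy, mul_zero]
      · simp
    rw [hsum]
    have := mu0 z; have := q0 z.1.1; have := q0 z.1.2
    field_simp
    ring
  · have hz : (e (r,k)).1.1 ≠ (e (r,k)).1.2 := ne_of_lt (e (r,k)).2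
    beta_reduce
    split_ifs with h1 h2
    · exact absurd (h1.symm.trans h2) hz
    · rfl
    · rfl

end CI

namespace CI
open scoped ContDiff

/-- The coordinate directions. -/
def ek {n : ℕ} (k : Fin n) : Fin n → ℝ := mz (Pi.single k 1)

lemma ek_mem {n : ℕ} (k : Fin n) : ek k ∈ Set.range (mz (n := n)) := ⟨_, rfl⟩

lemma ek_apply {n : ℕ} (k i : Fin n) : ek k i = if i = k then 1 else 0 := by
  simp only [ek, mz, Pi.single_apply]; split_ifs <;> simp

/-- The second harmonic `cos(2 lam x_k)`. -/
def c2 {P : Type} {n : ℕ} (lam : P → ℝ) (k : Fin n) : Fam P n :=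
  fun p x => Real.cos (lam p * ph (mz (Pi.single k 2)) x)

lemma two_cos_sq {P : Type} {n : ℕ} (lam : P → ℝ) (k : Fin n) (p : P) (x : Fin n → ℝ) :
    2 * Real.cos (lam p * ph (ek k) x) ^ 2 = 1 + c2 lam k p x := by
  have : ph (mz (Pi.single k 2)) x = 2 * ph (ek k) x := by
    rw [show (Pi.single k 2 : Fin n → ℤ) = Pi.single k 1 + Pi.single k 1 by
      rw [← Pi.single_add]; rfl, ph_add]
    rw [ek]; ring
  rw [c2, this, show lam p * (2 * ph (ek k) x) = 2 * (lam p * ph (ek k) x) by ring, Real.cos_two_mul]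
  ring

section free
variable {P : Type} {n d : ℕ} {s μ lam : P → ℝ} {u : Fin d → Fam P n}
  {ν θ : Fin n → Fin d → Fam P n}

lemma XX_free (hl : ∀ p, lam p ≠ 0) (G : Geo s μ u ν θ) {a w : Fin n → Fam P n}
    (ha : ∀ k p, Smo (a k p))
    (hw : ∀ k p, Smo (w k p)) (p : P) (i j : Fin n) (x : Fin n → ℝ) :
    XX u (VV lam ek ν θ a w) i j p x = pder j (w i p) x + pder i (w j p) x
      + (if i = j then a i p x ^ 2 * (1 + c2 lam i p x) else 0)
      + RR lam ek u ν θ a w i j p x := by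
  rw [XX_eq hl G ha hw]
  congr 2
  simp only [two_cos_sq, ek_apply]
  split_ifs with h
  · subst h
    rw [Finset.sum_eq_single i]
    · simp
    · intro k _ hk; rw [if_neg (Ne.symm hk)]; ring
    · simp
  · refine Finset.sum_eq_zero fun k _ => ?_
    by_cases h1 : i = k
    · rw [if_neg (fun h2 : j = k => h (h1.trans h2.symm))]; ring
    · rw [if_neg h1]; ring

/-- State of the iteration in the free step. -/
structure FS (s μ lam : P → ℝ) (u : Fin d → Fam P n) (ν θ : Fin n → Fin d → Fam P n)
    (D : Fin n → Fin n → Fam P n) (q : Fin n → ℝ) (a0 : Fin n → Fam P n) (J : ℕ)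
    (a w : Fin n → Fam P n) : Prop where
  ha : ∀ k, SC μ s (a k)
  hd : ∀ k, SC μ (fun p => s p * (μ p / lam p)) (fun p x => a k p x - a0 k p x)
  hw : ∀ k, Osc μ lam (fun p => s p ^ 2 / lam p) (fun _ => True) (w k)
  hr : ∀ i, Osc μ lam (fun p => s p ^ 2 * (μ p / lam p) ^ J) (fun _ => True)
    (fun p x => ∑ l, (D i l p x - XX u (VV lam ek ν θ a w) i l p x) * q l)
  ho : ∀ i j, i ≠ j → Osc μ lam (fun p => s p ^ 2 * (μ p / lam p)) (fun _ => True)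
    (XX u (VV lam ek ν θ a w) i j)

variable {D : Fin n → Fin n → Fam P n} {q : Fin n → ℝ} {a0 b0 a w : Fin n → Fam P n} {J : ℕ}

lemma pder_add' {f g : (Fin n → ℝ) → ℝ} (hf : Smo f) (hg : Smo g) (i : Fin n) (x : Fin n → ℝ) :
    pder i (fun x => f x + g x) x = pder i f x + pder i g x := by rw [pder_add hf hg]

lemma FS.step (hq : ∀ m : Fin n → ℤ, m ≠ 0 → ∑ i, (m i : ℝ) * q i ≠ 0) (q0 : ∀ i, q i ≠ 0)
    (G : Geo s μ u ν θ) (Z : Siz s μ lam) (sp : ∀ p, 0 < s p)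
    (hb0 : ∀ k, SC μ (fun p => 1 / s p) (b0 k)) (hab : ∀ k p x, a0 k p x * b0 k p x = 1)
    (hJ : 1 ≤ J) (h : FS s μ lam u ν θ D q a0 J a w) :
    ∃ a' w', FS s μ lam u ν θ D q a0 (J + 1) a' w' := by
  set e : P → ℝ := fun p => μ p / lam p with he
  have e0 : ∀ p, 0 < e p := Z.e0
  have e1 : ∀ p, e p ≤ 1 := Z.e1
  have hμ : ∀ p, 0 ≤ μ p := fun p => (Z.m0 p).le
  have eJ : ∀ p, e p ^ J ≤ e p := fun p => pow_le_of_le_one (e0 p).le (e1 p) (by omega)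
  have eJ1 : ∀ p, e p ^ J ≤ 1 := fun p => pow_le_one₀ (e0 p).le (e1 p)
  have eJ0 : ∀ p, 0 ≤ e p ^ J := fun p => (pow_pos (e0 p) _).le
  let W : OCl P n μ lam (Set.range mz) := OCl.osc hμ Z.ml
  have hA : ∀ p, 0 ≤ s p ^ 2 * e p ^ J := fun p => mul_nonneg (sq_nonneg _) (eJ0 p)
  choose r0 r1 hr0 hr1 hrr using fun i => (h.hr i).split
  -- the amplitude correction
  set δ : Fin n → Fam P n := fun k p x => (1 / (2 * q k)) * (r0 k p x * b0 k p x) with hδ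
  have hδs : ∀ k, SC μ (fun p => s p * e p ^ J) (δ k) := fun k =>
    (((hr0 k).mul (hb0 k)).const_mul _).congrA fun p => by
      have := (sp p).ne'; simp only [he]; field_simp
  -- the tangential correction
  have hf : ∀ l, Osc μ lam (fun p => s p ^ 2 * e p ^ J) (fun m => m ≠ 0)
      (fun p x => r1 l p x + -r0 l p x * c2 lam l p x) := fun l =>
    (hr1 l).add (Osc.cos1 _ (by intro h; simpa using congrFun h l) (hr0 l).neg)
  choose v hv hve using fun l => Osc.solve hq hμ Z.ml Z.l0 hA (hf l) l
  set dw : Fin n → Fam P n := fun i p x => ∑ l, v l i p x with hdw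
  have hdws : ∀ i, W.O (fun p => s p ^ 2 * e p ^ J / lam p) (dw i) := fun i =>
    W.sum _ fun l _ => hv l i
  have hB : ∀ p, 0 ≤ s p ^ 2 * e p ^ J / lam p := fun p => div_nonneg (hA p) (Z.l0 p).le
  have hC : ∀ p, 0 ≤ s p ^ 2 / lam p := fun p => div_nonneg (sq_nonneg _) (Z.l0 p).le
  have sv : ∀ l i p, Smo (v l i p) := fun l i => ((hv l i).toSC hμ Z.ml hB).1
  have sdw : ∀ i p, Smo (dw i p) := fun i => (W.toSC hB (hdws i)).1
  have sw : ∀ i p, Smo (w i p) := fun i => (W.toSC hC (h.hw i)).1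
  have hdw2 : ∀ i, W.O (fun p => s p ^ 2 / lam p) (dw i) := fun i =>
    W.weaken 1 (hdws i) hB (fun p => by
      rw [one_mul]
      exact div_le_div_of_nonneg_right (mul_le_of_le_one_right (sq_nonneg _) (eJ1 p)) (Z.l0 p).le) hC
  have hδ1 : ∀ k, SC μ s (δ k) := fun k =>
    (hδs k).weaken 1 (fun p => mul_nonneg (sp p).le (eJ0 p))
      (fun p => by rw [one_mul]; exact mul_le_of_le_one_right (sp p).le (eJ1 p)) hμ (fun _ => le_rfl)
      fun p => (sp p).le
  have hδ2 : ∀ k, SC μ (fun p => s p * e p) (δ k) := fun k =>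
    (hδs k).weaken 1 (fun p => mul_nonneg (sp p).le (eJ0 p))
      (fun p => by rw [one_mul]; exact mul_le_mul_of_nonneg_left (eJ p) (sp p).le) hμ (fun _ => le_rfl)
      fun p => mul_nonneg (sp p).le (e0 p).le
  set a' : Fin n → Fam P n := fun k p x => a k p x + δ k p x with ha'
  set w' : Fin n → Fam P n := fun k p x => w k p x + dw k p x with hw'
  have Ha' : ∀ k, SC μ s (a' k) := fun k => (h.ha k).add (hδ1 k)
  have Hw' : ∀ k, W.O (fun p => s p ^ 2 / lam p) (w' k) := fun k => W.add (h.hw k) (hdw2 k)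
  have sw' : ∀ i p, Smo (w' i p) := fun i => (W.toSC hC (Hw' i)).1
  have l0 : ∀ p, lam p ≠ 0 := fun p => (Z.l0 p).ne'
  have HR := O_RRdiff (ξ := ek) (ρ := fun p => e p ^ J) W Z ek_mem G eJ0 h.ha Ha' h.hw Hw'
    (fun k => (hδs k).congr fun p x => by simp [ha'])
    (fun k => W.congr (hdws k) fun p x => by simp [hw'])
  have pw : ∀ i j p x, pder j (w' i p) x = pder j (w i p) x + pder j (dw i p) x := fun i j p x =>
    pder_add' (sw i p) (sdw i p) j x
  have Xd : ∀ i j p x, XX u (VV lam ek ν θ a' w') i j p x = XX u (VV lam ek ν θ a w) i j p x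
      + (pder j (dw i p) x + pder i (dw j p) x)
      + (if i = j then (a' i p x ^ 2 - a i p x ^ 2) * (1 + c2 lam i p x) else 0)
      + (RR lam ek u ν θ a' w' i j p x - RR lam ek u ν θ a w i j p x) := by
    intro i j p x
    rw [XX_free l0 G (fun k => (Ha' k).1) sw', XX_free l0 G (fun k => (h.ha k).1) sw, pw, pw]
    split_ifs <;> ring
  have hB1 : ∀ p, 0 ≤ s p ^ 2 * e p ^ (J + 1) := fun p => mul_nonneg (sq_nonneg _) (pow_pos (e0 p) _).le
  refine ⟨a', w', Ha', fun k => ((h.hd k).add (hδ2 k)).congr fun p x => by simp [ha']; ring, Hw', ?_, ?_⟩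
  · intro i
    -- error terms
    have E1 : W.O (fun p => s p ^ 2 * e p ^ (J + 1)) (fun p x =>
        (2 * (a i p x - a0 i p x) * δ i p x + δ i p x * δ i p x) * ((1 + c2 lam i p x) * q i)) := by
      have c1 : W.O (fun _ => 1) (fun p x => (1 + c2 lam i p x) * q i) :=
        W.congr (W.cmul (q i) (W.add (W.slow (SC.const 1)) (W.cos _ ⟨Pi.single i 2, rfl⟩)))
          fun p x => by simp only [c2]; ring
      have c3 : SC μ (fun p => s p ^ 2 * e p ^ (J + 1))
          (fun p x => 2 * (a i p x - a0 i p x) * δ i p x + δ i p x * δ i p x) := by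
        refine SC.add ((((h.hd i).const_mul 2).mul (hδs i)).congrA fun p => by simp only [he]; ring) ?_
        exact ((hδ2 i).mul (hδs i)).congrA fun p => by ring
      exact W.congrA (W.mul (W.slow c3) c1) fun p => by ring
    have E2 : W.O (fun p => s p ^ 2 * e p ^ (J + 1)) (fun p x => ∑ l,
        (RR lam ek u ν θ a' w' i l p x - RR lam ek u ν θ a w i l p x) * q l) := by
      refine W.sum _ fun l _ => ?_
      refine W.congr (W.congrA (W.cmul (q l) (HR i l)) fun p => by simp only [he]; ring) fun p x => by ring
    have E3 : W.O (fun p => s p ^ 2 * e p ^ (J + 1)) (fun p x => ∑ l,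
        ((∑ j, (pder j (v l i p) x + pder i (v l j p) x) * q j)
          - if i = l then r1 l p x + -r0 l p x * c2 lam l p x else 0)) := by
      refine W.sum _ fun l _ => ?_
      exact W.congrA (hve l i) fun p => by simp only [he]; ring
    refine W.congr (W.neg (W.add (W.add E1 E2) E3)) fun p x => ?_
    have pdw : ∀ i j, pder j (dw i p) x = ∑ l, pder j (v l i p) x := by
      intro i j; simp only [hdw]; rw [pder_sum _ (fun l => sv l i p)]
    have t1 : ∑ l, ((∑ j, (pder j (v l i p) x + pder i (v l j p) x) * q j)
          - if i = l then r1 l p x + -r0 l p x * c2 lam l p x else 0) =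
        ∑ j, (pder j (dw i p) x + pder i (dw j p) x) * q j - (r1 i p x + -r0 i p x * c2 lam i p x) := by
      rw [Finset.sum_sub_distrib, Finset.sum_ite_eq, if_pos (Finset.mem_univ _), Finset.sum_comm]
      congr 1
      refine Finset.sum_congr rfl fun j _ => ?_
      rw [pdw, pdw, ← Finset.sum_add_distrib, Finset.sum_mul]
    have t2 : ∑ l, (D i l p x - XX u (VV lam ek ν θ a' w') i l p x) * q l =
        ∑ l, (D i l p x - XX u (VV lam ek ν θ a w) i l p x) * q l
        - ∑ j, (pder j (dw i p) x + pder i (dw j p) x) * q j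
        - (a' i p x ^ 2 - a i p x ^ 2) * (1 + c2 lam i p x) * q i
        - ∑ l, (RR lam ek u ν θ a' w' i l p x - RR lam ek u ν θ a w i l p x) * q l := by
      have : (a' i p x ^ 2 - a i p x ^ 2) * (1 + c2 lam i p x) * q i =
          ∑ l, (if i = l then (a' i p x ^ 2 - a i p x ^ 2) * (1 + c2 lam i p x) else 0) * q l := by
        simp
      rw [this]
      simp only [← Finset.sum_sub_distrib]
      exact Finset.sum_congr rfl fun l _ => by rw [Xd]; ring
    rw [t1, t2, hrr i p x]
    have t3 : 2 * a0 i p x * δ i p x * q i = r0 i p x := by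
      simp only [hδ]
      have := q0 i
      have h1 := hab i p x
      field_simp
      linear_combination r0 i p x * h1
    simp only [ha']
    linear_combination (1 + c2 lam i p x) * t3
  · intro i j hij
    have hD : ∀ p, 0 ≤ s p ^ 2 * e p := fun p => mul_nonneg (sq_nonneg _) (e0 p).le
    have F1 : ∀ i j, W.O (fun p => s p ^ 2 * e p) (fun p => pder j (dw i p)) := by
      intro i j
      refine W.weaken 1 (W.pd j hB (hdws i)) (fun p => mul_nonneg (hB p) (Z.l0 p).le) (fun p => ?_) hD
      rw [one_mul, div_mul_cancel₀ _ (l0 p)]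
      exact mul_le_mul_of_nonneg_left (eJ p) (sq_nonneg _)
    have F2 : W.O (fun p => s p ^ 2 * e p)
        (fun p x => RR lam ek u ν θ a' w' i j p x - RR lam ek u ν θ a w i j p x) := by
      refine W.weaken 1 (HR i j) (fun p => mul_nonneg (hA p) (e0 p).le) (fun p => ?_) hD
      calc _ = s p ^ 2 * e p * e p ^ J := by simp only [he]; ring
        _ ≤ s p ^ 2 * e p := mul_le_of_le_one_right (hD p) (eJ1 p)
        _ = _ := (one_mul _).symm
    refine W.congr (W.add (W.add (h.ho i j hij) (W.add (F1 i j) (F1 j i))) F2) fun p x => ?_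
    rw [Xd, if_neg hij]; ring

lemma FS.init 
    (G : Geo s μ u ν θ) (Z : Siz s μ lam)
    (ha0 : ∀ k, SC μ s (a0 k)) 
    (haD : ∀ k p x, a0 k p x ^ 2 * q k = ∑ l, D k l p x * q l) :
    ∃ a w, FS s μ lam u ν θ D q a0 1 a w := by
  have hμ : ∀ p, 0 ≤ μ p := fun p => (Z.m0 p).le
  let W : OCl P n μ lam (Set.range mz) := OCl.osc hμ Z.ml
  have l0 : ∀ p, lam p ≠ 0 := fun p => (Z.l0 p).ne'
  have hC : ∀ p, 0 ≤ s p ^ 2 / lam p := fun p => div_nonneg (sq_nonneg _) (Z.l0 p).le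
  set α : Fin n → Fam P n := fun k p x => (-1/4) / lam p * (a0 k p x * a0 k p x) with hα
  have scl : SC μ (fun p => 1 / lam p) (fun (p : P) (_ : Fin n → ℝ) => (-1/4) / lam p) :=
    SC.cst ⟨1/4, fun p => by
      rw [abs_div, abs_of_pos (Z.l0 p)]; norm_num; exact le_of_eq (by ring)⟩
  have hαs : ∀ k, SC μ (fun p => s p ^ 2 / lam p) (α k) := fun k =>
    (scl.mul ((ha0 k).mul (ha0 k))).congrA fun p => by ring
  set w : Fin n → Fam P n := fun k p x => α k p x * Real.sin (lam p * ph (mz (Pi.single k 2)) x) with hw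
  have Hw : ∀ k, W.O (fun p => s p ^ 2 / lam p) (w k) := fun k => Osc.sin1 _ trivial (hαs k)
  have sw : ∀ i p, Smo (w i p) := fun i => (W.toSC hC (Hw i)).1
  have pw : ∀ i j p x, pder j (w i p) x = pder j (α i p) x * Real.sin (lam p * ph (mz (Pi.single i 2)) x)
      + if i = j then - (a0 i p x ^ 2 * c2 lam i p x) / 2 else 0 := by
    intro i j p x
    simp only [hw]
    rw [pder_mul ((hαs i).1 p) (smo_sin _ _), pder_sin]
    simp only [hα, c2, mz, Pi.single_apply]
    have := l0 p
    split_ifs with h1 h2 h2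
    · push_cast; field_simp; ring
    · exact absurd h1.symm h2
    · exact absurd h2.symm h1
    · push_cast; ring
  have F1 : ∀ i j, W.O (fun p => s p ^ 2 * (μ p / lam p))
      (fun p x => pder j (α i p) x * Real.sin (lam p * ph (mz (Pi.single i 2)) x)) := fun i j =>
    Osc.sin1 _ trivial (((hαs i).pd j).congrA fun p => by ring)
  have HR := O_RR (ξ := ek) W Z ek_mem G ha0 Hw
  have Xe : ∀ i j p x, XX u (VV lam ek ν θ a0 w) i j p x =
      (pder j (α i p) x * Real.sin (lam p * ph (mz (Pi.single i 2)) x)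
      + pder i (α j p) x * Real.sin (lam p * ph (mz (Pi.single j 2)) x)
      + RR lam ek u ν θ a0 w i j p x) + (if i = j then a0 i p x ^ 2 else 0) := by
    intro i j p x
    rw [XX_free l0 G (fun k => (ha0 k).1) sw, pw, pw]
    by_cases h : i = j
    · subst h; simp only [if_true]; ring
    · rw [if_neg h, if_neg h, if_neg h, if_neg (Ne.symm h)]; ring
  have HX : ∀ i j, W.O (fun p => s p ^ 2 * (μ p / lam p)) (fun p x =>
      (pder j (α i p) x * Real.sin (lam p * ph (mz (Pi.single i 2)) x)
      + pder i (α j p) x * Real.sin (lam p * ph (mz (Pi.single j 2)) x)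
      + RR lam ek u ν θ a0 w i j p x)) := fun i j => W.add (W.add (F1 i j) (F1 j i)) (HR i j)
  refine ⟨a0, w, ha0, fun k => SC.zero.congr fun p x => (sub_self _).symm, Hw, fun i => ?_, fun i j hij => ?_⟩
  · refine W.congr (W.congrA (W.neg (W.sum Finset.univ fun l _ => W.cmul (q l) (HX i l))) fun p => by ring) fun p x => ?_
    have : ∑ l, (D i l p x - XX u (VV lam ek ν θ a0 w) i l p x) * q l
      = ∑ l, D i l p x * q l - ∑ l, (if i = l then a0 i p x ^ 2 else 0) * q l -
        ∑ l, q l * (pder l (α i p) x * Real.sin (lam p * ph (mz (Pi.single i 2)) x)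
      + pder i (α l p) x * Real.sin (lam p * ph (mz (Pi.single l 2)) x)
      + RR lam ek u ν θ a0 w i l p x) := by
      simp only [← Finset.sum_sub_distrib]
      exact Finset.sum_congr rfl fun l _ => by rw [Xe]; ring
    rw [this, ← haD]
    simp
  · refine W.congr (HX i j) fun p x => ?_
    rw [Xe, if_neg hij, add_zero]

/-- The free step. -/
theorem free_step (hq : ∀ m : Fin n → ℤ, m ≠ 0 → ∑ i, (m i : ℝ) * q i ≠ 0) (q0 : ∀ i, q i ≠ 0)
    (G : Geo s μ u ν θ) (Z : Siz s μ lam) (sp : ∀ p, 0 < s p)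
    (ha0 : ∀ k, SC μ s (a0 k)) (hb0 : ∀ k, SC μ (fun p => 1 / s p) (b0 k))
    (hab : ∀ k p x, a0 k p x * b0 k p x = 1)
    (haD : ∀ k p x, a0 k p x ^ 2 * q k = ∑ l, D k l p x * q l) (J : ℕ) (hJ : 1 ≤ J) :
    ∃ a w, FS s μ lam u ν θ D q a0 J a w := by
  induction J, hJ using Nat.le_induction with
  | base => exact FS.init G Z ha0 haD
  | succ J hJ ih =>
    obtain ⟨a, w, h⟩ := ih
    exact h.step hq q0 G Z sp hb0 hab hJ

end free
end CI

namespace CI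
open scoped ContDiff

section costly
variable {P : Type} {n d : ℕ} {s μ lam : P → ℝ} {u : Fin d → Fam P n}
  {ν θ : Fin n → Fin d → Fam P n}

/-- A perturbation step with rapidly oscillating error of first order. -/
lemma costly_step (G : Geo s μ u ν θ) (Z : Siz s μ lam) (ξ : Fin n → Fin n → ℝ)
    {β : Fin n → Fam P n} (hβ : ∀ k, SC μ s (β k)) :
    ∃ w : Fin n → Fam P n, (∀ l, SC lam (fun p => s p ^ 2 / lam p) (w l)) ∧
      ∀ i j, SC lam (fun p => s p ^ 2 * (μ p / lam p)) (fun p x =>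
        XX u (VV lam ξ ν θ β w) i j p x - ∑ k, β k p x ^ 2 * (ξ k i * ξ k j)) := by
  have hμ : ∀ p, 0 ≤ μ p := fun p => (Z.m0 p).le
  let W : OCl P n μ lam Set.univ := OCl.ofSC hμ Z.ml _
  have l0 : ∀ p, lam p ≠ 0 := fun p => (Z.l0 p).ne'
  have hC : ∀ p, 0 ≤ s p ^ 2 / lam p := fun p => div_nonneg (sq_nonneg _) (Z.l0 p).le
  have hE : ∀ p, 0 ≤ s p ^ 2 * (μ p / lam p) := fun p => mul_nonneg (sq_nonneg _) (Z.e0 p).le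
  have scl : SC μ (fun p => 1 / lam p) (fun (p : P) (_ : Fin n → ℝ) => (-1/4) / lam p) :=
    SC.cst ⟨1/4, fun p => by
      rw [abs_div, abs_of_pos (Z.l0 p)]; norm_num; exact le_of_eq (by ring)⟩
  set α : Fin n → Fin n → Fam P n := fun k i p x =>
    ξ k i * ((-1/4) / lam p * (β k p x * β k p x)) with hα
  have hαs : ∀ k i, SC μ (fun p => s p ^ 2 / lam p) (α k i) := fun k i =>
    ((scl.mul ((hβ k).mul (hβ k))).const_mul _).congrA fun p => by ring
  set sn : Fin n → Fam P n := fun k p x => Real.sin (lam p * ph (fun i => 2 * ξ k i) x) with hsn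
  set w : Fin n → Fam P n := fun i p x => ∑ k, α k i p x * sn k p x with hw
  have hsn1 : ∀ k, W.O (fun _ => 1) (sn k) := fun k => W.sin _ trivial
  have Hw : ∀ i, W.O (fun p => s p ^ 2 / lam p) (w i) := fun i =>
    W.sum _ fun k _ => W.congrA (W.mul (W.slow (hαs k i)) (hsn1 k)) fun p => mul_one _
  have sw : ∀ i p, Smo (w i p) := fun i => (W.toSC hC (Hw i)).1
  have pw : ∀ i j p x, pder j (w i p) x = (∑ k, pder j (α k i p) x * sn k p x)
      - ∑ k, β k p x ^ 2 * (ξ k i * ξ k j) * Real.cos (lam p * ph (fun i => 2 * ξ k i) x) / 2 := by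
    intro i j p x
    simp only [hw]
    rw [pder_sum _ (fun k => ((hαs k i).1 p).mul (smo_sin _ _)), ← Finset.sum_sub_distrib]
    refine Finset.sum_congr rfl fun k _ => ?_
    rw [pder_mul ((hαs k i).1 p) (smo_sin _ _)]
    simp only [hsn]
    rw [pder_sin]
    simp only [hα]
    have := l0 p
    field_simp
    ring
  have F1 : ∀ i j, W.O (fun p => s p ^ 2 * (μ p / lam p))
      (fun p x => ∑ k, pder j (α k i p) x * sn k p x) := fun i j =>
    W.sum _ fun k _ => W.congrA (W.mul (W.slow ((hαs k i).pd j)) (hsn1 k)) fun p => by ring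
  have HR := O_RR (ξ := ξ) W Z (fun _ => trivial) G hβ Hw
  refine ⟨w, fun l => W.toSC hC (Hw l), fun i j => W.toSC hE ?_⟩
  refine W.congr (W.add (W.add (F1 i j) (F1 j i)) (HR i j)) fun p x => ?_
  rw [XX_eq l0 G (fun k => (hβ k).1) sw, pw, pw]
  have t1 : ∑ k, β k p x ^ 2 * (2 * Real.cos (lam p * ph (ξ k) x) ^ 2) * (ξ k i * ξ k j) =
      ∑ k, β k p x ^ 2 * (ξ k i * ξ k j) +
      (∑ k, β k p x ^ 2 * (ξ k i * ξ k j) * Real.cos (lam p * ph (fun i => 2 * ξ k i) x) / 2 +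
      ∑ k, β k p x ^ 2 * (ξ k j * ξ k i) * Real.cos (lam p * ph (fun i => 2 * ξ k i) x) / 2) := by
    simp only [← Finset.sum_add_distrib]
    refine Finset.sum_congr rfl fun k _ => ?_
    have e1 : ph (fun i => 2 * ξ k i) x = 2 * ph (ξ k) x := by
      simp only [ph, Finset.mul_sum]; exact Finset.sum_congr rfl fun i _ => by ring
    rw [e1, show lam p * (2 * ph (ξ k) x) = 2 * (lam p * ph (ξ k) x) by ring, Real.cos_two_mul]
    ring
  rw [t1]
  ring

end costly
end CI

namespace CI
open scoped ContDiff

section mat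
open Filter Topology

lemma inv_sqrt_alg {𝔸 : Type} [NormedRing 𝔸] [NormedAlgebra ℝ 𝔸] [CompleteSpace 𝔸] [StarRing 𝔸]
    [ContinuousStar 𝔸] :
    ∃ B : 𝔸 → 𝔸, ContDiffAt ℝ ω B 1 ∧ B 1 = 1 ∧
      ∀ᶠ y in 𝓝 (1:𝔸), star y = y → star (B y) = B y ∧ B y * y * B y = 1 := by
  let f : 𝔸 → 𝔸 := fun y => y * y
  have hf : ContDiffAt ℝ ω f 1 := (contDiff_id.mul contDiff_id).contDiffAt
  let f' : 𝔸 ≃L[ℝ] 𝔸 := ContinuousLinearEquiv.smulLeft (Units.mk0 (2:ℝ) two_ne_zero)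
  have hf' : HasFDerivAt f (f' : 𝔸 →L[ℝ] 𝔸) 1 := by
    have h := (hasFDerivAt_id (𝕜 := ℝ) (1:𝔸)).mul' (hasFDerivAt_id (𝕜 := ℝ) (1:𝔸))
    refine h.congr_fderiv ?_
    ext v
    show _ = (2:ℝ) • v
    simp [two_smul]
  have hs : HasStrictFDerivAt f (f' : 𝔸 →L[ℝ] 𝔸) 1 := hf.hasStrictFDerivAt' hf' (by simp)
  set R := hs.localInverse f f' 1 with hR
  have f1 : f 1 = 1 := by simp [f]
  have hRc : ContDiffAt ℝ ω R 1 := by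
    have := hf.to_localInverse hf' (by simp)
    rw [f1] at this; exact this
  have hri : ∀ᶠ y in 𝓝 (1:𝔸), f (R y) = y := by
    have := hs.eventually_right_inverse; rwa [f1] at this
  have hli : ∀ᶠ y in 𝓝 (1:𝔸), R (f y) = y := hs.eventually_left_inverse
  have R1 : R 1 = 1 := by have := hli.self_of_nhds; rwa [f1] at this
  have hRt : Tendsto R (𝓝 1) (𝓝 1) := by
    have := hRc.continuousAt.tendsto; rwa [R1] at this
  have hst : Tendsto (fun y => star (R y)) (𝓝 (1:𝔸)) (𝓝 1) := by
    have := (continuous_star (R := 𝔸)).tendsto (1:𝔸)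
    rw [star_one] at this
    exact this.comp hRt
  have hstar : ∀ᶠ y in 𝓝 (1:𝔸), star y = y → star (R y) = R y := by
    filter_upwards [hst.eventually hli, hri] with y h1 h2 hy
    have : f (star (R y)) = y := by
      have h3 : star (f (R y)) = star y := by rw [h2]
      simp only [f, star_mul] at h3 ⊢
      rw [h3, hy]
    rw [this] at h1; exact h1.symm
  have hic : ContDiffAt ℝ ω (Ring.inverse : 𝔸 → 𝔸) 1 := contDiffAt_ringInverse ℝ (1 : 𝔸ˣ)
  have hi1 : Ring.inverse (1:𝔸) = 1 := Ring.inverse_one 𝔸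
  have hit : Tendsto (Ring.inverse : 𝔸 → 𝔸) (𝓝 1) (𝓝 1) := by
    have := hic.continuousAt.tendsto; rwa [hi1] at this
  refine ⟨fun y => R (Ring.inverse y), ?_, by simp [R1], ?_⟩
  · have : ContDiffAt ℝ ω R (Ring.inverse (1:𝔸)) := by rw [hi1]; exact hRc
    exact this.comp (1:𝔸) hic
  · have hun : ∀ᶠ y in 𝓝 (1:𝔸), IsUnit y := Units.nhds (1 : 𝔸ˣ)
    filter_upwards [hit.eventually hstar, hit.eventually hri, hun] with y h1 h2 h3 hy
    have h4 : star (Ring.inverse y) = Ring.inverse y := by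
      rw [← Ring.inverse_star, hy]
    have h5 := h1 h4
    refine ⟨h5, ?_⟩
    set x := R (Ring.inverse y) with hx
    have e1 : x * x * y = 1 := by
      have : x * x = Ring.inverse y := h2
      rw [this]; exact Ring.inverse_mul_cancel _ h3
    have e2 : y * (x * x) = 1 := by
      have : x * x = Ring.inverse y := h2
      rw [this]; exact Ring.mul_inverse_cancel _ h3
    have e3 : y * x = x * y := by
      calc y * x = y * x * (x * x * y) := by rw [e1, mul_one]
        _ = y * (x * x) * x * y := by noncomm_ring
        _ = x * y := by rw [e2, one_mul]
    calc x * y * x = x * (y * x) := by noncomm_ring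
      _ = x * x * y := by rw [e3]; noncomm_ring
      _ = 1 := e1

/-- Transfer of a locally analytic function on matrices to coordinates. -/
lemma mat_transfer {n : ℕ} {p : Matrix (Fin n) (Fin n) ℝ → Matrix (Fin n) (Fin n) ℝ → Prop}
    {B : (EuclideanSpace ℝ (Fin n) →L[ℝ] EuclideanSpace ℝ (Fin n)) →
      (EuclideanSpace ℝ (Fin n) →L[ℝ] EuclideanSpace ℝ (Fin n))}
    (hB : ContDiffAt ℝ ω B 1) (hB1 : B 1 = 1)
    (hp : ∀ᶠ y in 𝓝 (1 : EuclideanSpace ℝ (Fin n) →L[ℝ] EuclideanSpace ℝ (Fin n)),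
      p ((Matrix.toEuclideanCLM (n := Fin n) (𝕜 := ℝ)).symm y) ((Matrix.toEuclideanCLM (n := Fin n) (𝕜 := ℝ)).symm (B y))) :
    ∃ F : Fin n → Fin n → ((Fin n × Fin n) → ℝ) → ℝ, ∃ δ > 0, ∃ C : ℝ, 0 ≤ C ∧
      ∀ z : (Fin n × Fin n) → ℝ, ∀ t ≤ δ, (∀ i j, |z (i,j) - if i = j then 1 else 0| ≤ t) →
        (∀ k l, ContDiffAt ℝ ∞ (F k l) z) ∧
        (∀ k l, |F k l z - if k = l then 1 else 0| ≤ C * t) ∧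
        p (Matrix.of fun i j => z (i,j)) (Matrix.of fun i j => F i j z) := by
  let E := EuclideanSpace ℝ (Fin n) →L[ℝ] EuclideanSpace ℝ (Fin n)
  let opl : ((Fin n × Fin n) → ℝ) →ₗ[ℝ] E :=
    { toFun := fun z => Matrix.toEuclideanCLM (𝕜 := ℝ) (Matrix.of fun i j => z (i,j))
      map_add' := fun z w => by rw [← map_add]; rfl
      map_smul' := fun c z => by
        rw [RingHom.id_apply, ← map_smul]; rfl }
  let op : ((Fin n × Fin n) → ℝ) →L[ℝ] E := LinearMap.toContinuousLinearMap opl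
  let enl : Fin n → Fin n → E →ₗ[ℝ] ℝ := fun k l =>
    { toFun := fun T => (Matrix.toEuclideanCLM (𝕜 := ℝ)).symm T k l
      map_add' := fun z w => by rw [map_add]; rfl
      map_smul' := fun c z => by rw [RingHom.id_apply, map_smul]; rfl }
  let en : Fin n → Fin n → E →L[ℝ] ℝ := fun k l => LinearMap.toContinuousLinearMap (enl k l)
  let z0 : (Fin n × Fin n) → ℝ := fun ij => if ij.1 = ij.2 then 1 else 0
  have op0 : op z0 = 1 := by
    show Matrix.toEuclideanCLM (𝕜 := ℝ) (Matrix.of fun i j => z0 (i,j)) = 1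
    rw [show (Matrix.of fun i j => z0 (i,j)) = (1 : Matrix (Fin n) (Fin n) ℝ) by
      ext i j; simp [z0, Matrix.one_apply], map_one]
  let F : Fin n → Fin n → ((Fin n × Fin n) → ℝ) → ℝ := fun k l z => en k l (B (op z))
  have hF : ∀ k l, ContDiffAt ℝ ω (F k l) z0 := fun k l => by
    have h1 : ContDiffAt ℝ ω B (op z0) := by rw [op0]; exact hB
    exact (en k l).contDiff.contDiffAt.comp z0 (h1.comp z0 op.contDiff.contDiffAt)
  have hF0 : ∀ k l, F k l z0 = if k = l then 1 else 0 := fun k l => by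
    show (Matrix.toEuclideanCLM (𝕜 := ℝ)).symm (B (op z0)) k l = _
    rw [op0, hB1, map_one, Matrix.one_apply]
  have hp' : ∀ᶠ z in 𝓝 z0, p ((Matrix.toEuclideanCLM (n := Fin n) (𝕜 := ℝ)).symm (op z)) ((Matrix.toEuclideanCLM (n := Fin n) (𝕜 := ℝ)).symm (B (op z))) := by
    have := op.continuous.tendsto z0
    rw [op0] at this
    exact this.eventually hp
  have hc : ∀ᶠ z in 𝓝 z0, ∀ k l, ContDiffAt ℝ ω (F k l) z := by
    rw [eventually_all]; intro k; rw [eventually_all]; intro l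
    exact (hF k l).eventually (by simp)
  have hlip : ∀ k l, ∃ K : NNReal, ∃ t ∈ 𝓝 z0, LipschitzOnWith K (F k l) t := fun k l =>
    ((hF k l).of_le (by simp)).exists_lipschitzOnWith
  choose K t ht hK using hlip
  have ht' : ∀ᶠ z in 𝓝 z0, ∀ k l, z ∈ t k l := by
    rw [eventually_all]; intro k; rw [eventually_all]; intro l; exact ht k l
  obtain ⟨δ, hδ, h⟩ := Metric.eventually_nhds_iff.1 (hp'.and (hc.and ht'))
  refine ⟨F, δ / 2, half_pos hδ, ∑ k, ∑ l, (K k l : ℝ), by positivity, fun z t' ht'' hz => ?_⟩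
  have hd : ∀ t', (∀ i j, |z (i,j) - if i = j then 1 else 0| ≤ t') → 0 ≤ t' → dist z z0 ≤ t' := by
    intro t' hz h0
    rw [dist_pi_le_iff h0]
    rintro ⟨i, j⟩
    rw [Real.dist_eq]; exact hz i j
  have hzd : dist z z0 < δ := by
    refine (hd (δ/2) (fun i j => (hz i j).trans ht'') (half_pos hδ).le).trans_lt (half_lt_self hδ)
  obtain ⟨h1, h2, h3⟩ := h hzd
  refine ⟨fun k l => (h2 k l).of_le (by simp), fun k l => ?_, ?_⟩
  · have ht0 : 0 ≤ t' := (abs_nonneg _).trans (hz k l)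
    have h4 := (hK k l).dist_le_mul z (h3 k l) z0 (mem_of_mem_nhds (ht k l))
    rw [hF0, Real.dist_eq] at h4
    refine h4.trans (mul_le_mul ?_ (hd t' hz ht0) dist_nonneg (by positivity))
    calc (K k l : ℝ) ≤ ∑ l, (K k l : ℝ) :=
          Finset.single_le_sum (f := fun l => (K k l : ℝ)) (fun _ _ => by positivity) (Finset.mem_univ l)
      _ ≤ _ := Finset.single_le_sum (f := fun k => ∑ l, (K k l : ℝ)) (fun _ _ => by positivity) (Finset.mem_univ k)
  · have e1 : (Matrix.toEuclideanCLM (n := Fin n) (𝕜 := ℝ)).symm (op z) = Matrix.of fun i j => z (i,j) := 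
      (Matrix.toEuclideanCLM (𝕜 := ℝ)).symm_apply_apply _
    rw [e1] at h1
    exact h1

lemma exists_inv (n : ℕ) :
    ∃ F : Fin n → Fin n → ((Fin n × Fin n) → ℝ) → ℝ, ∃ δ > 0, ∃ C : ℝ, 0 ≤ C ∧
      ∀ z : (Fin n × Fin n) → ℝ, ∀ t ≤ δ, (∀ i j, |z (i,j) - if i = j then 1 else 0| ≤ t) →
        (∀ k l, ContDiffAt ℝ ∞ (F k l) z) ∧
        (∀ k l, |F k l z - if k = l then 1 else 0| ≤ C * t) ∧
        ∀ i l, ∑ m, z (i,m) * F m l z = if i = l then 1 else 0 := by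
  have hic : ContDiffAt ℝ ω (Ring.inverse : (EuclideanSpace ℝ (Fin n) →L[ℝ] EuclideanSpace ℝ (Fin n)) → _) 1 :=
    contDiffAt_ringInverse ℝ (1 : (EuclideanSpace ℝ (Fin n) →L[ℝ] EuclideanSpace ℝ (Fin n))ˣ)
  have hun := Units.nhds (1 : (EuclideanSpace ℝ (Fin n) →L[ℝ] EuclideanSpace ℝ (Fin n))ˣ)
  obtain ⟨F, δ, hδ, C, hC, h⟩ := mat_transfer (p := fun y b => y * b = 1) hic (Ring.inverse_one _) (by
    filter_upwards [hun] with y hy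
    rw [← map_mul, Ring.mul_inverse_cancel _ hy, map_one])
  refine ⟨F, δ, hδ, C, hC, fun z t ht hz => ?_⟩
  obtain ⟨h1, h2, h3⟩ := h z t ht hz
  refine ⟨h1, h2, fun i l => ?_⟩
  have := congrFun (congrFun h3 i) l
  rw [Matrix.mul_apply, Matrix.one_apply] at this
  exact this

lemma exists_isqrt (n : ℕ) :
    ∃ F : Fin n → Fin n → ((Fin n × Fin n) → ℝ) → ℝ, ∃ δ > 0, ∃ C : ℝ, 0 ≤ C ∧
      ∀ z : (Fin n × Fin n) → ℝ, ∀ t ≤ δ, (∀ i j, |z (i,j) - if i = j then 1 else 0| ≤ t) →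
        (∀ k l, ContDiffAt ℝ ∞ (F k l) z) ∧
        (∀ k l, |F k l z - if k = l then 1 else 0| ≤ C * t) ∧
        ((∀ i j, z (i,j) = z (j,i)) → ∀ k l, ∑ a, ∑ b, F k a z * F l b z * z (a,b) = if k = l then 1 else 0) := by
  obtain ⟨B, hB, hB1, hB2⟩ := inv_sqrt_alg (𝔸 := EuclideanSpace ℝ (Fin n) →L[ℝ] EuclideanSpace ℝ (Fin n))
  obtain ⟨F, δ, hδ, C, hC, h⟩ := mat_transfer (p := fun y b => star y = y → star b = b ∧ b * y * b = 1) hB hB1 (by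
    have ms : ∀ y, star ((Matrix.toEuclideanCLM (n := Fin n) (𝕜 := ℝ)).symm y) =
      (Matrix.toEuclideanCLM (n := Fin n) (𝕜 := ℝ)).symm (star y) := fun y =>
        ((Matrix.toEuclideanCLM (n := Fin n) (𝕜 := ℝ)).symm.map_star' y).symm
    filter_upwards [hB2] with y hy h
    rw [ms] at h
    obtain ⟨h1, h2⟩ := hy ((Matrix.toEuclideanCLM (𝕜 := ℝ)).symm.injective h)
    rw [ms, h1, ← map_mul, ← map_mul, h2, map_one]
    exact ⟨rfl, rfl⟩)
  refine ⟨F, δ, hδ, C, hC, fun z t ht hz => ?_⟩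
  obtain ⟨h1, h2, h3⟩ := h z t ht hz
  refine ⟨h1, h2, fun hsym k l => ?_⟩
  obtain ⟨h4, h5⟩ := h3 (by ext i j; simp [Matrix.star_apply, hsym j i])
  have := congrFun (congrFun h5 k) l
  rw [Matrix.mul_apply, Matrix.one_apply] at this
  rw [← this, Finset.sum_comm]
  refine Finset.sum_congr rfl fun b _ => ?_
  rw [Matrix.mul_apply, Finset.sum_mul]
  refine Finset.sum_congr rfl fun a _ => ?_
  have h6 := congrFun (congrFun h4 l) b
  simp only [Matrix.star_apply, Matrix.of_apply, star_trivial] at h6 ⊢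
  rw [h6]; ring

end mat
end CI

namespace CI
open scoped ContDiff

lemma abs_sum_le' {m : ℕ} {f : Fin m → ℝ} {c : ℝ} (h : ∀ i, |f i| ≤ c) : |∑ i, f i| ≤ m * c := by
  refine (Finset.abs_sum_le_sum_abs _ _).trans ?_
  refine (Finset.sum_le_sum fun i _ => h i).trans ?_
  simp

lemma abs_mul_le' {a b x y : ℝ} (h : |a| ≤ x) (h' : |b| ≤ y) : |a * b| ≤ x * y := by
  rw [abs_mul]; exact mul_le_mul h h' (abs_nonneg _) ((abs_nonneg _).trans h)

/-- Order-one functions whose first derivatives are of size `s μ`. -/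
def CO {P : Type} {n : ℕ} (s μ : P → ℝ) (f : Fam P n) : Prop :=
  SC μ (fun _ => 1) f ∧ ∀ j, SC μ (fun p => s p * μ p) (fun p => pder j (f p))

section co
variable {P : Type} {n d : ℕ} {s μ : P → ℝ} {f g : Fam P n}

lemma CO.add (hf : CO s μ f) (hg : CO s μ g) : CO s μ (fun p x => f p x + g p x) :=
  ⟨hf.1.add hg.1, fun j => ((hf.2 j).add (hg.2 j)).congr fun p x => by
    rw [pder_add (hf.1.1 p) (hg.1.1 p)]⟩

lemma CO.neg (hf : CO s μ f) : CO s μ (fun p x => - f p x) :=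
  ⟨hf.1.neg, fun j => ((hf.2 j).neg).congr fun p x => by rw [pder_neg]⟩

lemma CO.sub (hf : CO s μ f) (hg : CO s μ g) : CO s μ (fun p x => f p x - g p x) := by
  simpa only [sub_eq_add_neg] using hf.add hg.neg

lemma CO.mul (hf : CO s μ f) (hg : CO s μ g) : CO s μ (fun p x => f p x * g p x) :=
  ⟨(hf.1.mul hg.1).congrA fun p => one_mul _, fun j =>
    ((((hf.2 j).mul hg.1).congrA fun p => mul_one _).add ((hf.1.mul (hg.2 j)).congrA fun p => one_mul _)).congr
      fun p x => by rw [pder_mul (hf.1.1 p) (hg.1.1 p)]⟩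

lemma CO.congr (hf : CO s μ f) (h : ∀ p x, f p x = g p x) : CO s μ g := by
  have : f = g := by funext p x; exact h p x
  rwa [← this]

lemma CO.const (c : ℝ) : CO s μ (fun (_ : P) (_ : Fin n → ℝ) => c) :=
  ⟨SC.const c, fun j => SC.zero.congr fun p x => by rw [pder_const]⟩

lemma CO.sum {ι : Type*} (t : Finset ι) {F : ι → Fam P n} (h : ∀ j, CO s μ (F j)) :
    CO s μ (fun p x => ∑ j ∈ t, F j p x) := by
  classical
  induction t using Finset.induction_on with
  | empty => simpa using CO.const 0
  | insert a t ha ih => simpa only [Finset.sum_insert ha] using (h a).add ih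

lemma CO.dot {F G : Fin d → Fam P n} (hF : ∀ a, CO s μ (F a)) (hG : ∀ a, CO s μ (G a)) :
    CO s μ (fun p x => ∑ a, F a p x * G a p x) := CO.sum _ fun a => (hF a).mul (hG a)

lemma CO.comp {ι : Type} [Fintype ι] [DecidableEq ι] {K : Set (ι → ℝ)} (hKc : IsCompact K)
    {F : (ι → ℝ) → ℝ}
    (hF : ∀ z ∈ K, ContDiffAt ℝ ∞ F z) {φ : ι → Fam P n} (hφ : ∀ j, CO s μ (φ j))
    (hK : ∀ p x, (fun j => φ j p x) ∈ K) : CO s μ (fun p x => F (fun j => φ j p x)) :=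
  ⟨SC.comp hKc hF (fun j => (hφ j).1) hK, fun i =>
    SC.comp_pd hKc hF (fun j => (hφ j).1) hK fun j => (hφ j).2 i⟩

lemma CO.reindex {Q : Type} (ι : Q → P) (hf : CO s μ f) :
    CO (fun q => s (ι q)) (fun q => μ (ι q)) (fun q => f (ι q)) :=
  ⟨hf.1.reindex ι, fun j => (hf.2 j).reindex ι⟩

lemma isCompact_box {ι : Type} [Fintype ι] (c : ι → ℝ) (δ : ℝ) : IsCompact {z : ι → ℝ | ∀ j, |z j - c j| ≤ δ} := by
  have : {z : ι → ℝ | ∀ j, |z j - c j| ≤ δ} = Set.pi Set.univ fun j => Metric.closedBall (c j) δ := by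
    ext z; simp [Metric.mem_closedBall, Real.dist_eq]
  rw [this]
  exact isCompact_univ_pi fun j => isCompact_closedBall _ _

end co

/-- Correction of almost-frames to exact frames. -/
lemma frame (n d : ℕ) (C : ℝ) (hC : 0 ≤ C) : ∃ t0 > 0, ∃ C' : ℝ, 0 ≤ C' ∧ ∀ {P : Type} {s μ t : P → ℝ}
    {A N T : Fin n → Fin d → Fam P n},
    (∀ i a, CO s μ (A i a)) → (∀ i a, CO s μ (N i a)) → (∀ i a, CO s μ (T i a)) →
    (∀ i a p x, |A i a p x| ≤ C) → (∀ i a p x, |N i a p x| ≤ C) → (∀ i a p x, |T i a p x| ≤ C) →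
    (∀ p, t p ≤ t0) →
    (∀ p x i l, |(∑ a, A i a p x * T l a p x) - if i = l then 1 else 0| ≤ t p) →
    (∀ p x i k, |∑ a, A i a p x * N k a p x| ≤ t p) →
    (∀ p x k l, |(∑ a, N k a p x * N l a p x) - if k = l then 1 else 0| ≤ t p) →
    ∃ ν θ : Fin n → Fin d → Fam P n, (∀ i a, CO s μ (ν i a)) ∧ (∀ i a, CO s μ (θ i a)) ∧
      (∀ p x i k, ∑ a, A i a p x * ν k a p x = 0) ∧
      (∀ p x k l, ∑ a, ν k a p x * ν l a p x = if k = l then 1 else 0) ∧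
      (∀ p x i l, ∑ a, A i a p x * θ l a p x = if i = l then 1 else 0) ∧
      (∀ i a p x, |ν i a p x - N i a p x| ≤ C' * t p) ∧
      (∀ i a p x, |θ i a p x - T i a p x| ≤ C' * t p) := by
  obtain ⟨I, δ1, hδ1, C1, hC1, hI⟩ := exists_inv n
  obtain ⟨B, δ2, hδ2, C4, hC4, hB⟩ := exists_isqrt n
  set C2 : ℝ := C + n * (C * C1) with hC2
  have hC20 : 0 ≤ C2 := by positivity
  set C3 : ℝ := 1 + d * (n * C2 * C) + d * ((C + n * C2) * (n * C2)) with hC3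
  have hC30 : 0 < C3 := by positivity
  refine ⟨min 1 (min δ1 (δ2 / C3)), by positivity, n * (C * C1) + (n * (C4 * C3 * (C + n * C2)) + n * C2),
    by positivity, ?_⟩
  intro P s μ t A N T hA hN hT bA bN bT ht hAT hAN hNN
  have t1 : ∀ p, t p ≤ 1 := fun p => (ht p).trans (min_le_left _ _)
  have t2 : ∀ p, t p ≤ δ1 := fun p => (ht p).trans ((min_le_right _ _).trans (min_le_left _ _))
  have t3 : ∀ p, C3 * t p ≤ δ2 := fun p => by
    have := (ht p).trans ((min_le_right _ _).trans (min_le_right _ _))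
    rw [le_div_iff₀ hC30] at this; linarith
  -- dual frame
  set M : (Fin n × Fin n) → Fam P n := fun il p x => ∑ a, A il.1 a p x * T il.2 a p x with hM
  have hMc : ∀ il, CO s μ (M il) := fun il => CO.dot (hA _) (hT _)
  have hI' := fun p x => hI (fun il => M il p x) (t p) (t2 p) (fun i l => hAT p x i l)
  set J : Fin n → Fin n → Fam P n := fun k l p x => I k l (fun il => M il p x) with hJ
  have hJc : ∀ k l, CO s μ (J k l) := fun k l =>
    CO.comp (isCompact_box (fun ij : Fin n × Fin n => if ij.1 = ij.2 then (1:ℝ) else 0) δ1)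
      (fun z hz => (hI z δ1 le_rfl (fun i j => hz (i,j))).1 k l) hMc
      (fun p x ij => (hAT p x ij.1 ij.2).trans (t2 p))
  set θ : Fin n → Fin d → Fam P n := fun l a p x => ∑ m, T m a p x * J m l p x with hθ
  have hθc : ∀ l a, CO s μ (θ l a) := fun l a => CO.sum _ fun m => (hT m a).mul (hJc m l)
  have hθ1 : ∀ p x i l, ∑ a, A i a p x * θ l a p x = if i = l then 1 else 0 := by
    intro p x i l
    rw [← (hI' p x).2.2 i l]
    simp only [hθ, hJ, hM, Finset.mul_sum, Finset.sum_mul]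
    rw [Finset.sum_comm]
    refine Finset.sum_congr rfl fun m _ => Finset.sum_congr rfl fun a _ => by ring
  have hθ2 : ∀ l a p x, |θ l a p x - T l a p x| ≤ n * (C * C1) * t p := by
    intro l a p x
    have : θ l a p x - T l a p x = ∑ m, T m a p x * (J m l p x - if m = l then 1 else 0) := by
      simp [hθ, mul_sub, Finset.sum_sub_distrib]
    rw [this, mul_assoc, mul_assoc]
    exact abs_sum_le' fun m => abs_mul_le' (bT m a p x) ((hI' p x).2.1 m l)
  have hn0 : ∀ p (x : Fin n → ℝ) (k : Fin n), 0 ≤ t p := fun p x k => (abs_nonneg _).trans (hAN p x k k)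
  have hθb : ∀ l a p x, |θ l a p x| ≤ C2 := by
    intro l a p x
    have h1 := hθ2 l a p x
    have h2 := bT l a p x
    have h3 : n * (C * C1) * t p ≤ n * (C * C1) := mul_le_of_le_one_right (by positivity) (t1 p)
    calc |θ l a p x| = |T l a p x + (θ l a p x - T l a p x)| := by ring_nf
      _ ≤ |T l a p x| + |θ l a p x - T l a p x| := abs_add_le _ _
      _ ≤ _ := by rw [hC2]; linarith
  -- projected normals
  set S : Fin n → Fin d → Fam P n := fun k a p x =>
    N k a p x - ∑ l, (∑ b, A l b p x * N k b p x) * θ l a p x with hS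
  have hSc : ∀ k a, CO s μ (S k a) := fun k a =>
    (hN k a).sub (CO.sum _ fun l => (CO.dot (hA l) (hN k)).mul (hθc l a))
  have hSA : ∀ p x i k, ∑ a, A i a p x * S k a p x = 0 := by
    intro p x i k
    simp only [hS, mul_sub, Finset.sum_sub_distrib]
    have : ∀ c : Fin n → ℝ, ∑ a, A i a p x * ∑ l, c l * θ l a p x =
        ∑ l, c l * ∑ a, A i a p x * θ l a p x := by
      intro c
      generalize θ = θ
      simp only [Finset.mul_sum]
      rw [Finset.sum_comm]
      refine Finset.sum_congr rfl fun l _ => Finset.sum_congr rfl fun a _ => by ring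
    rw [this]
    simp only [hθ1]
    simp
  have hSN : ∀ k a p x, |S k a p x - N k a p x| ≤ n * C2 * t p := by
    intro k a p x
    have : S k a p x - N k a p x = - ∑ l, (∑ b, A l b p x * N k b p x) * θ l a p x := by
      simp only [hS]; ring
    rw [this, abs_neg, mul_assoc, mul_comm C2]
    exact abs_sum_le' fun l => abs_mul_le' (hAN p x l k) (hθb l a p x)
  have hSb : ∀ k a p x, |S k a p x| ≤ C + n * C2 := by
    intro k a p x
    have h1 := hSN k a p x
    have h2 := bN k a p x
    have h3 : n * C2 * t p ≤ n * C2 := mul_le_of_le_one_right (by positivity) (t1 p)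
    calc |S k a p x| = |N k a p x + (S k a p x - N k a p x)| := by ring_nf
      _ ≤ |N k a p x| + |S k a p x - N k a p x| := abs_add_le _ _
      _ ≤ _ := by linarith
  set G : (Fin n × Fin n) → Fam P n := fun kl p x => ∑ a, S kl.1 a p x * S kl.2 a p x with hG
  have hGc : ∀ kl, CO s μ (G kl) := fun kl => CO.dot (hSc _) (hSc _)
  have hG1 : ∀ p x k l, |G (k,l) p x - if k = l then 1 else 0| ≤ C3 * t p := by
    intro p x k l
    have e : G (k,l) p x - (if k = l then 1 else 0) = ((∑ a, N k a p x * N l a p x) - if k = l then 1 else 0)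
        + (∑ a, (S k a p x - N k a p x) * N l a p x) + ∑ a, S k a p x * (S l a p x - N l a p x) := by
      have : G (k,l) p x = (∑ a, N k a p x * N l a p x) + (∑ a, (S k a p x - N k a p x) * N l a p x)
         + ∑ a, S k a p x * (S l a p x - N l a p x) := by
        simp only [hG, ← Finset.sum_add_distrib]
        exact Finset.sum_congr rfl fun a _ => by ring
      rw [this]; ring
    rw [e]
    have h1 := hNN p x k l
    have h2 : |∑ a, (S k a p x - N k a p x) * N l a p x| ≤ d * (n * C2 * t p * C) :=
      abs_sum_le' fun a => abs_mul_le' (hSN k a p x) (bN l a p x)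
    have h3 : |∑ a, S k a p x * (S l a p x - N l a p x)| ≤ d * ((C + n * C2) * (n * C2 * t p)) :=
      abs_sum_le' fun a => abs_mul_le' (hSb k a p x) (hSN l a p x)
    refine (abs_add_three _ _ _).trans ?_
    rw [hC3]; linarith
  have hB' := fun p x => hB (fun kl => G kl p x) (C3 * t p) (t3 p) (fun k l => hG1 p x k l)
  set Bf : Fin n → Fin n → Fam P n := fun k l p x => B k l (fun kl => G kl p x) with hBf
  have hBc : ∀ k l, CO s μ (Bf k l) := fun k l =>
    CO.comp (isCompact_box (fun ij : Fin n × Fin n => if ij.1 = ij.2 then (1:ℝ) else 0) δ2)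
      (fun z hz => (hB z δ2 le_rfl (fun i j => hz (i,j))).1 k l) hGc
      (fun p x ij => (hG1 p x ij.1 ij.2).trans (t3 p))
  set ν : Fin n → Fin d → Fam P n := fun k a p x => ∑ m, Bf k m p x * S m a p x with hν
  refine ⟨ν, θ, fun k a => CO.sum _ fun m => (hBc k m).mul (hSc m a), hθc, ?_, ?_, hθ1, ?_, ?_⟩
  · intro p x i k
    have : ∑ a, A i a p x * ν k a p x = ∑ m, Bf k m p x * ∑ a, A i a p x * S m a p x := by
      simp only [hν, Finset.mul_sum]
      rw [Finset.sum_comm]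
      refine Finset.sum_congr rfl fun m _ => Finset.sum_congr rfl fun a _ => by ring
    rw [this]; simp [hSA]
  · intro p x k l
    rw [← (hB' p x).2.2 (fun i j => by
      simp only [hG]; exact Finset.sum_congr rfl fun a _ => mul_comm _ _) k l]
    simp only [hν, hBf, hG, Finset.mul_sum, Finset.sum_mul]
    rw [Finset.sum_comm]
    rw [Finset.sum_comm]
    have : ∀ a, ∑ i, ∑ j, B k j (fun kl => ∑ a, S kl.1 a p x * S kl.2 a p x) * S j a p x * 
      (B l i (fun kl => ∑ a, S kl.1 a p x * S kl.2 a p x) * S i a p x) = 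
      ∑ j, ∑ i, B k j (fun kl => ∑ a, S kl.1 a p x * S kl.2 a p x) * B l i (fun kl => ∑ a, S kl.1 a p x * S kl.2 a p x) *
       (S j a p x * S i a p x) := by
      intro a
      rw [Finset.sum_comm]
      refine Finset.sum_congr rfl fun m _ => Finset.sum_congr rfl fun a _ => by ring
    rw [Finset.sum_congr rfl fun a _ => this a, Finset.sum_comm]
    refine Finset.sum_congr rfl fun m _ => ?_
    rw [Finset.sum_comm]
  · intro k a p x
    have e : ν k a p x - N k a p x = (∑ m, (Bf k m p x - if k = m then 1 else 0) * S m a p x)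
        + (S k a p x - N k a p x) := by
      simp [hν, sub_mul, Finset.sum_sub_distrib]
    have h1 : |∑ m, (Bf k m p x - if k = m then 1 else 0) * S m a p x| ≤
        n * (C4 * (C3 * t p) * (C + n * C2)) :=
      abs_sum_le' fun m => abs_mul_le' ((hB' p x).2.1 k m) (hSb m a p x)
    have h2 := hSN k a p x
    have h3 : 0 ≤ n * (C * C1) * t p := mul_nonneg (by positivity) (hn0 p x k)
    rw [e]
    refine (abs_add_le _ _).trans ?_
    linarith
  · intro k a p x
    have h3 : 0 ≤ (n * (C4 * C3 * (C + n * C2)) + n * C2) * t p := mul_nonneg (by positivity) (hn0 p x k)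
    have := hθ2 k a p x
    linarith

end CI

namespace CI
open scoped ContDiff

/-- Induced metric. -/
def Hm {P : Type} {n d : ℕ} (u : Fin d → Fam P n) (i j : Fin n) : Fam P n :=
  fun p x => ∑ b, pder i (u b p) x * pder j (u b p) x

lemma Hm_add {P : Type} {n d : ℕ} {u V : Fin d → Fam P n} (hu : ∀ b p, Smo (u b p)) (hV : ∀ b p, Smo (V b p))
    (i j : Fin n) (p : P) (x : Fin n → ℝ) :
    Hm (fun b p x => u b p x + V b p x) i j p x = Hm u i j p x + XX u V i j p x := by
  simp only [Hm, XX, pder_add (hu _ _) (hV _ _), ← Finset.sum_add_distrib]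
  exact Finset.sum_congr rfl fun b _ => by ring

lemma unif {m : ℕ} {R : Fin m → ℝ → Prop} (hm : ∀ i c c', c ≤ c' → R i c → R i c') (h : ∀ i, ∃ c, R i c) :
    ∃ c, 0 ≤ c ∧ ∀ i, R i c := by
  choose c hc using h
  refine ⟨∑ i, |c i|, Finset.sum_nonneg fun i _ => abs_nonneg _, fun i => hm i (c i) _ ?_ (hc i)⟩
  exact (le_abs_self _).trans (Finset.single_le_sum (f := fun i => |c i|) (fun j _ => abs_nonneg _) (Finset.mem_univ i))

/-- uniform bound for a finite collection -/
lemma SC.bd2 {P : Type} {n m d : ℕ} {μ A : P → ℝ} (hA : ∀ p, 0 ≤ A p) {F : Fin m → Fin d → Fam P n}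
    (h : ∀ i a, SC μ A (F i a)) : ∃ C, 0 ≤ C ∧ ∀ i a p x, |F i a p x| ≤ C * A p := by
  refine unif (R := fun i C => ∀ a p x, |F i a p x| ≤ C * A p) ?_ fun i => ?_
  · exact fun i c c' hc h a p x => (h a p x).trans (mul_le_mul_of_nonneg_right hc (hA p))
  obtain ⟨C, _, hC⟩ := unif (R := fun a C => ∀ p x, |F i a p x| ≤ C * A p)
    (fun a c c' hc h p x => (h p x).trans (mul_le_mul_of_nonneg_right hc (hA p))) (fun a => by
      obtain ⟨C, _, hC⟩ := (h i a).bd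
      exact ⟨C, fun p x => by simpa [abs_of_nonneg (hA p)] using hC p x⟩)
  exact ⟨C, hC⟩

lemma Geo.reindex {P Q : Type} {n d : ℕ} {s μ : P → ℝ} {u : Fin d → Fam P n}
    {ν θ : Fin n → Fin d → Fam P n} (G : Geo s μ u ν θ) (ι : Q → P) :
    Geo (fun q => s (ι q)) (fun q => μ (ι q)) (fun b q => u b (ι q)) (fun k b q => ν k b (ι q))
      (fun k b q => θ k b (ι q)) where
  us a q := G.us a (ι q)
  u1 i a := (G.u1 i a).reindex ι
  u2 i j a := (G.u2 i j a).reindex ι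
  n1 i a := (G.n1 i a).reindex ι
  n2 i j a := (G.n2 i j a).reindex ι
  t1 i a := (G.t1 i a).reindex ι
  t2 i j a := (G.t2 i j a).reindex ι
  un q := G.un (ι q)
  nn q := G.nn (ι q)
  ut q := G.ut (ι q)

lemma Siz.reindex {P Q : Type} {s μ lam : P → ℝ} (Z : Siz s μ lam) (ι : Q → P) :
    Siz (fun q => s (ι q)) (fun q => μ (ι q)) (fun q => lam (ι q)) :=
  ⟨fun q => Z.s0 _, fun q => Z.m0 _, fun q => Z.ml _, fun q => Z.sl _⟩

section step
variable {P : Type} {n d : ℕ} {s μ lam : P → ℝ} {u : Fin d → Fam P n}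
  {ν θ : Fin n → Fin d → Fam P n} {ξ : Fin n → Fin n → ℝ} {a w : Fin n → Fam P n}

lemma SC_VV (G : Geo s μ u ν θ) (Z : Siz s μ lam)
    (ha : ∀ k, SC μ s (a k)) (hw : ∀ l, SC lam (fun p => s p ^ 2 / lam p) (w l)) (b : Fin d) :
    SC lam (fun p => s p / lam p) (VV lam ξ ν θ a w b) := by
  have hμ : ∀ p, 0 ≤ μ p := fun p => (Z.m0 p).le
  have l0 : ∀ p, 0 ≤ lam p := fun p => (Z.l0 p).le
  let W : OCl P n μ lam Set.univ := OCl.ofSC hμ Z.ml _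
  have hG : ∀ k, SC lam (fun p => 1 / lam p) (Gam lam (ξ k)) := fun k =>
    W.toSC (fun p => div_nonneg zero_le_one (l0 p)) (O_Gam W Z (Set.mem_univ _))
  refine SC.add (SC.sum _ fun k _ => ?_) (SC.sum _ fun l _ => ?_)
  · refine ((((ha k).weaken (B := s) 1 Z.s0 (by simp) hμ Z.ml Z.s0).mul (hG k)).mul
      ((G.n1 k b).weaken (B := fun _ => 1) 1 (by simp) (by simp) hμ Z.ml (by simp))).congrA fun p => by ring
  · refine SC.weaken (A := fun p => s p ^ 2 / lam p * 1) 1 ((hw l).mul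
      ((G.t1 l b).weaken (B := fun _ => 1) 1 (by simp) (by simp) hμ Z.ml (by simp)))
      (fun p => mul_nonneg (div_nonneg (sq_nonneg _) (l0 p)) zero_le_one) (fun p => ?_) l0 (fun _ => le_rfl)
      (fun p => div_nonneg (Z.s0 p) (l0 p))
    have : s p ^ 2 ≤ s p := by nlinarith [Z.s0 p, Z.s1 p]
    rw [mul_one, one_mul]
    exact div_le_div_of_nonneg_right this (l0 p)

/-- New frames after a step. -/
lemma step_geo (G : Geo s μ u ν θ) (Z : Siz s μ lam)
    (ha : ∀ k, SC μ s (a k)) (hw : ∀ l, SC lam (fun p => s p ^ 2 / lam p) (w l)) :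
    ∃ t0 > 0, ∀ {Q : Type} (ι : Q → P), (∀ q, s (ι q) ≤ t0) → ∃ ν' θ' : Fin n → Fin d → Fam Q n,
      Geo (fun q => s (ι q)) (fun q => lam (ι q))
        (fun b q x => u b (ι q) x + VV lam ξ ν θ a w b (ι q) x) ν' θ' ∧
      ∃ C : ℝ, 0 ≤ C ∧ ∀ k b q x, |θ' k b q x - θ k b (ι q) x| ≤ C * s (ι q) := by
  have hμ : ∀ p, 0 ≤ μ p := fun p => (Z.m0 p).le
  have l0 : ∀ p, 0 ≤ lam p := fun p => (Z.l0 p).le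
  have l1 : ∀ p, lam p ≠ 0 := fun p => (Z.l0 p).ne'
  set V := VV lam ξ ν θ a w with hV
  have hVs : ∀ b, SC lam (fun p => s p / lam p) (V b) := SC_VV G Z ha hw
  have hV1 : ∀ i b, SC lam s (fun p => pder i (V b p)) := fun i b =>
    ((hVs b).pd i).congrA fun p => div_mul_cancel₀ _ (l1 p)
  have hV2 : ∀ i j b, SC lam (fun p => s p * lam p) (fun p => pder j (pder i (V b p))) := fun i j b =>
    ((hV1 i b).pd j)
  have w1 : ∀ {f : Fam P n}, SC μ (fun _ => 1) f → SC lam (fun _ => 1) f := fun h =>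
    h.weaken 1 (by simp) (by simp) hμ Z.ml (by simp)
  have w2 : ∀ {f : Fam P n}, SC μ (fun p => s p * μ p) f → SC lam (fun p => s p * lam p) f := fun h =>
    h.weaken 1 (fun p => mul_nonneg (Z.s0 p) (hμ p)) (fun p => by
      rw [one_mul]; exact mul_le_mul_of_nonneg_left (Z.ml p) (Z.s0 p)) hμ Z.ml
      (fun p => mul_nonneg (Z.s0 p) (l0 p))
  have hV1' : ∀ i b, SC lam (fun _ => 1) (fun p => pder i (V b p)) := fun i b =>
    (hV1 i b).weaken 1 Z.s0 (fun p => by simpa using Z.s1 p) l0 (fun _ => le_rfl) (by simp)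
  have su : ∀ b p, Smo (u b p) := G.us
  have sV : ∀ b p, Smo (V b p) := fun b => (hVs b).1
  set A : Fin n → Fin d → Fam P n := fun i b p x => pder i (u b p) x + pder i (V b p) x with hA
  have cA : ∀ i b, CO s lam (A i b) := fun i b => ⟨(w1 (G.u1 i b)).add (hV1' i b), fun j =>
    ((w2 (G.u2 i j b)).add (hV2 i j b)).congr fun p x => by
      rw [pder_add ((su b p).pder i) ((sV b p).pder i)]⟩
  have cN : ∀ k b, CO s lam (ν k b) := fun k b => ⟨w1 (G.n1 k b), fun j => w2 (G.n2 j k b)⟩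
  have cT : ∀ k b, CO s lam (θ k b) := fun k b => ⟨w1 (G.t1 k b), fun j => w2 (G.t2 j k b)⟩
  obtain ⟨C1, hC1, b1⟩ := SC.bd2 (by simp) fun i b => (cA i b).1
  obtain ⟨C2, hC2, b2⟩ := SC.bd2 (by simp) fun i b => (cN i b).1
  obtain ⟨C3, hC3, b3⟩ := SC.bd2 (by simp) fun i b => (cT i b).1
  obtain ⟨C4, hC4, b4⟩ := SC.bd2 Z.s0 hV1
  set C := C1 + C2 + C3 with hC
  have C0 : 0 ≤ C := by positivity
  obtain ⟨t0, ht0, C', hC', hF⟩ := frame n d C C0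
  set K := d * (C4 * C) with hK
  have K0 : 0 ≤ K := by positivity
  refine ⟨t0 / (K + 1), by positivity, fun {Q} ι hι => ?_⟩
  have hs : ∀ q, K * s (ι q) ≤ t0 := fun q => by
    have h := hι q
    rw [le_div_iff₀ (by positivity)] at h
    nlinarith [Z.s0 (ι q)]
  have key : ∀ {B : Fin d → ℝ} (i : Fin n) (q : Q) x, (∀ b, |B b| ≤ C) →
      |∑ b, pder i (V b (ι q)) x * B b| ≤ K * s (ι q) := by
    intro B i q x hB
    refine (abs_sum_le' fun b => abs_mul_le' (b4 i b (ι q) x) (hB b)).trans (le_of_eq ?_)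
    rw [hK]; ring
  obtain ⟨ν', θ', h1, h2, h3, h4, h5, h6, h7⟩ := hF (P := Q) (s := fun q => s (ι q)) (μ := fun q => lam (ι q))
    (t := fun q => K * s (ι q)) (A := fun i b q => A i b (ι q)) (N := fun i b q => ν i b (ι q))
    (T := fun i b q => θ i b (ι q))
    (fun i b => (cA i b).reindex ι) (fun i b => (cN i b).reindex ι) (fun i b => (cT i b).reindex ι)
    (fun i b q x => (b1 i b _ x).trans (by simp only [hC]; linarith))
    (fun i b q x => (b2 i b _ x).trans (by simp only [hC]; linarith))
    (fun i b q x => (b3 i b _ x).trans (by simp only [hC]; linarith)) hs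
    (fun q x i l => by
      simp only [hA, add_mul, Finset.sum_add_distrib]
      rw [G.ut]
      simp only [add_sub_cancel_left]
      exact key i q x fun b => (b3 l b _ x).trans (by simp only [hC]; linarith))
    (fun q x i l => by
      simp only [hA, add_mul, Finset.sum_add_distrib]
      rw [G.un, zero_add]
      exact key i q x fun b => (b2 l b _ x).trans (by simp only [hC]; linarith))
    (fun q x k l => by
      rw [G.nn, sub_self, abs_zero]; exact mul_nonneg K0 (Z.s0 _))
  have hp : ∀ i b q, pder i (fun x => u b (ι q) x + V b (ι q) x) = A i b (ι q) := fun i b q => by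
    rw [pder_add (su _ _) (sV _ _)]
  refine ⟨ν', θ', ⟨?_, ?_, ?_, fun k a => (h1 k a).1, fun j k a => (h1 k a).2 j, fun k a => (h2 k a).1,
    fun j k a => (h2 k a).2 j, ?_, h4, ?_⟩, C' * K, by positivity, fun k b q x => ?_⟩
  · exact fun b q => (su b _).add (sV b _)
  · exact fun i b => by simpa only [hp] using (cA i b).1.reindex ι
  · exact fun i j b => by simpa only [hp] using ((cA i b).2 j).reindex ι
  · intro q x i k; simp only [hp]; exact h3 q x i k
  · intro q x i k; simp only [hp]; exact h5 q x i k
  · rw [mul_assoc]; exact h7 k b q x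

end step
end CI

namespace CI
open scoped ContDiff

/-- Closeness of two immersions with tangential frames. -/
def Near {Q : Type} {n d : ℕ} (s δ : Q → ℝ) (u u' : Fin d → Fam Q n) (θ θ' : Fin n → Fin d → Fam Q n) : Prop :=
  ∃ C : ℝ, 0 ≤ C ∧ (∀ b q x, |u' b q x - u b q x| ≤ C * δ q) ∧
    (∀ i b q x, |pder i (u' b q) x - pder i (u b q) x| ≤ C * s q) ∧
    (∀ i b q x, |θ' i b q x - θ i b q x| ≤ C * s q)

lemma abs_tri {a b c x y : ℝ} (h : |a - b| ≤ x) (h' : |c - a| ≤ y) : |c - b| ≤ x + y := by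
  have := abs_add_le (c - a) (a - b)
  rw [sub_add_sub_cancel] at this; linarith

lemma Near.trans {Q : Type} {n d : ℕ} {s δ : Q → ℝ} {u u' u'' : Fin d → Fam Q n}
    {θ θ' θ'' : Fin n → Fin d → Fam Q n} (h : Near s δ u u' θ θ') (h' : Near s δ u' u'' θ' θ'') :
    Near s δ u u'' θ θ'' := by
  obtain ⟨C, hC, h1, h2, h3⟩ := h
  obtain ⟨C', hC', h1', h2', h3'⟩ := h'
  refine ⟨C + C', by positivity, fun b q x => ?_, fun i b q x => ?_, fun i b q x => ?_⟩ <;> rw [add_mul]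
  · exact abs_tri (h1 b q x) (h1' b q x)
  · exact abs_tri (h2 i b q x) (h2' i b q x)
  · exact abs_tri (h3 i b q x) (h3' i b q x)

lemma Near.reindex {P Q : Type} {n d : ℕ} {s δ : P → ℝ} {u u' : Fin d → Fam P n}
    {θ θ' : Fin n → Fin d → Fam P n} (h : Near s δ u u' θ θ') (ι : Q → P) :
    Near (fun q => s (ι q)) (fun q => δ (ι q)) (fun b q => u b (ι q)) (fun b q => u' b (ι q))
      (fun k b q => θ k b (ι q)) (fun k b q => θ' k b (ι q)) := by
  obtain ⟨C, hC, h1, h2, h3⟩ := h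
  exact ⟨C, hC, fun b q => h1 b _, fun i b q => h2 i b _, fun i b q => h3 i b _⟩

section step
variable {P : Type} {n d : ℕ} {s μ lam : P → ℝ} {u : Fin d → Fam P n}
  {ν θ : Fin n → Fin d → Fam P n} {ξ : Fin n → Fin n → ℝ} {a w : Fin n → Fam P n}

lemma step_near (G : Geo s μ u ν θ) (Z : Siz s μ lam)
    (ha : ∀ k, SC μ s (a k)) (hw : ∀ l, SC lam (fun p => s p ^ 2 / lam p) (w l))
    {δ : P → ℝ} (hδ : ∀ p, s p / lam p ≤ δ p) {Q : Type} (ι : Q → P) {θ' : Fin n → Fin d → Fam Q n}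
    (h : ∃ C : ℝ, 0 ≤ C ∧ ∀ k b q x, |θ' k b q x - θ k b (ι q) x| ≤ C * s (ι q)) :
    Near (fun q => s (ι q)) (fun q => δ (ι q)) (fun b q => u b (ι q))
      (fun b q x => u b (ι q) x + VV lam ξ ν θ a w b (ι q) x) (fun k b q => θ k b (ι q)) θ' := by
  obtain ⟨C, hC, h⟩ := h
  have hVs : ∀ b, SC lam (fun p => s p / lam p) (VV lam ξ ν θ a w b) := SC_VV G Z ha hw
  have hV1 : ∀ i b, SC lam s (fun p => pder i (VV lam ξ ν θ a w b p)) := fun i b =>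
    ((hVs b).pd i).congrA fun p => div_mul_cancel₀ _ (Z.l0 p).ne'
  have d0 : ∀ p, 0 ≤ s p / lam p := fun p => div_nonneg (Z.s0 p) (Z.l0 p).le
  obtain ⟨C1, hC1, b1⟩ := SC.bd2 (m := 1) d0 (fun _ b => hVs b)
  obtain ⟨C2, hC2, b2⟩ := SC.bd2 Z.s0 hV1
  refine ⟨C + C1 + C2, by positivity, fun b q x => ?_, fun i b q x => ?_, fun k b q x => (h k b q x).trans ?_⟩
  · rw [add_sub_cancel_left]
    refine (b1 0 b (ι q) x).trans ((mul_le_mul_of_nonneg_left (hδ _) hC1).trans ?_)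
    exact mul_le_mul_of_nonneg_right (by linarith) ((d0 _).trans (hδ _))
  · rw [pder_add (G.us _ _) ((hVs _).1 _), add_sub_cancel_left]
    refine (b2 i b (ι q) x).trans (mul_le_mul_of_nonneg_right (by linarith) (Z.s0 _))
  · exact mul_le_mul_of_nonneg_right (by linarith) (Z.s0 _)

/-- iterating the costly step -/
lemma costly_chain {s : P → ℝ} (Λ : ℕ → P → ℝ) (G : Geo s (Λ 0) u ν θ) (Z : ∀ m, Siz s (Λ m) (Λ (m+1)))
    (ξ : ℕ → Fin n → Fin n → ℝ) {β : ℕ → Fin n → Fam P n} (hβ : ∀ r k, SC (Λ 0) s (β r k))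
    {δ : P → ℝ} (hδ : ∀ m p, Λ m p / Λ (m+1) p ≤ δ p) (N : ℕ) :
    ∃ t0 > 0, ∀ {Q : Type} (ι : Q → P), (∀ q, s (ι q) ≤ t0) → ∃ (u' : Fin d → Fam Q n)
      (ν' θ' : Fin n → Fin d → Fam Q n),
      Geo (fun q => s (ι q)) (fun q => Λ N (ι q)) u' ν' θ' ∧
      Near (fun q => s (ι q)) (fun q => s (ι q) / Λ 0 (ι q)) (fun b q => u b (ι q)) u'
        (fun k b q => θ k b (ι q)) θ' ∧
      ∃ C : ℝ, 0 ≤ C ∧ ∀ i j q x, |Hm u' i j q x - Hm u i j (ι q) x -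
        ∑ r ∈ Finset.range N, ∑ k, β r k (ι q) x ^ 2 * (ξ r k i * ξ r k j)| ≤ C * (s (ι q) ^ 2 * δ (ι q)) := by
  have hΛ : ∀ m p, Λ 0 p ≤ Λ m p := by
    intro m p
    induction m with
    | zero => exact le_rfl
    | succ m ih => exact ih.trans ((Z m).ml p)
  induction N with
  | zero =>
    refine ⟨1, one_pos, fun {Q} ι _ => ⟨_, _, _, G.reindex ι, ⟨0, le_rfl, by simp, by simp, by simp⟩, 0, le_rfl, ?_⟩⟩
    intro i j q x
    simp [Hm]
  | succ N ih =>
    obtain ⟨t1, ht1, H⟩ := ih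
    let P1 := {p : P // s p ≤ t1}
    obtain ⟨u1, ν1, θ1, G1, N1, C1, hC1, E1⟩ := H (fun p : P1 => p.1) (fun p => p.2)
    have Z1 := (Z N).reindex (fun p : P1 => p.1)
    have hβ1 : ∀ k, SC (fun p : P1 => Λ N p.1) (fun p : P1 => s p.1) (fun p => β N k p.1) := fun k =>
      ((hβ N k).weaken (ν := Λ N) (B := s) 1 (Z 0).s0 (by simp) (fun p => ((Z 0).m0 p).le) (hΛ N) (Z 0).s0).reindex _
    obtain ⟨w, hw, hE⟩ := costly_step G1 Z1 (ξ N) hβ1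
    obtain ⟨t2, ht2, H2⟩ := step_geo (ξ := ξ N) G1 Z1 hβ1 hw
    refine ⟨min t1 t2, by positivity, fun {Q} ι hι => ?_⟩
    let ι1 : Q → P1 := fun q => ⟨ι q, (hι q).trans (min_le_left _ _)⟩
    obtain ⟨ν', θ', G', hθ⟩ := H2 ι1 (fun q => (hι q).trans (min_le_right _ _))
    have e0 : ∀ p : P1, 0 ≤ s p.1 ^ 2 * (Λ N p.1 / Λ (N+1) p.1) := fun p =>
      mul_nonneg (sq_nonneg _) (Z1.e0 p).le
    obtain ⟨C2, hC2, E2⟩ := SC.bd2 e0 hE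
    refine ⟨_, ν', θ', G', (N1.reindex ι1).trans (step_near G1 Z1 hβ1 hw (δ := fun p => s p.1 / Λ 0 p.1)
      (fun p => ?_) ι1 hθ), C1 + C2, by positivity, fun i j q x => ?_⟩
    · exact div_le_div_of_nonneg_left ((Z 0).s0 _) ((Z 0).m0 _) (hΛ (N+1) _)
    · have h1 := E1 i j (ι1 q) x
      have h2 := E2 i j (ι1 q) x
      have h3 := Hm_add (fun b p => G1.us b p) (fun b p => smo_VV (lam := fun p : P1 => Λ (N+1) p.1) (ξ := ξ N)
        G1 (fun k => (hβ1 k).1) (fun k => (hw k).1) b p) i j (ι1 q) x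
      have h4 : C2 * (s (ι q) ^ 2 * (Λ N (ι q) / Λ (N+1) (ι q))) ≤ C2 * (s (ι q) ^ 2 * δ (ι q)) :=
        mul_le_mul_of_nonneg_left (mul_le_mul_of_nonneg_left (hδ _ _) (sq_nonneg _)) hC2
      rw [Finset.sum_range_succ, add_mul]
      have h5 := (abs_add_le _ _).trans (add_le_add h1 (h2.trans h4))
      refine le_trans (le_of_eq ?_) h5
      change |Hm (fun b p x => u1 b p x + VV (fun p : P1 => Λ (N+1) p.1) (ξ N) ν1 θ1 (fun k p => β N k p.1) w b p x) i j (ι1 q) x - _ - _| = _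
      rw [h3]
      congr 1
      simp only [ι1]
      ring

end step
end CI

namespace CI
open scoped ContDiff

/-- The algebraic decomposition data. -/
structure Dec (n N : ℕ) where
  q : Fin n → ℝ
  hq : ∀ m : Fin n → ℤ, m ≠ 0 → ∑ i, (m i : ℝ) * q i ≠ 0
  ξ : Fin N → Fin n → Fin n → ℝ
  L : Fin N → Fin n → Fin n → Fin n → ℝ
  H0 : Fin n → Fin n → ℝ
  dec : ∀ Z : Fin n → Fin n → ℝ, (∀ i j, Z i j = Z j i) → ∀ i j, Z i j =
        (if i = j then (∑ l, Z i l * q l) / q i else 0) +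
          ∑ r, ∑ k, (∑ a, ∑ b, L r k a b * Z a b) * (ξ r k i * ξ r k j)
  hH : ∀ i j, H0 i j = (if i = j then 1 else 0) + ∑ r, ∑ k, ξ r k i * ξ r k j
  Hq : ∀ i, ∑ l, H0 i l * q l = q i
  LH : ∀ r k, ∑ a, ∑ b, L r k a b * H0 a b = 1
  Ld : ∀ r k a, L r k a a = 0

lemma Dec.nonempty (n N : ℕ) (hn : 2 ≤ n) (hN : n * (n - 1) ≤ 2 * (N * n)) : Nonempty (Dec n N) := by
  obtain ⟨q, hq, ξ, L, H0, h1, h2, h3, h4, h5⟩ := exists_decomp n N hn hN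
  exact ⟨⟨q, hq, ξ, L, H0, h1, h2, h3, h4, h5⟩⟩

lemma Dec.q0 {n N : ℕ} (Y : Dec n N) (i : Fin n) : Y.q i ≠ 0 := by
  have := Y.hq (Pi.single i 1) (by intro h; simpa using congrFun h i)
  simpa [Pi.single_apply] using this

lemma Dec.sig {n N : ℕ} (Y : Dec n N) : ∃ σ > 0, ∀ (Z : Fin n → Fin n → ℝ) (t : ℝ), 0 ≤ t →
    (∀ i j, |Z i j - t * Y.H0 i j| ≤ σ * t) →
    (∀ i, t / 2 ≤ (∑ l, Z i l * Y.q l) / Y.q i ∧ (∑ l, Z i l * Y.q l) / Y.q i ≤ 2 * t) ∧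
    (∀ r k, t / 2 ≤ (∑ a, ∑ b, Y.L r k a b * Z a b) ∧ (∑ a, ∑ b, Y.L r k a b * Z a b) ≤ 2 * t) := by
  have q0 := Y.q0
  set K1 : ℝ := ∑ i, ∑ l, |Y.q l / Y.q i| with hK1
  set K2 : ℝ := ∑ r, ∑ k, ∑ a, ∑ b, |Y.L r k a b| with hK2
  have k1 : 0 ≤ K1 := Finset.sum_nonneg fun _ _ => Finset.sum_nonneg fun _ _ => abs_nonneg _
  have k2 : 0 ≤ K2 := Finset.sum_nonneg fun _ _ => Finset.sum_nonneg fun _ _ =>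
    Finset.sum_nonneg fun _ _ => Finset.sum_nonneg fun _ _ => abs_nonneg _
  refine ⟨1 / (2 * (1 + K1 + K2)), by positivity, fun Z t ht hZ => ?_⟩
  set σ : ℝ := 1 / (2 * (1 + K1 + K2)) with hσ
  have hs : 0 ≤ σ * t := by positivity
  have hb : (1 + K1 + K2) * (σ * t) = t / 2 := by rw [hσ]; field_simp
  refine ⟨fun i => ?_, fun r k => ?_⟩
  · have e : (∑ l, Z i l * Y.q l) / Y.q i - t = ∑ l, Y.q l / Y.q i * (Z i l - t * Y.H0 i l) := by
      have h1 : ∑ l, Y.q l / Y.q i * (Z i l - t * Y.H0 i l) =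
        (∑ l, Z i l * Y.q l) / Y.q i - t * (∑ l, Y.H0 i l * Y.q l) / Y.q i := by
        simp only [Finset.mul_sum, Finset.sum_div, ← Finset.sum_sub_distrib]
        exact Finset.sum_congr rfl fun l _ => by ring
      rw [h1, Y.Hq, mul_div_assoc, div_self (q0 i), mul_one]
    have h2 : |∑ l, Y.q l / Y.q i * (Z i l - t * Y.H0 i l)| ≤ K1 * (σ * t) := by
      refine (Finset.abs_sum_le_sum_abs _ _).trans ?_
      have : ∑ l, |Y.q l / Y.q i| ≤ K1 :=
        Finset.single_le_sum (f := fun i => ∑ l, |Y.q l / Y.q i|)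
          (fun _ _ => Finset.sum_nonneg fun _ _ => abs_nonneg _) (Finset.mem_univ i)
      refine le_trans ?_ (mul_le_mul_of_nonneg_right this hs)
      rw [Finset.sum_mul]
      exact Finset.sum_le_sum fun l _ => by
        rw [abs_mul]; exact mul_le_mul_of_nonneg_left (hZ i l) (abs_nonneg _)
    rw [← e, abs_le] at h2
    constructor <;> nlinarith
  · have e : (∑ a, ∑ b, Y.L r k a b * Z a b) - t = ∑ a, ∑ b, Y.L r k a b * (Z a b - t * Y.H0 a b) := by
      have h1 : ∑ a, ∑ b, Y.L r k a b * (Z a b - t * Y.H0 a b) =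
        (∑ a, ∑ b, Y.L r k a b * Z a b) - t * ∑ a, ∑ b, Y.L r k a b * Y.H0 a b := by
        simp only [Finset.mul_sum, ← Finset.sum_sub_distrib]
        exact Finset.sum_congr rfl fun l _ => Finset.sum_congr rfl fun l _ => by ring
      rw [h1, Y.LH, mul_one]
    have h2 : |∑ a, ∑ b, Y.L r k a b * (Z a b - t * Y.H0 a b)| ≤ K2 * (σ * t) := by
      refine (Finset.abs_sum_le_sum_abs _ _).trans ?_
      have h3 : ∑ a, ∑ b, |Y.L r k a b| ≤ ∑ k, ∑ a, ∑ b, |Y.L r k a b| :=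
        Finset.single_le_sum (f := fun k => ∑ a, ∑ b, |Y.L r k a b|)
          (fun _ _ => Finset.sum_nonneg fun _ _ => Finset.sum_nonneg fun _ _ => abs_nonneg _) (Finset.mem_univ k)
      have h4 : ∑ k, ∑ a, ∑ b, |Y.L r k a b| ≤ K2 :=
        Finset.single_le_sum (f := fun r => ∑ k, ∑ a, ∑ b, |Y.L r k a b|)
          (fun _ _ => Finset.sum_nonneg fun _ _ => Finset.sum_nonneg fun _ _ => Finset.sum_nonneg fun _ _ => abs_nonneg _)
          (Finset.mem_univ r)
      refine le_trans ?_ (mul_le_mul_of_nonneg_right (h3.trans h4) hs)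
      rw [Finset.sum_mul]
      refine Finset.sum_le_sum fun a _ => ?_
      refine (Finset.abs_sum_le_sum_abs _ _).trans ?_
      rw [Finset.sum_mul]
      exact Finset.sum_le_sum fun l _ => by
        rw [abs_mul]; exact mul_le_mul_of_nonneg_left (hZ a l) (abs_nonneg _)
    rw [← e, abs_le] at h2
    constructor <;> nlinarith

lemma SC.isqrt {P : Type} {n : ℕ} {s μ : P → ℝ} (hs : ∀ p, 0 < s p) {f : Fam P n} (hf : SC μ (fun p => s p ^ 2) f)
    {a b : ℝ} (ha : 0 < a) (h1 : ∀ p x, a * s p ^ 2 ≤ f p x) (h2 : ∀ p x, f p x ≤ b * s p ^ 2) :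
    SC μ (fun p => 1 / s p) (fun p x => (√(f p x))⁻¹) := by
  have hg : SC μ (fun _ => 1) (fun p x => (s p ^ 2)⁻¹ * f p x) :=
    (hf.scale (fun p => (s p ^ 2)⁻¹) (fun p => by positivity)).congrA fun p => by
      have := (hs p).ne'; field_simp
  have h3 := SC.comp1 (F := fun t => (√t)⁻¹) (a := a) (b := b) (fun t ht => by
    have h0 : 0 < t := by linarith [ht.1]
    exact (Real.contDiffAt_sqrt h0.ne').inv (Real.sqrt_pos.2 h0).ne') hg (fun p x => by
      have := hs p
      have h5 : (0:ℝ) < s p ^ 2 := by positivity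
      constructor
      · rw [← div_eq_inv_mul, le_div_iff₀ h5]; exact h1 p x
      · rw [← div_eq_inv_mul, div_le_iff₀ h5]; exact h2 p x)
  refine ((h3.scale (fun p => 1 / s p) (fun p => by have := hs p; positivity)).congrA fun p => mul_one _).congr fun p x => ?_
  rw [Real.sqrt_mul (by positivity), Real.sqrt_inv, Real.sqrt_sq (hs p).le]
  have := (hs p).ne'
  rw [mul_inv, inv_inv]
  field_simp

section free
variable {P : Type} {n d N : ℕ} {s μ lam : P → ℝ} {u : Fin d → Fam P n}
  {ν θ : Fin n → Fin d → Fam P n}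

lemma XX_symm {V : Fin d → Fam P n} (i j : Fin n) (p : P) (x : Fin n → ℝ) :
    XX u V i j p x = XX u V j i p x :=
  Finset.sum_congr rfl fun b _ => by ring

/-- The free step with its residual decomposed. -/
lemma free_part (Y : Dec n N) {σ : ℝ} (hY : ∀ (Z : Fin n → Fin n → ℝ) (t : ℝ), 0 ≤ t →
    (∀ i j, |Z i j - t * Y.H0 i j| ≤ σ * t) →
    (∀ i, t / 2 ≤ (∑ l, Z i l * Y.q l) / Y.q i ∧ (∑ l, Z i l * Y.q l) / Y.q i ≤ 2 * t) ∧
    (∀ r k, t / 2 ≤ (∑ a, ∑ b, Y.L r k a b * Z a b) ∧ (∑ a, ∑ b, Y.L r k a b * Z a b) ≤ 2 * t))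
    (G : Geo s μ u ν θ) (Z : Siz s μ lam) (sp : ∀ p, 0 < s p) {D : Fin n → Fin n → Fam P n}
    (hD : ∀ i j, SC μ (fun p => s p ^ 2) (D i j)) (Ds : ∀ i j p x, D i j p x = D j i p x)
    (Dσ : ∀ i j p x, |D i j p x - s p ^ 2 * Y.H0 i j| ≤ σ * s p ^ 2) (J : ℕ) (hJ : 1 ≤ J) :
    ∃ t0 > 0, ∀ {Q : Type} (ι : Q → P), (∀ q, s (ι q) ≤ t0) → (∀ q, μ (ι q) / lam (ι q) ≤ t0) →
      ∃ (u' : Fin d → Fam Q n) (ν' θ' : Fin n → Fin d → Fam Q n),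
      Geo (fun q => s (ι q)) (fun q => lam (ι q)) u' ν' θ' ∧
      Near (fun q => s (ι q)) (fun q => s (ι q) / lam (ι q)) (fun b q => u b (ι q)) u'
        (fun k b q => θ k b (ι q)) θ' ∧
      ∃ β : Fin N → Fin n → Fam Q n, (∀ r k, SC (fun q => lam (ι q)) (fun q => s (ι q)) (β r k)) ∧
      ∃ C : ℝ, 0 ≤ C ∧ ∀ i j q x, |Hm u' i j q x + (∑ r, ∑ k, β r k q x ^ 2 * (Y.ξ r k i * Y.ξ r k j))
        - Hm u i j (ι q) x - D i j (ι q) x| ≤ C * (s (ι q) ^ 2 * (μ (ι q) / lam (ι q)) ^ J) := by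
  have hμ : ∀ p, 0 ≤ μ p := fun p => (Z.m0 p).le
  have l0 : ∀ p, 0 ≤ lam p := fun p => (Z.l0 p).le
  have q0 := Y.q0
  have hDY := fun p x => hY (fun i j => D i j p x) (s p ^ 2) (sq_nonneg _) (fun i j => Dσ i j p x)
  set c : Fin n → Fam P n := fun i p x => (∑ l, D i l p x * Y.q l) / Y.q i with hc
  have cs : ∀ i, SC μ (fun p => s p ^ 2) (c i) := fun i =>
    ((SC.sum Finset.univ (F := fun l p x => Y.q l * D i l p x) fun l _ => (hD i l).const_mul _).const_mul (1 / Y.q i)).congr fun p x => by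
      simp only [hc, Finset.mul_sum, Finset.sum_div]
      exact Finset.sum_congr rfl fun l _ => by ring
  have c1 : ∀ i p x, (1/2) * s p ^ 2 ≤ c i p x := fun i p x => by linarith [((hDY p x).1 i).1]
  have c2 : ∀ i p x, c i p x ≤ 2 * s p ^ 2 := fun i p x => ((hDY p x).1 i).2
  have cp : ∀ i p x, 0 < c i p x := fun i p x => lt_of_lt_of_le (by have := sp p; positivity) (c1 i p x)
  obtain ⟨a, w, F⟩ := free_step (D := D) Y.hq q0 G Z sp (a0 := fun i p x => √(c i p x)) (b0 := fun i p x => (√(c i p x))⁻¹)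
    (fun i => (cs i).sqrt sp (by norm_num) (c1 i) (c2 i)) (fun i => (cs i).isqrt sp (by norm_num) (c1 i) (c2 i))
    (fun i p x => mul_inv_cancel₀ (Real.sqrt_pos.2 (cp i p x)).ne')
    (fun i p x => by rw [Real.sq_sqrt (cp i p x).le]; simp only [hc]; exact div_mul_cancel₀ _ (q0 i)) J hJ
  have hE : ∀ p, 0 ≤ s p ^ 2 * (μ p / lam p) := fun p => mul_nonneg (sq_nonneg _) (Z.e0 p).le
  have hEJ : ∀ p, 0 ≤ s p ^ 2 * (μ p / lam p) ^ J := fun p => mul_nonneg (sq_nonneg _) (pow_nonneg (Z.e0 p).le _)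
  have hw : ∀ l, SC lam (fun p => s p ^ 2 / lam p) (w l) := fun l =>
    (F.hw l).toSC hμ Z.ml (fun p => div_nonneg (sq_nonneg _) (l0 p))
  set X : Fin n → Fin n → Fam P n := fun i j => XX u (VV lam ek ν θ a w) i j with hX
  have hXo : ∀ i j, i ≠ j → SC lam (fun p => s p ^ 2 * (μ p / lam p)) (X i j) := fun i j h =>
    (F.ho i j h).toSC hμ Z.ml hE
  have hr : ∀ i, SC lam (fun p => s p ^ 2 * (μ p / lam p) ^ J) (fun p x => ∑ l, (D i l p x - X i l p x) * Y.q l) :=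
    fun i => (F.hr i).toSC hμ Z.ml hEJ
  -- coefficients
  set O : Fin N → Fin n → Fam P n := fun r k p x => ∑ i, ∑ j, Y.L r k i j * X i j p x with hO
  have Os : ∀ r k, SC lam (fun p => s p ^ 2 * (μ p / lam p)) (O r k) := fun r k =>
    SC.sum _ fun i _ => SC.sum _ fun j _ => by
      by_cases h : i = j
      · subst h
        simpa [Y.Ld] using SC.zero
      · exact (hXo i j h).const_mul _
  set b : Fin N → Fin n → Fam P n := fun r k p x => (∑ i, ∑ j, Y.L r k i j * D i j p x) - O r k p x with hb
  have bs : ∀ r k, SC lam (fun p => s p ^ 2) (b r k) := fun r k => by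
    refine SC.sub (SC.sum _ fun i _ => SC.sum _ fun j _ => ?_) ((Os r k).weaken 1 hE (fun p => ?_) l0 (fun _ => le_rfl)
      fun p => sq_nonneg _)
    · exact (((hD i j).const_mul _).weaken 1 (fun p => sq_nonneg _) (by simp) hμ Z.ml (fun p => sq_nonneg _))
    · rw [one_mul]; exact mul_le_of_le_one_right (sq_nonneg _) (Z.e1 p)
  obtain ⟨CO, hCO, bO⟩ := SC.bd2 hE Os
  obtain ⟨Cr, hCr, br⟩ := SC.bd2 (m := 1) hEJ fun _ i => hr i
  obtain ⟨t1, ht1, H⟩ := step_geo (ξ := ek) G Z F.ha hw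
  refine ⟨min t1 (1 / (4 * (CO + 1))), by positivity, fun {Q} ι h1 h2 => ?_⟩
  obtain ⟨ν', θ', G', hθ⟩ := H ι (fun q => (h1 q).trans (min_le_left _ _))
  have hOs : ∀ r k q x, |O r k (ι q) x| ≤ s (ι q) ^ 2 / 4 := by
    intro r k q x
    refine (bO r k (ι q) x).trans ?_
    have h3 := (h2 q).trans (min_le_right _ _)
    rw [le_div_iff₀ (by positivity)] at h3
    have h4 := (Z.e0 (ι q)).le
    have h5 : CO * (μ (ι q) / lam (ι q)) ≤ 1 / 4 := by nlinarith
    nlinarith [sq_nonneg (s (ι q))]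
  have b1 : ∀ r k q x, (1/4) * s (ι q) ^ 2 ≤ b r k (ι q) x := fun r k q x => by
    have h3 := ((hDY (ι q) x).2 r k).1
    have h4 := abs_le.1 (hOs r k q x)
    simp only [hb]; linarith [h4.2]
  have b2 : ∀ r k q x, b r k (ι q) x ≤ 3 * s (ι q) ^ 2 := fun r k q x => by
    have h3 := ((hDY (ι q) x).2 r k).2
    have h4 := abs_le.1 (hOs r k q x)
    simp only [hb]; nlinarith [h4.1, sq_nonneg (s (ι q))]
  refine ⟨_, ν', θ', G', step_near G Z F.ha hw (fun p => le_rfl) ι hθ, fun r k q x => √(b r k (ι q) x),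
    fun r k => ((bs r k).reindex ι).sqrt (s := fun q => s (ι q)) (fun q => sp _) (by norm_num) (b1 r k) (b2 r k),
    Cr * ∑ i, |(Y.q i)⁻¹|, by positivity, fun i j q x => ?_⟩
  have h3 := Hm_add G.us (fun b p => smo_VV (lam := lam) (ξ := ek) G (fun k => (F.ha k).1) (fun k => (hw k).1) b p)
    i j (ι q) x
  have h4 := Y.dec (fun i j => D i j (ι q) x - X i j (ι q) x) (fun i j => by rw [Ds, hX]; simp only; rw [XX_symm]) i j
  have h5 : ∀ r k, √(b r k (ι q) x) ^ 2 = ∑ i, ∑ j, Y.L r k i j * (D i j (ι q) x - X i j (ι q) x) := fun r k => by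
    rw [Real.sq_sqrt (by nlinarith [b1 r k q x, sq_nonneg (s (ι q))])]
    simp only [hb, hO, mul_sub, Finset.sum_sub_distrib]
  simp only [h5]
  change |Hm (fun b p x => u b p x + VV lam ek ν θ a w b p x) i j (ι q) x + _ - _ - _| ≤ _
  rw [h3]
  have e : ∀ h X D d S : ℝ, D - X = d + S → h + X + S - h - D = - d := by intros; linarith
  rw [e _ _ _ _ _ h4, abs_neg]
  have h6 : |∑ l, (D i l (ι q) x - X i l (ι q) x) * Y.q l| ≤ _ := br 0 i (ι q) x
  have h7 : |(Y.q i)⁻¹| ≤ ∑ i, |(Y.q i)⁻¹| :=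
    Finset.single_le_sum (f := fun i => |(Y.q i)⁻¹|) (fun _ _ => abs_nonneg _) (Finset.mem_univ i)
  have h8 : 0 ≤ Cr * (s (ι q) ^ 2 * (μ (ι q) / lam (ι q)) ^ J) := mul_nonneg hCr (hEJ _)
  split_ifs
  · rw [div_eq_mul_inv]
    refine (abs_mul_le' h6 h7).trans (le_of_eq (by ring))
  · rw [abs_zero]
    have : 0 ≤ ∑ i, |(Y.q i)⁻¹| := Finset.sum_nonneg fun _ _ => abs_nonneg _
    have h9 := mul_nonneg h8 this
    refine h9.trans (le_of_eq (by ring))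

/-- The complete perturbation stage. -/
theorem full_chain (Y : Dec n N) {σ : ℝ} (hY : ∀ (Z : Fin n → Fin n → ℝ) (t : ℝ), 0 ≤ t →
    (∀ i j, |Z i j - t * Y.H0 i j| ≤ σ * t) →
    (∀ i, t / 2 ≤ (∑ l, Z i l * Y.q l) / Y.q i ∧ (∑ l, Z i l * Y.q l) / Y.q i ≤ 2 * t) ∧
    (∀ r k, t / 2 ≤ (∑ a, ∑ b, Y.L r k a b * Z a b) ∧ (∑ a, ∑ b, Y.L r k a b * Z a b) ≤ 2 * t))
    (Λ : ℕ → P → ℝ)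
    (G : Geo s μ u ν θ) (Z0 : Siz s μ (Λ 0)) (Z : ∀ m, Siz s (Λ m) (Λ (m+1))) (sp : ∀ p, 0 < s p) {D : Fin n → Fin n → Fam P n}
    (hD : ∀ i j, SC μ (fun p => s p ^ 2) (D i j)) (Ds : ∀ i j p x, D i j p x = D j i p x)
    (Dσ : ∀ i j p x, |D i j p x - s p ^ 2 * Y.H0 i j| ≤ σ * s p ^ 2) (J : ℕ) (hJ : 1 ≤ J)
    {δ : P → ℝ} (hδ : ∀ m p, Λ m p / Λ (m+1) p ≤ δ p) (hδ0 : ∀ p, (μ p / Λ 0 p) ^ J ≤ δ p) :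
    ∃ t0 > 0, ∀ {Q : Type} (ι : Q → P), (∀ q, s (ι q) ≤ t0) → (∀ q, μ (ι q) / Λ 0 (ι q) ≤ t0) →
      ∃ (u' : Fin d → Fam Q n) (ν' θ' : Fin n → Fin d → Fam Q n),
      Geo (fun q => s (ι q)) (fun q => Λ N (ι q)) u' ν' θ' ∧
      Near (fun q => s (ι q)) (fun q => s (ι q) / Λ 0 (ι q)) (fun b q => u b (ι q)) u'
        (fun k b q => θ k b (ι q)) θ' ∧
      ∃ C : ℝ, 0 ≤ C ∧ ∀ i j q x, |Hm u' i j q x - Hm u i j (ι q) x - D i j (ι q) x| ≤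
        C * (s (ι q) ^ 2 * δ (ι q)) := by
  obtain ⟨t1, ht1, H1⟩ := free_part Y hY G Z0 sp hD Ds Dσ J hJ
  let P1 := {p : P // s p ≤ t1 ∧ μ p / Λ 0 p ≤ t1}
  obtain ⟨u1, ν1, θ1, G1, N1, β, hβ, C1, hC1, E1⟩ := H1 (fun p : P1 => p.1) (fun p => p.2.1) (fun p => p.2.2)
  obtain ⟨t2, ht2, H2⟩ := costly_chain (fun m (p : P1) => Λ m p.1) G1 (fun m => (Z m).reindex _)
    (fun r => if h : r < N then Y.ξ ⟨r, h⟩ else fun _ _ => 0)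
    (β := fun r => if h : r < N then β ⟨r, h⟩ else fun _ _ _ => 0) (fun r k => by
      split_ifs
      · exact hβ _ _
      · exact SC.zero) (δ := fun p => δ p.1) (fun m p => hδ m p.1) N
  refine ⟨min t1 t2, by positivity, fun {Q} ι h1 h2 => ?_⟩
  let ι1 : Q → P1 := fun q => ⟨ι q, (h1 q).trans (min_le_left _ _), (h2 q).trans (min_le_left _ _)⟩
  obtain ⟨u', ν', θ', G', N', C', hC', E'⟩ := H2 ι1 (fun q => (h1 q).trans (min_le_right _ _))
  refine ⟨u', ν', θ', G', (N1.reindex ι1).trans N', C1 + C', by positivity, fun i j q x => ?_⟩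
  have h3 := E1 i j (ι1 q) x
  have h4 := E' i j q x
  rw [Finset.sum_range] at h4
  simp only [Fin.is_lt, dif_pos, Fin.eta] at h4
  have h5 : C1 * (s (ι q) ^ 2 * (μ (ι q) / Λ 0 (ι q)) ^ J) ≤ C1 * (s (ι q) ^ 2 * δ (ι q)) :=
    mul_le_mul_of_nonneg_left (mul_le_mul_of_nonneg_left (hδ0 _) (sq_nonneg _)) hC1
  rw [add_mul]
  refine le_trans (le_of_eq ?_) ((abs_add_le _ _).trans (add_le_add (h3.trans h5) h4))
  congr 1
  simp only [ι1]
  ring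

end free
end CI

namespace CI
open scoped ContDiff

/-- Kernels supported in the unit ball. -/
structure Ker {n : ℕ} (ψ : (Fin n → ℝ) → ℝ) : Prop where
  smo : Smo ψ
  supp : ∀ t, 1 < ‖t‖ → ψ t = 0

/-- Rescaled kernel. -/
def kn {n : ℕ} (ψ : (Fin n → ℝ) → ℝ) (l : ℝ) : (Fin n → ℝ) → ℝ := fun t => (l ^ n)⁻¹ * ψ (l⁻¹ • t)

/-- Mollification. -/
def mol {n : ℕ} (ψ : (Fin n → ℝ) → ℝ) (l : ℝ) (f : (Fin n → ℝ) → ℝ) : (Fin n → ℝ) → ℝ :=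
  fun x => ∫ t, kn ψ l t * f (x - t)

section mol
variable {n : ℕ} {ψ f g : (Fin n → ℝ) → ℝ} {l : ℝ}

lemma Ker.pder (h : Ker ψ) (i : Fin n) : Ker (pder i ψ) := by
  refine ⟨h.smo.pder i, fun t ht => ?_⟩
  have : ψ =ᶠ[nhds t] fun _ => 0 := by
    filter_upwards [(isOpen_lt continuous_const continuous_norm).mem_nhds ht] with y hy using h.supp y hy
  simp only [_root_.pder]
  rw [this.fderiv_eq]; simp

lemma kn_smo (h : Ker ψ) (l : ℝ) : Smo (kn ψ l) :=
  contDiff_const.mul (h.smo.comp (contDiff_const_smul _))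

lemma kn_supp (h : Ker ψ) (hl : 0 < l) {t : Fin n → ℝ} (ht : l < ‖t‖) : kn ψ l t = 0 := by
  rw [kn, h.supp, mul_zero]
  rw [norm_smul, norm_inv, Real.norm_eq_abs, abs_of_pos hl, ← div_eq_inv_mul, one_lt_div hl]; exact ht

lemma kn_cs (h : Ker ψ) (hl : 0 < l) : HasCompactSupport (kn ψ l) :=
  HasCompactSupport.intro (isCompact_closedBall (0 : Fin n → ℝ) l) fun t ht => kn_supp h hl (by
    simpa using ht)

lemma pder_kn (h : Ker ψ) (i : Fin n) : pder i (kn ψ l) = fun x => l⁻¹ * kn (pder i ψ) l x := by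
  funext x
  have h2 : HasFDerivAt (fun t : Fin n → ℝ => l⁻¹ • t) (l⁻¹ • ContinuousLinearMap.id ℝ _) x :=
    (l⁻¹ • ContinuousLinearMap.id ℝ (Fin n → ℝ)).hasFDerivAt
  have h1 : HasFDerivAt (kn ψ l) ((l ^ n)⁻¹ • (fderiv ℝ ψ (l⁻¹ • x)).comp (l⁻¹ • ContinuousLinearMap.id ℝ _)) x :=
    (((h.smo.diffAt (l⁻¹ • x)).hasFDerivAt).comp x h2).const_mul _
  simp only [_root_.pder, kn]
  have h3 := h1.fderiv
  rw [h3]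
  simp; ring

lemma kn_int (h : Ker ψ) (hl : 0 < l) (hf : Continuous f) (x : Fin n → ℝ) :
    Integrable fun t => kn ψ l t * f (x - t) := by
  refine Continuous.integrable_of_hasCompactSupport ?_ ?_
  · have := (kn_smo h l).continuous
    fun_prop
  · exact (kn_cs h hl).mul_right

lemma mol_eq_conv : mol ψ l f = convolution (kn ψ l) f (ContinuousLinearMap.mul ℝ ℝ) volume := rfl

lemma mol_smo (h : Ker ψ) (hl : 0 < l) (hf : Continuous f) : Smo (mol ψ l f) := by
  rw [mol_eq_conv]
  exact (kn_cs h hl).contDiff_convolution_left _ (kn_smo h l) hf.locallyIntegrable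

lemma pder_mol (h : Ker ψ) (hl : 0 < l) (hf : Continuous f) (i : Fin n) :
    pder i (mol ψ l f) = fun x => l⁻¹ * mol (pder i ψ) l f x := by
  funext x
  have h1 := (kn_cs h hl).hasFDerivAt_convolution_left (ContinuousLinearMap.mul ℝ ℝ)
    ((kn_smo h l).of_le (by simp)) (hf.locallyIntegrable (μ := volume)) x
  rw [← mol_eq_conv] at h1
  simp only [_root_.pder]
  rw [h1.fderiv, convolution, ContinuousLinearMap.integral_apply]
  · simp only [mol, ← integral_const_mul]
    refine integral_congr_ae (Filter.Eventually.of_forall fun t => ?_)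
    have h2 := congrFun (pder_kn (l := l) h i) t
    simp only [_root_.pder] at h2
    simp [h2]; ring
  · refine Continuous.integrable_of_hasCompactSupport ?_ ?_
    · have h3 : Continuous (fderiv ℝ (kn ψ l)) := (kn_smo h l).continuous_fderiv (by simp)
      exact ((ContinuousLinearMap.precompL _ (ContinuousLinearMap.mul ℝ ℝ)).continuous.comp h3).clm_apply
        (hf.comp (continuous_const.sub continuous_id))
    · refine ((kn_cs h hl).fderiv ℝ).mono ?_
      intro t ht h0
      apply ht
      have h0' : fderiv ℝ (kn ψ l) t = 0 := h0
      simp [h0']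

lemma kn_L1 (hl : 0 < l) : ∫ t, |kn ψ l t| = ∫ t, |ψ t| := by
  simp only [kn, abs_mul]
  rw [integral_const_mul]
  have h1 := Measure.integral_comp_smul (volume : Measure (Fin n → ℝ)) (fun t => |ψ t|) l⁻¹
  rw [h1]
  simp only [Module.finrank_fintype_fun_eq_card, Fintype.card_fin]
  rw [inv_pow, inv_inv, smul_eq_mul, abs_inv, ← mul_assoc, inv_mul_cancel₀ (by positivity), one_mul]

lemma mol_bd (h : Ker ψ) (hl : 0 < l) {x : Fin n → ℝ} {A : ℝ}
    (hA : ∀ t, ‖t‖ ≤ l → |f (x - t)| ≤ A) : |mol ψ l f x| ≤ (∫ t, |ψ t|) * A := by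
  rw [← kn_L1 hl, ← integral_mul_const, ← Real.norm_eq_abs]
  have h1 := (kn_smo h l).continuous
  refine norm_integral_le_of_norm_le ?_ (Filter.Eventually.of_forall fun t => ?_)
  · refine Integrable.mul_const ?_ _
    exact (Continuous.integrable_of_hasCompactSupport (by fun_prop) (kn_cs h hl)).abs
  · by_cases ht : ‖t‖ ≤ l
    · rw [Real.norm_eq_abs, abs_mul]; exact mul_le_mul_of_nonneg_left (hA t ht) (abs_nonneg _)
    · rw [kn_supp h hl (not_le.1 ht)]; simp

lemma mol_add (h : Ker ψ) (hl : 0 < l) (hf : Continuous f) (hg : Continuous g) (x : Fin n → ℝ) :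
    mol ψ l (fun x => f x + g x) x = mol ψ l f x + mol ψ l g x := by
  simp only [mol, mul_add]
  exact integral_add (kn_int h hl hf x) (kn_int h hl hg x)

lemma mol_sum (h : Ker ψ) (hl : 0 < l) {ι : Type*} (S : Finset ι) {F : ι → (Fin n → ℝ) → ℝ}
    (hf : ∀ j, Continuous (F j)) (x : Fin n → ℝ) :
    mol ψ l (fun x => ∑ j ∈ S, F j x) x = ∑ j ∈ S, mol ψ l (F j) x := by
  simp only [mol, Finset.mul_sum]
  exact integral_finset_sum _ fun j _ => kn_int h hl (hf j) x

lemma mol_cmul (c : ℝ) (x : Fin n → ℝ) :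
    mol ψ l (fun x => c * f x) x = c * mol ψ l f x := by
  simp only [mol, ← integral_const_mul]
  exact integral_congr_ae (Filter.Eventually.of_forall fun t => by simp only; ring)

lemma mol_const (hψ : ∫ t, ψ t = 1) (hl : 0 < l) (c : ℝ) (x : Fin n → ℝ) : mol ψ l (fun _ => c) x = c := by
  simp only [mol]
  rw [integral_mul_const]
  simp only [kn]
  rw [integral_const_mul]
  have h1 := Measure.integral_comp_smul (volume : Measure (Fin n → ℝ)) ψ l⁻¹
  rw [h1, hψ]
  simp only [Module.finrank_fintype_fun_eq_card, Fintype.card_fin]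
  rw [inv_pow, inv_inv, smul_eq_mul, mul_one, abs_of_pos (by positivity), inv_mul_cancel₀ (by positivity), one_mul]

lemma exists_ker (n : ℕ) : ∃ ψ : (Fin n → ℝ) → ℝ, Ker ψ ∧ (∀ t, 0 ≤ ψ t) ∧ ∫ t, ψ t = 1 := by
  let B : ContDiffBump (0 : Fin n → ℝ) := ⟨1/2, 1, by norm_num, by norm_num⟩
  refine ⟨B.normed volume, ⟨B.contDiff_normed, fun t ht => ?_⟩, B.nonneg_normed, B.integral_normed⟩
  have := B.support_normed_eq (μ := volume)
  have h2 : t ∉ Function.support (B.normed volume) := by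
    rw [this]; simp [B]; exact ht.le
  simpa using h2

lemma lip_of_pder (hf : Differentiable ℝ f) {A : ℝ} (h : ∀ i x, |pder i f x| ≤ A) (x y : Fin n → ℝ) :
    |f x - f y| ≤ n * A * ‖x - y‖ := by
  have key : ∀ z, ‖fderiv ℝ f z‖ ≤ n * A := by
    intro z
    by_cases hn : n = 0
    · subst hn
      have : fderiv ℝ f z = 0 := by ext v; rw [Subsingleton.elim v 0, map_zero, map_zero]
      simp [this]
    have hA : 0 ≤ A := (abs_nonneg _).trans (h ⟨0, Nat.pos_of_ne_zero hn⟩ z)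
    refine ContinuousLinearMap.opNorm_le_bound _ (by positivity) fun v => ?_
    have e : fderiv ℝ f z v = ∑ i, v i * pder i f z := by
      conv_lhs => rw [pi_eq_sum_univ' v]
      simp [_root_.pder, map_sum]
    rw [e, Real.norm_eq_abs]
    refine (abs_sum_le' fun i => abs_mul_le' (norm_le_pi_norm v i) (h i z)).trans (le_of_eq (by ring))
  have := Convex.norm_image_sub_le_of_norm_fderiv_le (s := Set.univ) (fun z _ => hf z) (fun z _ => key z) convex_univ
    (Set.mem_univ y) (Set.mem_univ x)
  simpa using this

lemma mol_close (h : Ker ψ) (hψ : ∫ t, ψ t = 1) (h0 : ∀ t, 0 ≤ ψ t) (hl : 0 < l) (hf : Continuous f) {A : ℝ} (hA : 0 ≤ A)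
    (hL : ∀ x y, |f x - f y| ≤ A * ‖x - y‖) (x : Fin n → ℝ) : |mol ψ l f x - f x| ≤ A * l := by
  have e : mol ψ l f x - f x = mol ψ l (fun y => f y + -f x) x := by
    rw [mol_add h hl hf continuous_const, mol_const hψ hl]; ring
  rw [e]
  have := mol_bd (f := fun y => f y + - f x) h hl (x := x) (A := A * l) (fun t ht => by
    have h1 := hL (x - t) x
    simp only [sub_sub_cancel_left, norm_neg] at h1
    rw [← sub_eq_add_neg]
    exact h1.trans (mul_le_mul_of_nonneg_left ht hA))
  simpa [abs_of_nonneg (h0 _), hψ] using this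

set_option maxHeartbeats 1000000 in
lemma pder_mol' (h : Ker ψ) (hl : 0 < l) (hf : ContDiff ℝ 1 f) {A : ℝ} (i : Fin n) (hA : ∀ x, |pder i f x| ≤ A) :
    pder i (mol ψ l f) = mol ψ l (pder i f) := by
  funext x
  have hc : Continuous (pder i f) := (hf.continuous_fderiv (by simp)).clm_apply continuous_const
  have h0 := (mol_smo h hl hf.continuous).diffAt x
  have h1 : HasDerivAt (fun τ : ℝ => mol ψ l f (x + τ • Pi.single i 1)) (pder i (mol ψ l f) x) 0 := by
    have h2 : HasDerivAt (fun τ : ℝ => x + τ • (Pi.single i 1 : Fin n → ℝ)) (Pi.single i 1) 0 := by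
      simpa using ((hasDerivAt_id (0:ℝ)).smul_const (Pi.single i 1 : Fin n → ℝ)).const_add x
    have h3 : HasFDerivAt (mol ψ l f) (fderiv ℝ (mol ψ l f) x) (x + (0:ℝ) • Pi.single i 1) := by
      simpa using h0.hasFDerivAt
    exact h3.comp_hasDerivAt 0 h2
  have h4 : HasDerivAt (fun τ : ℝ => mol ψ l f (x + τ • Pi.single i 1)) (mol ψ l (pder i f) x) 0 := by
    have kc := (kn_smo h l).continuous
    have := hasDerivAt_integral_of_dominated_loc_of_deriv_le (μ := volume) (s := Metric.ball (0:ℝ) 1)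
      (F := fun (τ : ℝ) t => kn ψ l t * f (x + τ • Pi.single i 1 - t))
      (F' := fun (τ : ℝ) t => kn ψ l t * pder i f (x + τ • Pi.single i 1 - t)) (x₀ := 0)
      (bound := fun t => |kn ψ l t| * A) (Metric.ball_mem_nhds _ one_pos)
      (Filter.Eventually.of_forall fun τ => (kn_int h hl hf.continuous _).aestronglyMeasurable)
      (kn_int h hl hf.continuous _) (kn_int h hl hc _).aestronglyMeasurable
      (Filter.Eventually.of_forall fun t τ _ => by
        rw [Real.norm_eq_abs, abs_mul]; exact mul_le_mul_of_nonneg_left (hA _) (abs_nonneg _))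
      ((Continuous.integrable_of_hasCompactSupport kc (kn_cs h hl)).abs.mul_const _)
      (Filter.Eventually.of_forall fun t τ _ => by
        refine HasDerivAt.const_mul _ ?_
        have h2 : HasDerivAt (fun τ : ℝ => x + τ • (Pi.single i 1 : Fin n → ℝ) - t) (Pi.single i 1) τ := by
          simpa using (((hasDerivAt_id (τ:ℝ)).smul_const (Pi.single i 1 : Fin n → ℝ)).const_add x).sub_const t
        have h5 : HasFDerivAt f (fderiv ℝ f (x + τ • Pi.single i 1 - t)) (x + τ • Pi.single i 1 - t) :=
          ((hf.differentiable (by simp)) _).hasFDerivAt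
        exact h5.comp_hasDerivAt τ h2)
    have h6 := this.2
    simp only [zero_smul, add_zero] at h6
    exact h6
  exact h1.unique h4

end mol

section molsc
variable {P : Type} {n : ℕ} {ψ : (Fin n → ℝ) → ℝ} {l A B : P → ℝ} {f g : Fam P n}

lemma SO.mol {S : P → Set (Fin n → ℝ)} (hl : ∀ p, 0 < l p) (hf : ∀ p, Continuous (f p)) {c : ℝ}
    (hA : ∀ p, ∀ x ∈ S p, ∀ t, ‖t‖ ≤ l p → |f p (x - t)| ≤ c * A p) (k : ℕ) (h : Ker ψ) :
    SO S (fun p => 1 / l p) k A (fun p => mol ψ (l p) (f p)) := by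
  have key : ∀ k {B m : P → ℝ} {ψ : (Fin n → ℝ) → ℝ}, Ker ψ → (∀ p, 0 ≤ m p) → (∀ p, B p = m p * A p) →
      SO S (fun p => 1 / l p) k B (fun p x => m p * CI.mol ψ (l p) (f p) x) := by
    intro k
    have b : ∀ {B m : P → ℝ} {ψ : (Fin n → ℝ) → ℝ}, Ker ψ → (∀ p, 0 ≤ m p) → (∀ p, B p = m p * A p) →
      ∃ C : ℝ, ∀ p, ∀ x ∈ S p, |m p * CI.mol ψ (l p) (f p) x| ≤ C * B p := by
      intro B m ψ h hm hB
      refine ⟨(∫ t, |ψ t|) * c, fun p x hx => ?_⟩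
      rw [abs_mul, abs_of_nonneg (hm p), hB]
      refine (mul_le_mul_of_nonneg_left (mol_bd h (hl p) (hA p x hx)) (hm p)).trans (le_of_eq (by ring))
    induction k with
    | zero => exact b
    | succ k ih =>
      intro B m ψ h hm hB
      refine ⟨b h hm hB, fun i => ?_⟩
      have := ih (B := fun p => B p * (1 / l p)) (m := fun p => m p * (l p)⁻¹) (h.pder i)
        (fun p => mul_nonneg (hm p) (inv_nonneg.2 (hl p).le)) (fun p => by rw [hB]; ring)
      convert this using 2 with p
      rw [pder_const_mul _ (mol_smo h (hl p) (hf p)), pder_mol h (hl p) (hf p)]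
      funext x; ring
  have := key k (B := A) (m := fun _ => 1) h (by simp) (by simp)
  simpa using this

lemma SC.mol (h : Ker ψ) (hl : ∀ p, 0 < l p) (hf : ∀ p, Continuous (f p)) {c : ℝ}
    (hA : ∀ p x, |f p x| ≤ c * A p) : SC (fun p => 1 / l p) A (fun p => mol ψ (l p) (f p)) :=
  ⟨fun p => mol_smo h (hl p) (hf p), fun k => SO.mol hl hf (fun p x _ t _ => hA p _) k h⟩

/-- commutator estimate -/
lemma SC.comm (h : Ker ψ) (hψ : ∫ t, ψ t = 1) (hl : ∀ p, 0 < l p) (hf : ∀ p, Continuous (f p)) (hg : ∀ p, Continuous (g p))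
    {c : ℝ} (hc : 0 ≤ c) (hB : ∀ p, 0 ≤ B p)
    (lf : ∀ p x y, |f p x - f p y| ≤ c * B p * ‖x - y‖) (lg : ∀ p x y, |g p x - g p y| ≤ c * B p * ‖x - y‖) :
    SC (fun p => 1 / l p) (fun p => (l p * B p) ^ 2)
      (fun p x => CI.mol ψ (l p) (fun x => f p x * g p x) x - CI.mol ψ (l p) (f p) x * CI.mol ψ (l p) (g p) x) := by
  have sf := fun p => mol_smo h (hl p) (hf p)
  have sg := fun p => mol_smo h (hl p) (hg p)
  have sfg : ∀ p, Smo (CI.mol ψ (l p) (fun x => f p x * g p x)) := fun p => mol_smo h (hl p) ((hf p).mul (hg p))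
  refine ⟨fun p => (sfg p).sub ((sf p).mul (sg p)), fun k => ?_⟩
  -- shifted family
  have bf : ∀ {f : Fam P n}, (∀ p, Continuous (f p)) → (∀ p x y, |f p x - f p y| ≤ c * B p * ‖x - y‖) →
    SO (P := P × (Fin n → ℝ)) (fun q => {q.2}) (fun q => 1 / l q.1) k (fun q => l q.1 * B q.1)
      (fun q => CI.mol ψ (l q.1) (fun x => f q.1 x - f q.1 q.2)) := by
    intro f hf lf
    refine SO.mol (c := c) (l := fun q : P × (Fin n → ℝ) => l q.1) (fun q => hl q.1) (fun q => (hf q.1).sub continuous_const) ?_ k h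
    rintro ⟨p, x0⟩ x hx t ht
    obtain rfl : x = x0 := hx
    have := lf p (x - t) x
    simp only [sub_sub_cancel_left, norm_neg] at this
    exact this.trans ((mul_le_mul_of_nonneg_left ht (mul_nonneg hc (hB p))).trans (le_of_eq (by ring)))
  have bfg : SO (P := P × (Fin n → ℝ)) (fun q => {q.2}) (fun q => 1 / l q.1) k (fun q => (l q.1 * B q.1) * (l q.1 * B q.1))
      (fun q => CI.mol ψ (l q.1) (fun x => (f q.1 x - f q.1 q.2) * (g q.1 x - g q.1 q.2))) := by
    refine SO.mol (c := c * c) (l := fun q : P × (Fin n → ℝ) => l q.1) (fun q => hl q.1)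
      (fun q => ((hf q.1).sub continuous_const).mul ((hg q.1).sub continuous_const)) ?_ k h
    rintro ⟨p, x0⟩ x hx t ht
    obtain rfl : x = x0 := hx
    have h1 := lf p (x - t) x
    have h2 := lg p (x - t) x
    simp only [sub_sub_cancel_left, norm_neg] at h1 h2
    have h3 := mul_le_mul_of_nonneg_left ht (mul_nonneg hc (hB p))
    exact (abs_mul_le' (h1.trans h3) (h2.trans h3)).trans (le_of_eq (by ring))
  have sm : ∀ {f : Fam P n}, (∀ p, Continuous (f p)) → ∀ q : P × (Fin n → ℝ),
     Smo (CI.mol ψ (l q.1) (fun x => f q.1 x - f q.1 q.2)) := fun hf q =>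
      mol_smo h (hl q.1) ((hf q.1).sub continuous_const)
  have smfg : ∀ q : P × (Fin n → ℝ), Smo (CI.mol ψ (l q.1) (fun x => (f q.1 x - f q.1 q.2) * (g q.1 x - g q.1 q.2))) :=
    fun q => mol_smo h (hl q.1) (((hf q.1).sub continuous_const).mul ((hg q.1).sub continuous_const))
  have tot := SO.add smfg
    (fun q => ((sm hf q).mul (sm hg q)).neg) bfg ((bf hf lf).mul (sm hf) (sm hg) (bf hg lg)).neg
  have e1 : ∀ {f : Fam P n}, (∀ p, Continuous (f p)) → ∀ p x0 x, CI.mol ψ (l p) (fun x => f p x - f p x0) x =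
      CI.mol ψ (l p) (f p) x - f p x0 := by
    intro f hf p x0 x
    simp only [sub_eq_add_neg]
    rw [mol_add h (hl p) (hf p) continuous_const, mol_const hψ (hl p)]
  have e2 : ∀ p x0 x, CI.mol ψ (l p) (fun x => (f p x - f p x0) * (g p x - g p x0)) x =
      CI.mol ψ (l p) (fun x => f p x * g p x) x - g p x0 * CI.mol ψ (l p) (f p) x
        - f p x0 * CI.mol ψ (l p) (g p) x + f p x0 * g p x0 := by
    intro p x0 x
    have : (fun x => (f p x - f p x0) * (g p x - g p x0)) = fun x => (f p x * g p x + (- g p x0) * f p x)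
      + ((- f p x0) * g p x + f p x0 * g p x0) := by funext x; ring
    have cf := hf p; have cg := hg p
    rw [this, mol_add h (hl p) (by fun_prop) (by fun_prop), mol_add h (hl p) (by fun_prop) (by fun_prop),
      mol_add h (hl p) (by fun_prop) (by fun_prop), mol_const hψ (hl p), mol_cmul, mol_cmul]
    ring
  have tot' : SO (P := P × (Fin n → ℝ)) (fun q => {q.2}) (fun q => 1 / l q.1) k (fun q => (l q.1 * B q.1) ^ 2)
    (fun q x => CI.mol ψ (l q.1) (fun x => f q.1 x * g q.1 x) x - CI.mol ψ (l q.1) (f q.1) x * CI.mol ψ (l q.1) (g q.1) x) := by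
    convert tot using 1
    · funext q; ring
    · funext q x
      rw [e2, e1 hf, e1 hg]; ring
  clear tot bfg bf e1 e2 sm
  have back : ∀ k {A : P → ℝ} {F : Fam P n}, SO (P := P × (Fin n → ℝ)) (fun q => {q.2}) (fun q => 1 / l q.1) k (fun q => A q.1) (fun q => F q.1) →
    SO (fun _ => Set.univ) (fun p => 1 / l p) k A F := by
    intro k
    induction k with
    | zero => rintro A F ⟨C, hC⟩; exact ⟨C, fun p x _ => hC (p, x) x rfl⟩
    | succ k ih => rintro A F ⟨⟨C, hC⟩, hd⟩; exact ⟨⟨C, fun p x _ => hC (p, x) x rfl⟩, fun i => ih (hd i)⟩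
  exact back k tot'

end molsc
end CI

namespace CI
open scoped ContDiff

/-- State of the iteration. -/
structure St {n d : ℕ} (H0 : Fin n → Fin n → ℝ) (g : Fin n → Fin n → (Fin n → ℝ) → ℝ) (σ M : ℝ) (r : ℕ) (κ s lam : ℝ)
    (u : Fin d → (Fin n → ℝ) → ℝ) (ν θ : Fin n → Fin d → (Fin n → ℝ) → ℝ) : Prop where
  k1 : 1 ≤ κ
  sp : 0 < s
  lp : 0 < lam
  us : ∀ a, Smo (u a)
  ns : ∀ k a, Smo (ν k a)
  ts : ∀ k a, Smo (θ k a)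
  un : ∀ x i k, ∑ a, pder i (u a) x * ν k a x = 0
  nn : ∀ x k l, ∑ a, ν k a x * ν l a x = if k = l then 1 else 0
  ut : ∀ x i l, ∑ a, pder i (u a) x * θ l a x = if i = l then 1 else 0
  b1 : ∀ i a x, |pder i (u a) x| ≤ M - κ * s
  bt : ∀ k a x, |θ k a x| ≤ M - κ * s
  b2 : ∀ i j a x, |pder j (pder i (u a)) x| ≤ s * κ ^ r * lam
  b3 : ∀ j k a x, |pder j (ν k a) x| ≤ s * κ ^ r * lam
  b4 : ∀ j k a x, |pder j (θ k a) x| ≤ s * κ ^ r * lam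
  er : ∀ i j x, |g i j x - (∑ a, pder i (u a) x * pder j (u a) x) - s ^ 2 * H0 i j| ≤ σ / 2 * s ^ 2
  ss : s * κ ^ (2 * r + 1) ≤ 1
  sl : κ ^ (2 * r) ≤ s ^ 2 * lam

lemma mol_close' {n : ℕ} {ψ f : (Fin n → ℝ) → ℝ} {l : ℝ} (h : Ker ψ) (hψ : ∫ t, ψ t = 1) (h0 : ∀ t, 0 ≤ ψ t) (hl : 0 < l)
    (hf : Smo f) {B : ℝ} (hB0 : 0 ≤ B) (hB : ∀ i x, |pder i f x| ≤ B) (x : Fin n → ℝ) : |mol ψ l f x - f x| ≤ n * B * l :=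
  mol_close h hψ h0 hl hf.continuous (by positivity)
    (fun x y => lip_of_pder (hf.differentiable (by simp)) hB x y) x

lemma CO.mol {P : Type} {n : ℕ} {ψ : (Fin n → ℝ) → ℝ} {l s : P → ℝ} {f : Fam P n} (h : Ker ψ) (hl : ∀ p, 0 < l p)
    (hf : ∀ p, Smo (f p)) {c : ℝ} (h0 : ∀ p x, |f p x| ≤ c)
    (h1 : ∀ j p x, |pder j (f p) x| ≤ c * (s p * (1 / l p))) :
    CO s (fun p => 1 / l p) (fun p => mol ψ (l p) (f p)) := by
  refine ⟨SC.mol (c := c) h hl (fun p => (hf p).continuous) (fun p x => by simpa using h0 p x), fun j => ?_⟩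
  have := SC.mol (A := fun p => s p * (1 / l p)) (c := c) h hl (fun p => ((hf p).pder j).continuous) (h1 j)
  exact this.congr fun p x => by rw [pder_mol' h (hl p) ((hf p).of_le (by simp)) j (h1 j p)]

lemma abs_le_one_of_unit {d : ℕ} {v : Fin d → ℝ} (h : ∑ a, v a * v a = 1) (a : Fin d) : |v a| ≤ 1 := by
  have := Finset.single_le_sum (f := fun a => v a * v a) (fun b _ => mul_self_nonneg _) (Finset.mem_univ a)
  rw [h] at this
  exact abs_le_one_iff_mul_self_le_one.2 this

lemma dot_diff {d : ℕ} {A A' T T' : Fin d → ℝ} {C t c : ℝ} (hC : 0 ≤ C) (ht : 0 ≤ t) (h1 : ∀ a, |A a| ≤ C) (h2 : ∀ a, |T' a| ≤ C)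
    (h3 : ∀ a, |A' a - A a| ≤ t) (h4 : ∀ a, |T' a - T a| ≤ t) (h : ∑ a, A a * T a = c) :
    |∑ a, A' a * T' a - c| ≤ d * (2 * C * t) := by
  rw [← h, ← Finset.sum_sub_distrib]
  refine abs_sum_le' fun a => ?_
  have e : A' a * T' a - A a * T a = (A' a - A a) * T' a + A a * (T' a - T a) := by ring
  rw [e]
  refine (abs_add_le _ _).trans ?_
  have := abs_mul_le' (h3 a) (h2 a)
  have := abs_mul_le' (h1 a) (h4 a)
  linarith

section moll
variable {P : Type} {n d : ℕ} {H0 : Fin n → Fin n → ℝ} {g : Fin n → Fin n → (Fin n → ℝ) → ℝ} {σ M : ℝ} {r : ℕ}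
  {κ s lam : P → ℝ} {u : Fin d → Fam P n} {ν θ : Fin n → Fin d → Fam P n} {ψ : (Fin n → ℝ) → ℝ}

lemma St.lB {u : Fin d → (Fin n → ℝ) → ℝ} {ν θ : Fin n → Fin d → (Fin n → ℝ) → ℝ} {κ s lam : ℝ}
    (h : St H0 g σ M r κ s lam u ν θ) : (lam * κ ^ (r + 1))⁻¹ * (s * κ ^ r * lam) = s / κ := by
  have := h.k1; have := h.lp
  field_simp
  ring

/-- mollified frame -/
lemma moll_geo (hS : ∀ p, St H0 g σ M r (κ p) (s p) (lam p) (fun a => u a p) (fun k a => ν k a p) (fun k a => θ k a p))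
    (hM : 1 ≤ M) (h : Ker ψ) (hψ : ∫ t, ψ t = 1) (h0 : ∀ t, 0 ≤ ψ t)
    {l : P → ℝ} (hl : ∀ p, l p = (lam p * κ p ^ (r + 1))⁻¹) :
    ∃ K0 : ℝ, 1 ≤ K0 ∧ ∀ {Q : Type} (ι : Q → P), (∀ q, K0 ≤ κ (ι q)) →
      ∃ (ν1 θ1 : Fin n → Fin d → Fam Q n),
      Geo (fun q => s (ι q)) (fun q => 1 / l (ι q)) (fun b q => mol ψ (l (ι q)) (u b (ι q))) ν1 θ1 ∧
      Near (fun q => s (ι q)) (fun q => l (ι q)) (fun b q => u b (ι q)) (fun b q => mol ψ (l (ι q)) (u b (ι q)))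
        (fun k b q => θ k b (ι q)) θ1 := by
  have lp : ∀ p, 0 < l p := fun p => by
    rw [hl]; have := (hS p).k1; have := (hS p).lp; positivity
  have kp : ∀ p, 0 < κ p := fun p => by have := (hS p).k1; linarith
  have sp : ∀ p, 0 < s p := fun p => (hS p).sp
  have sk : ∀ p, s p / κ p ≤ s p := fun p => div_le_self (sp p).le (hS p).k1
  have B0 : ∀ p, 0 ≤ s p * κ p ^ r * lam p := fun p => by
    have := (hS p).lp; have := kp p; have := sp p; positivity
  have Ms : ∀ p, M - κ p * s p ≤ M := fun p => by have := mul_pos (kp p) (sp p); linarith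
  have eB : ∀ p, s p * κ p ^ r * lam p ≤ s p * (1 / l p) := fun p => by
    have h1 : l p * (s p * κ p ^ r * lam p) ≤ s p := by rw [hl, (hS p).lB]; exact sk p
    rw [mul_one_div, le_div_iff₀ (lp p)]; linarith
  have eB' : ∀ p, s p * κ p ^ r * lam p ≤ M * (s p * (1 / l p)) := fun p =>
    (eB p).trans (le_mul_of_one_le_left ((B0 p).trans (eB p)) hM)
  have bu : ∀ i a p x, |pder i (u a p) x| ≤ M := fun i a p x => ((hS p).b1 i a x).trans (Ms p)
  have bt : ∀ i a p x, |θ i a p x| ≤ M := fun i a p x => ((hS p).bt i a x).trans (Ms p)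
  have bn : ∀ i a p x, |ν i a p x| ≤ M := fun i a p x =>
    (abs_le_one_of_unit (v := fun a => ν i a p x) (by have := (hS p).nn x i i; simpa using this) a).trans hM
  have pm : ∀ i a p, pder i (mol ψ (l p) (u a p)) = mol ψ (l p) (pder i (u a p)) := fun i a p =>
    pder_mol' h (lp p) (((hS p).us a).of_le (by simp)) i (bu i a p)
  have cA : ∀ i a, CO s (fun p => 1 / l p) (fun p => mol ψ (l p) (pder i (u a p))) := fun i a =>
    CO.mol h lp (fun p => ((hS p).us a).pder i) (bu i a) (fun j p x => ((hS p).b2 i j a x).trans (eB' p))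
  have cN : ∀ i a, CO s (fun p => 1 / l p) (fun p => mol ψ (l p) (ν i a p)) := fun i a =>
    CO.mol h lp (fun p => (hS p).ns i a) (bn i a) (fun j p x => ((hS p).b3 j i a x).trans (eB' p))
  have cT : ∀ i a, CO s (fun p => 1 / l p) (fun p => mol ψ (l p) (θ i a p)) := fun i a =>
    CO.mol h lp (fun p => (hS p).ts i a) (bt i a) (fun j p x => ((hS p).b4 j i a x).trans (eB' p))
  have mb : ∀ {f : (Fin n → ℝ) → ℝ} (p : P), (∀ x, |f x| ≤ M) → ∀ x, |mol ψ (l p) f x| ≤ M := by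
    intro f p hf x
    have := mol_bd (x := x) h (lp p) (fun t _ => hf (x - t))
    simpa [abs_of_nonneg (h0 _), hψ] using this
  have cl : ∀ {f : (Fin n → ℝ) → ℝ} (p : P), Smo f → (∀ i x, |pder i f x| ≤ s p * κ p ^ r * lam p) → ∀ x,
      |mol ψ (l p) f x - f x| ≤ n * s p := by
    intro f p hf hb x
    refine (mol_close' h hψ h0 (lp p) hf (B0 p) hb x).trans ?_
    have h1 : (s p * κ p ^ r * lam p) * l p ≤ s p := by rw [mul_comm, hl, (hS p).lB]; exact sk p
    calc _ = n * ((s p * κ p ^ r * lam p) * l p) := by ring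
      _ ≤ _ := mul_le_mul_of_nonneg_left h1 (by positivity)
  have clA := fun i a p => cl p (((hS p).us a).pder i) (fun j => (hS p).b2 i j a)
  have clN := fun i a p => cl p ((hS p).ns i a) (fun j => (hS p).b3 j i a)
  have clT := fun i a p => cl p ((hS p).ts i a) (fun j => (hS p).b4 j i a)
  obtain ⟨t0, ht0, C', hC', F⟩ := frame n d M (by linarith)
  set C1 : ℝ := d * (2 * M * n) with hC1
  have C10 : 0 ≤ C1 := by positivity
  refine ⟨1 + C1 / t0, by have : 0 ≤ C1 / t0 := by positivity
                          linarith, fun {Q} ι hι => ?_⟩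
  have hn0 : ∀ p, 0 ≤ (n:ℝ) * s p := fun p => mul_nonneg (by positivity) (sp p).le
  have ed : ∀ p, (d:ℝ) * (2 * M * (n * s p)) = C1 * s p := fun p => by rw [hC1]; ring
  obtain ⟨ν1, θ1, f1, f2, f3, f4, f5, f6, f7⟩ := F (P := Q) (s := fun q => s (ι q)) (μ := fun q => 1 / l (ι q))
    (t := fun q => C1 * s (ι q))
    (A := fun i a q => mol ψ (l (ι q)) (pder i (u a (ι q)))) (N := fun i a q => mol ψ (l (ι q)) (ν i a (ι q)))
    (T := fun i a q => mol ψ (l (ι q)) (θ i a (ι q))) (fun i a => (cA i a).reindex ι) (fun i a => (cN i a).reindex ι)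
    (fun i a => (cT i a).reindex ι) (fun i a q => mb _ (bu i a _)) (fun i a q => mb _ (bn i a _))
    (fun i a q => mb _ (bt i a _)) (fun q => by
      have h1 : s (ι q) * κ (ι q) ≤ 1 := by
        refine le_trans ?_ (hS (ι q)).ss
        refine mul_le_mul_of_nonneg_left ?_ (sp _).le
        exact le_self_pow₀ (hS (ι q)).k1 (by omega)
      have h2 := mul_le_mul_of_nonneg_left (hι q) (sp (ι q)).le
      have h3 : s (ι q) * (1 + C1 / t0) ≤ 1 := h2.trans h1
      have h4 : s (ι q) * (C1 / t0) ≤ 1 := by have := sp (ι q); linarith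
      rw [← mul_div_assoc, div_le_one ht0] at h4
      linarith)
    (fun q x i k => by
      rw [← ed]; exact dot_diff (by linarith) (hn0 _) (fun a => bu i a _ x) (fun a => mb _ (bt k a _) x) (fun a => clA i a _ x)
        (fun a => clT k a _ x) ((hS (ι q)).ut x i k))
    (fun q x i k => by
      rw [← ed]; have := dot_diff (by linarith) (hn0 _) (fun a => bu i a _ x) (fun a => mb _ (bn k a _) x) (fun a => clA i a _ x)
        (fun a => clN k a _ x) ((hS (ι q)).un x i k)
      simpa using this)
    (fun q x i k => by
      rw [← ed]; exact dot_diff (by linarith) (hn0 _) (fun a => bn i a _ x) (fun a => mb _ (bn k a _) x) (fun a => clN i a _ x)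
        (fun a => clN k a _ x) ((hS (ι q)).nn x i k))
  refine ⟨ν1, θ1, ⟨?_, ?_, ?_, fun i a => (f1 i a).1, fun i j a => ?_, fun i a => (f2 i a).1, fun i j a => ?_, ?_, ?_, ?_⟩, ?_⟩
  · exact fun a q => mol_smo h (lp _) ((hS (ι q)).us a).continuous
  · exact fun i a => ((cA i a).reindex ι).1.congr fun q x => by rw [pm]
  · first
    | exact fun i j a => (((cA i a).reindex ι).2 j).congr fun q x => by rw [pm]
    | exact fun i j a => (((cA j a).reindex ι).2 i).congr fun q x => by rw [pm]
  · first
    | exact (f1 j a).2 i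
    | exact (f1 i a).2 j
  · first
    | exact (f2 j a).2 i
    | exact (f2 i a).2 j
  · intro q x i k; simp only [pm]; exact f3 q x i k
  · intro q x i k; exact f4 q x i k
  · intro q x i k; simp only [pm]; exact f5 q x i k
  · refine ⟨n * M + n + C' * C1, by positivity, fun b q x => ?_, fun i b q x => ?_, fun i b q x => ?_⟩
    · have := mol_close' h hψ h0 (lp (ι q)) ((hS (ι q)).us b) (by linarith) (fun i => bu i b (ι q)) x
      refine this.trans (mul_le_mul_of_nonneg_right ?_ (lp _).le)
      have : 0 ≤ C' * C1 := by positivity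
      have : (0:ℝ) ≤ n := by positivity
      linarith
    · rw [pm]
      refine (clA i b (ι q) x).trans (mul_le_mul_of_nonneg_right ?_ (sp _).le)
      have : 0 ≤ C' * C1 := by positivity
      have : (0:ℝ) ≤ n * M := by positivity
      linarith
    · refine (abs_tri (clT i b (ι q) x) (f7 i b q x)).trans ?_
      have := sp (ι q)
      have : (0:ℝ) ≤ n * M * s (ι q) := by positivity
      linarith
end moll
end CI

namespace CI
open scoped ContDiff

section moll
variable {P : Type} {n d : ℕ} {H0 : Fin n → Fin n → ℝ} {g : Fin n → Fin n → (Fin n → ℝ) → ℝ} {σ M : ℝ} {r : ℕ}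
  {κ s lam : P → ℝ} {u : Fin d → Fam P n} {ν θ : Fin n → Fin d → Fam P n} {ψ : (Fin n → ℝ) → ℝ}

/-- mollified defect -/
lemma moll_D (hS : ∀ p, St H0 g σ M r (κ p) (s p) (lam p) (fun a => u a p) (fun k a => ν k a p) (fun k a => θ k a p))
    (hr : 1 ≤ r) (h : Ker ψ) (hψ : ∫ t, ψ t = 1) (h0 : ∀ t, 0 ≤ ψ t) (hg : ∀ i j, Continuous (g i j))
    {l : P → ℝ} (hl : ∀ p, l p = (lam p * κ p ^ (r + 1))⁻¹) :
    (∀ i j, SC (fun p => 1 / l p) (fun p => s p ^ 2) (fun p x => mol ψ (l p) (g i j) x - (s p / κ p ^ r) ^ 2 * H0 i j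
      - Hm (fun b p => mol ψ (l p) (u b p)) i j p x)) ∧
    ∃ C : ℝ, 0 ≤ C ∧ ∀ i j p x, |(mol ψ (l p) (g i j) x - (s p / κ p ^ r) ^ 2 * H0 i j
      - Hm (fun b p => mol ψ (l p) (u b p)) i j p x) - s p ^ 2 * H0 i j| ≤ σ / 2 * s p ^ 2 + C * (s p ^ 2 / κ p) := by
  have lp : ∀ p, 0 < l p := fun p => by
    rw [hl]; have := (hS p).k1; have := (hS p).lp; positivity
  have k1 : ∀ p, 1 ≤ κ p := fun p => (hS p).k1
  have kp : ∀ p, 0 < κ p := fun p => by have := (hS p).k1; linarith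
  have sp : ∀ p, 0 < s p := fun p => (hS p).sp
  have B0 : ∀ p, 0 ≤ s p * κ p ^ r * lam p := fun p => by
    have := (hS p).lp; have := kp p; have := sp p; positivity
  have pm : ∀ i a p, pder i (mol ψ (l p) (u a p)) = mol ψ (l p) (pder i (u a p)) := fun i a p =>
    pder_mol' h (lp p) (((hS p).us a).of_le (by simp)) i ((hS p).b1 i a)
  have pc : ∀ i a p, Continuous (pder i (u a p)) := fun i a p => (((hS p).us a).pder i).continuous
  have lip : ∀ i a p x y, |pder i (u a p) x - pder i (u a p) y| ≤ n * (s p * κ p ^ r * lam p) * ‖x - y‖ := fun i a p =>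
    lip_of_pder ((((hS p).us a).pder i).differentiable (by simp)) (fun j => (hS p).b2 i j a)
  have cm : ∀ i j, SC (fun p => 1 / l p) (fun p => (s p / κ p) ^ 2) (fun p x => ∑ b, (mol ψ (l p) (fun x => pder i (u b p) x * pder j (u b p) x) x
      - mol ψ (l p) (pder i (u b p)) x * mol ψ (l p) (pder j (u b p)) x)) := fun i j =>
    SC.sum _ fun b _ => (SC.comm h hψ lp (pc i b) (pc j b) (by positivity) B0 (lip i b) (lip j b)).congrA fun p => by
      rw [hl, (hS p).lB]
  have kr : ∀ p, κ p ≤ κ p ^ r := fun p => le_self_pow₀ (k1 p) (by omega)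
  have s2 : ∀ p, (s p / κ p) ^ 2 ≤ s p ^ 2 / κ p := fun p => by
    rw [div_pow]
    exact div_le_div_of_nonneg_left (sq_nonneg _) (kp p) (le_self_pow₀ (k1 p) (by omega))
  have s2' : ∀ p, (s p / κ p ^ r) ^ 2 ≤ s p ^ 2 / κ p := fun p => by
    refine le_trans ?_ (s2 p)
    exact pow_le_pow_left₀ (by have := sp p; have := kp p; positivity)
      (div_le_div_of_nonneg_left (sp p).le (kp p) (kr p)) 2
  have s3 : ∀ p, s p ^ 2 / κ p ≤ s p ^ 2 := fun p => div_le_self (sq_nonneg _) (k1 p)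
  have hc : ∀ i j p, Continuous (fun x => ∑ a, pder i (u a p) x * pder j (u a p) x) := fun i j p =>
    continuous_finset_sum _ fun a _ => (pc i a p).mul (pc j a p)
  have Ec : ∀ i j p, Continuous (fun x => g i j x - (∑ a, pder i (u a p) x * pder j (u a p) x) - s p ^ 2 * H0 i j) :=
    fun i j p => ((hg i j).sub (hc i j p)).sub continuous_const
  have e : ∀ i j p x, mol ψ (l p) (g i j) x - (s p / κ p ^ r) ^ 2 * H0 i j - Hm (fun b p => mol ψ (l p) (u b p)) i j p x =
      (mol ψ (l p) (fun x => g i j x - (∑ a, pder i (u a p) x * pder j (u a p) x) - s p ^ 2 * H0 i j) x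
       + (s p ^ 2 - (s p / κ p ^ r) ^ 2) * H0 i j) + ∑ b, (mol ψ (l p) (fun x => pder i (u b p) x * pder j (u b p) x) x
      - mol ψ (l p) (pder i (u b p)) x * mol ψ (l p) (pder j (u b p)) x) := by
    intro i j p x
    have e1 : mol ψ (l p) (g i j) x = mol ψ (l p) (fun x => (g i j x - (∑ a, pder i (u a p) x * pder j (u a p) x) - s p ^ 2 * H0 i j) +
      ((∑ a, pder i (u a p) x * pder j (u a p) x) + s p ^ 2 * H0 i j)) x := by
      congr 1; funext x; ring
    have hcc : Continuous (fun x => (∑ a, pder i (u a p) x * pder j (u a p) x) + s p ^ 2 * H0 i j) := (hc i j p).add continuous_const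
    rw [e1, mol_add h (lp p) (Ec i j p) hcc, mol_add h (lp p) (hc i j p) continuous_const,
      mol_const hψ (lp p), mol_sum h (lp p) _ (F := fun a x => pder i (u a p) x * pder j (u a p) x) (fun a => (pc i a p).mul (pc j a p)), Finset.sum_sub_distrib]
    simp only [Hm, pm]
    ring
  refine ⟨fun i j => ?_, ?_⟩
  · refine SC.congr ?_ fun p x => (e i j p x).symm
    refine SC.add (SC.add ?_ ?_) ?_
    · exact SC.mol (c := σ / 2) h lp (Ec i j) (fun p x => (hS p).er i j x)
    · refine SC.cst ⟨|H0 i j|, fun p => ?_⟩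
      rw [abs_mul, mul_comm]
      refine mul_le_mul_of_nonneg_left ?_ (abs_nonneg _)
      have := (s2' p).trans (s3 p)
      rw [abs_of_nonneg (by linarith)]
      have := sq_nonneg (s p / κ p ^ r)
      linarith
    · exact (cm i j).weaken 1 (fun p => sq_nonneg _) (fun p => by rw [one_mul]; exact (s2 p).trans (s3 p))
        (fun p => (one_div_pos.2 (lp p)).le) (fun p => le_rfl) (fun p => sq_nonneg _)
  · obtain ⟨C, hC, hb⟩ := SC.bd2 (fun p => sq_nonneg _) cm
    refine ⟨C + ∑ i, ∑ j, |H0 i j|, add_nonneg hC (Finset.sum_nonneg fun _ _ => Finset.sum_nonneg fun _ _ => abs_nonneg _), fun i j p x => ?_⟩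
    rw [e]
    have h1 := mol_bd (x := x) h (lp p) (f := fun x => g i j x - (∑ a, pder i (u a p) x * pder j (u a p) x) - s p ^ 2 * H0 i j)
      (fun t _ => (hS p).er i j (x - t))
    simp only [abs_of_nonneg (h0 _), hψ, one_mul] at h1
    have h2 := (hb i j p x).trans (mul_le_mul_of_nonneg_left (s2 p) hC)
    have h3 : |H0 i j| ≤ ∑ i, ∑ j, |H0 i j| :=
      (Finset.single_le_sum (f := fun j => |H0 i j|) (fun _ _ => abs_nonneg _) (Finset.mem_univ j)).trans
      (Finset.single_le_sum (f := fun i => ∑ j, |H0 i j|) (fun _ _ => Finset.sum_nonneg fun _ _ => abs_nonneg _) (Finset.mem_univ i))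
    have h4 : |(s p / κ p ^ r) ^ 2 * H0 i j| ≤ (s p ^ 2 / κ p) * (∑ i, ∑ j, |H0 i j|) :=
      abs_mul_le' (by rw [abs_of_nonneg (sq_nonneg _)]; exact s2' p) h3
    rw [abs_le] at h1 h2 h4 ⊢
    constructor <;> nlinarith
end moll

/-- tuples -/
structure Tup (n d : ℕ) where
  κ : ℝ
  s : ℝ
  l : ℝ
  u : Fin d → (Fin n → ℝ) → ℝ
  ν : Fin n → Fin d → (Fin n → ℝ) → ℝ
  θ : Fin n → Fin d → (Fin n → ℝ) → ℝ

theorem stage {n d N : ℕ} (Y : Dec n N) {σ : ℝ} (hσ : 0 < σ) (hY : ∀ (Z : Fin n → Fin n → ℝ) (t : ℝ), 0 ≤ t →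
    (∀ i j, |Z i j - t * Y.H0 i j| ≤ σ * t) →
    (∀ i, t / 2 ≤ (∑ l, Z i l * Y.q l) / Y.q i ∧ (∑ l, Z i l * Y.q l) / Y.q i ≤ 2 * t) ∧
    (∀ r k, t / 2 ≤ (∑ a, ∑ b, Y.L r k a b * Z a b) ∧ (∑ a, ∑ b, Y.L r k a b * Z a b) ≤ 2 * t))
    (g : Fin n → Fin n → (Fin n → ℝ) → ℝ) (hg : ∀ i j, Continuous (g i j)) (gs : ∀ i j x, g i j x = g j i x)
    {A : ℝ} (hA : 0 ≤ A) (gl : ∀ i j x y, |g i j x - g i j y| ≤ A * ‖x - y‖) {M : ℝ} (hM : 1 ≤ M) (r : ℕ) (hr : 1 ≤ r)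
    (hN : 1 ≤ N) :
    ∃ K : ℝ, 1 ≤ K ∧ ∀ κ s lam (u : Fin d → (Fin n → ℝ) → ℝ) (ν θ : Fin n → Fin d → (Fin n → ℝ) → ℝ), K ≤ κ →
      St Y.H0 g σ M r κ s lam u ν θ → ∃ (u' : Fin d → (Fin n → ℝ) → ℝ) (ν' θ' : Fin n → Fin d → (Fin n → ℝ) → ℝ),
      St Y.H0 g σ M r κ (s / κ ^ r) (lam * κ ^ (r + 3 + N * (2 * r + 1))) u' ν' θ' ∧
      (∀ a x, |u' a x - u a x| ≤ 1 / lam) ∧ (∀ i a x, |pder i (u' a) x - pder i (u a) x| ≤ κ * s) := by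
  let P := {p : Tup n d // St Y.H0 g σ M r p.κ p.s p.l p.u p.ν p.θ}
  obtain ⟨ψ, hψ, ψ0, ψ1⟩ := exists_ker n
  let l : P → ℝ := fun p => (p.1.l * p.1.κ ^ (r + 1))⁻¹
  have hS : ∀ p : P, St Y.H0 g σ M r p.1.κ p.1.s p.1.l p.1.u p.1.ν p.1.θ := fun p => p.2
  obtain ⟨K0, hK0, F0⟩ := moll_geo (P := P) (κ := fun p => p.1.κ) (s := fun p => p.1.s) (lam := fun p => p.1.l)
    (u := fun a p => p.1.u a) (ν := fun k a p => p.1.ν k a) (θ := fun k a p => p.1.θ k a) hS hM hψ ψ1 ψ0 (l := l)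
    (fun _ => rfl)
  obtain ⟨D1, C1, hC1, D2⟩ := moll_D (P := P) (κ := fun p => p.1.κ) (s := fun p => p.1.s) (lam := fun p => p.1.l)
    (u := fun a p => p.1.u a) (ν := fun k a p => p.1.ν k a) (θ := fun k a p => p.1.θ k a) hS hr hψ ψ1 ψ0 hg (l := l)
    (fun _ => rfl)
  let Q1 := {p : P // K0 ≤ p.1.κ ∧ 2 * C1 / σ ≤ p.1.κ}
  obtain ⟨ν1, θ1, G1, N1⟩ := F0 (fun q : Q1 => q.1) (fun q => q.2.1)
  have k1 : ∀ q : Q1, 1 ≤ q.1.1.κ := fun q => (hS q.1).k1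
  have kp : ∀ q : Q1, 0 < q.1.1.κ := fun q => by have := k1 q; linarith
  have sp : ∀ q : Q1, 0 < q.1.1.s := fun q => (hS q.1).sp
  have lp : ∀ q : Q1, 0 < q.1.1.l := fun q => (hS q.1).lp
  let Λ : ℕ → Q1 → ℝ := fun m q => q.1.1.l * q.1.1.κ ^ (r + 1) * q.1.1.κ * (q.1.1.κ ^ (2 * r + 1)) ^ m
  have Λp : ∀ m q, 0 < Λ m q := fun m q => by
    have := kp q; have := lp q; simp only [Λ]; positivity
  have Λs : ∀ m q, Λ (m+1) q = Λ m q * q.1.1.κ ^ (2 * r + 1) := fun m q => by simp only [Λ, pow_succ]; ring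
  have l1 : ∀ q : Q1, 1 / l q.1 = q.1.1.l * q.1.1.κ ^ (r + 1) := fun q => by simp [l]
  have Λ0 : ∀ q : Q1, Λ 0 q = 1 / l q.1 * q.1.1.κ := fun q => by rw [l1]; simp [Λ]
  have lpos : ∀ q : Q1, 0 < 1 / l q.1 := fun q => by
    rw [l1]; have := kp q; have := lp q; positivity
  have kk : ∀ q : Q1, q.1.1.κ ≤ q.1.1.κ ^ (2 * r + 1) := fun q => le_self_pow₀ (k1 q) (by omega)
  have sk : ∀ q : Q1, q.1.1.s * q.1.1.κ ≤ 1 := fun q =>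
    (mul_le_mul_of_nonneg_left (kk q) (sp q).le).trans (hS q.1).ss
  obtain ⟨t0, ht0, F⟩ := full_chain Y hY (s := fun q : Q1 => q.1.1.s) (μ := fun q : Q1 => 1 / l q.1) Λ G1
    ⟨fun q => (sp q).le, lpos, fun q => by rw [Λ0]; exact le_mul_of_one_le_right (lpos q).le (k1 q), fun q => by
      rw [Λ0]; have := mul_le_mul_of_nonneg_left (sk q) (lpos q).le
      linarith⟩
    (fun m => ⟨fun q => (sp q).le, Λp m, fun q => by
      rw [Λs]; exact le_mul_of_one_le_right (Λp m q).le (one_le_pow₀ (k1 q)), fun q => by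
      rw [Λs]; have := mul_le_mul_of_nonneg_left (hS q.1).ss (Λp m q).le
      linarith⟩) sp (fun i j => (D1 i j).reindex (fun q : Q1 => q.1))
    (fun i j q x => by
      simp only [Hm]
      have e1 : g i j = g j i := funext (gs i j)
      have e2 : Y.H0 i j = Y.H0 j i := by
        rw [Y.hH, Y.hH]; simp only [eq_comm (a := i) (b := j), mul_comm]
      rw [e1, e2]
      congr 1
      exact Finset.sum_congr rfl fun a _ => mul_comm _ _)
    (fun i j q x => by
      refine (D2 i j q.1 x).trans ?_
      have h1 := q.2.2
      rw [div_le_iff₀ hσ] at h1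
      have h2 : C1 * (q.1.1.s ^ 2 / q.1.1.κ) ≤ σ / 2 * q.1.1.s ^ 2 := by
        rw [← mul_div_assoc, div_le_iff₀ (kp q)]
        have := mul_le_mul_of_nonneg_right h1 (sq_nonneg q.1.1.s)
        nlinarith
      linarith)
    (2 * r + 1) (by omega) (δ := fun q => 1 / q.1.1.κ ^ (2 * r + 1))
    (fun m q => by
      rw [Λs, div_mul_eq_div_div, div_self (Λp m q).ne'])
    (fun q => by
      rw [Λ0, div_mul_eq_div_div, div_self (lpos q).ne', div_pow, one_pow])
  let Q2 := {q : Q1 // 1 / t0 ≤ q.1.1.κ}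
  have hk2 : ∀ q : Q2, 1 / q.1.1.1.κ ≤ t0 := fun q => by
    have := q.2
    rw [div_le_iff₀ ht0] at this
    rw [div_le_iff₀ (kp q.1)]; linarith
  obtain ⟨u2, ν2, θ2, G2, N2, C2, hC2, E2⟩ := F (fun q : Q2 => q.1)
    (fun q => by
      refine le_trans ?_ (hk2 q)
      rw [le_div_iff₀ (kp q.1)]; exact sk q.1)
    (fun q => by
      rw [Λ0, div_mul_eq_div_div, div_self (lpos q.1).ne']; exact hk2 q)
  obtain ⟨C3, hC3, n31, n32, n33⟩ := N1
  obtain ⟨C4, hC4, n41, n42, n43⟩ := N2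
  obtain ⟨C5, hC5, g5⟩ := SC.bd2 (A := fun q : Q2 => q.1.1.1.s * Λ N q.1) (m := n * n) (d := d) (fun q => mul_nonneg (sp q.1).le (Λp N q.1).le)
    (F := fun ij a q => pder (finProdFinEquiv.symm ij).2 (pder (finProdFinEquiv.symm ij).1 (u2 a q)))
    (fun ij a => G2.u2 _ _ a)
  obtain ⟨C6, hC6, g6⟩ := SC.bd2 (A := fun q : Q2 => q.1.1.1.s * Λ N q.1) (m := n * n) (d := d) (fun q => mul_nonneg (sp q.1).le (Λp N q.1).le)
    (F := fun ij a q => pder (finProdFinEquiv.symm ij).2 (ν2 (finProdFinEquiv.symm ij).1 a q))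
    (fun ij a => G2.n2 _ _ a)
  obtain ⟨C7, hC7, g7⟩ := SC.bd2 (A := fun q : Q2 => q.1.1.1.s * Λ N q.1) (m := n * n) (d := d) (fun q => mul_nonneg (sp q.1).le (Λp N q.1).le)
    (F := fun ij a q => pder (finProdFinEquiv.symm ij).2 (θ2 (finProdFinEquiv.symm ij).1 a q))
    (fun ij a => G2.t2 _ _ a)
  refine ⟨1 + K0 + 2 * C1 / σ + 1 / t0 + C3 + C4 + C5 + C6 + C7 + 2 / σ * (A + C2), ?_, ?_⟩
  · have : 0 ≤ 2 * C1 / σ := by positivity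
    have : 0 ≤ 1 / t0 := by positivity
    have : 0 ≤ 2 / σ * (A + C2) := by positivity
    linarith
  intro κ s lam u ν θ hK hSt
  have z1 : 0 ≤ 2 * C1 / σ := by positivity
  have z2 : 0 ≤ 1 / t0 := by positivity
  have z3 : 0 ≤ 2 / σ * (A + C2) := by positivity
  have κ1 : 1 ≤ κ := hSt.k1
  have κp : 0 < κ := by linarith
  have s0 : 0 < s := hSt.sp
  have lm : 0 < lam := hSt.lp
  let p : P := ⟨⟨κ, s, lam, u, ν, θ⟩, hSt⟩
  let q1 : Q1 := ⟨p, by show K0 ≤ κ; linarith, by show 2 * C1 / σ ≤ κ; linarith⟩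
  let q2 : Q2 := ⟨q1, by show 1 / t0 ≤ κ; linarith⟩
  have ns : C3 + C4 + 1 ≤ κ := by linarith
  have kr : κ ≤ κ ^ r := le_self_pow₀ κ1 (by omega)
  have du : ∀ i a x, |pder i (u2 a q2) x - pder i (u a) x| ≤ (C3 + C4) * s := fun i a x => by
    rw [add_mul]; exact abs_tri (n32 i a q1 x) (n42 i a q2 x)
  have dt : ∀ i a x, |θ2 i a q2 x - θ i a x| ≤ (C3 + C4) * s := fun i a x => by
    rw [add_mul]; exact abs_tri (n33 i a q1 x) (n43 i a q2 x)
  have hlp : l p = (lam * κ ^ (r+1))⁻¹ := rfl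
  have hL0 : Λ 0 q1 = lam * κ ^ (r + 1) * κ := by simp [Λ, q1, p]
  have hLN : Λ N q1 = lam * κ ^ (r + 1) * κ * (κ ^ (2 * r + 1)) ^ N := rfl
  have spp : κ * (s / κ ^ r) ≤ s := by
    rw [← mul_div_assoc, div_le_iff₀ (by positivity)]
    rw [mul_comm]; exact mul_le_mul_of_nonneg_left kr s0.le
  have top : s / κ ^ r * κ ^ r * (lam * κ ^ (r + 3 + N * (2 * r + 1))) = κ * (s * Λ N q1) := by
    rw [hLN, div_mul_cancel₀ _ (by positivity), ← pow_mul]; ring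
  have sL : 0 ≤ s * Λ N q1 := mul_nonneg s0.le (Λp N q1).le
  refine ⟨fun a => u2 a q2, fun k a => ν2 k a q2, fun k a => θ2 k a q2, ⟨κ1, by positivity, by positivity, fun a => G2.us a q2,
    fun k a => (G2.n1 k a).smo q2, fun k a => (G2.t1 k a).smo q2, fun x => G2.un q2 x, fun x => G2.nn q2 x, fun x => G2.ut q2 x,
    fun i a x => ?_, fun i a x => ?_, fun i j a x => ?_, fun j k a x => ?_, fun j k a x => ?_, fun i j x => ?_, ?_, ?_⟩, fun a x => ?_, fun i a x => ?_⟩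
  · have h1 := hSt.b1 i a x
    have h2 := abs_add_le (pder i (u a) x) (pder i (u2 a q2) x - pder i (u a) x)
    rw [add_sub_cancel] at h2
    have h3 := du i a x
    have h4 := mul_le_mul_of_nonneg_right ns s0.le
    linarith
  · have h1 := hSt.bt i a x
    have h2 := abs_add_le (θ i a x) (θ2 i a q2 x - θ i a x)
    rw [add_sub_cancel] at h2
    have h3 := dt i a x
    have h4 := mul_le_mul_of_nonneg_right ns s0.le
    linarith
  · have h1 := g5 (finProdFinEquiv (i, j)) a q2 x
    simp only [Equiv.symm_apply_apply] at h1
    rw [top]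
    exact h1.trans (mul_le_mul_of_nonneg_right (by linarith) sL)
  · have h1 := g6 (finProdFinEquiv (k, j)) a q2 x
    simp only [Equiv.symm_apply_apply] at h1
    rw [top]
    exact h1.trans (mul_le_mul_of_nonneg_right (by linarith) sL)
  · have h1 := g7 (finProdFinEquiv (k, j)) a q2 x
    simp only [Equiv.symm_apply_apply] at h1
    rw [top]
    exact h1.trans (mul_le_mul_of_nonneg_right (by linarith) sL)
  · have h1 := E2 i j q2 x
    have h2 := mol_close hψ ψ1 ψ0 (l := l p) (by rw [hlp]; positivity) (hg i j) hA (gl i j) x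
    have h3 : l p ≤ s ^ 2 / κ ^ (2 * r + 1) := by
      rw [hlp]
      have := hSt.sl
      rw [inv_le_comm₀ (by positivity) (by positivity), inv_div, div_le_iff₀ (by positivity)]
      calc κ ^ (2 * r + 1) = κ * κ ^ (2 * r) := by ring
        _ ≤ κ ^ (r + 1) * (s ^ 2 * lam) := mul_le_mul (le_self_pow₀ κ1 (by omega)) this (by positivity) (by positivity)
        _ = _ := by ring
    have h4 : (A + C2) * (s ^ 2 / κ ^ (2 * r + 1)) ≤ σ / 2 * (s / κ ^ r) ^ 2 := by
      have e : σ / 2 * (s / κ ^ r) ^ 2 = (σ / 2 * κ) * (s ^ 2 / κ ^ (2 * r + 1)) := by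
        rw [div_pow, ← pow_mul, mul_comm r 2]; field_simp; ring
      rw [e]
      refine mul_le_mul_of_nonneg_right ?_ (by positivity)
      have : 2 / σ * (A + C2) ≤ κ := by linarith
      have := mul_le_mul_of_nonneg_left this (show 0 ≤ σ / 2 by positivity)
      refine le_trans (le_of_eq ?_) this
      field_simp
    have h5 := mul_le_mul_of_nonneg_left h3 hA
    refine le_trans ?_ h4
    have e1 : C2 * (s ^ 2 * (1 / κ ^ (2 * r + 1))) = C2 * (s ^ 2 / κ ^ (2 * r + 1)) := by ring
    have h1' : |Hm u2 i j q2 x - Hm (fun b p => mol ψ (l p) (p.1.u b)) i j p x - (mol ψ (l p) (g i j) x - (s / κ ^ r) ^ 2 * Y.H0 i j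
      - Hm (fun b p => mol ψ (l p) (p.1.u b)) i j p x)| ≤ C2 * (s ^ 2 * (1 / κ ^ (2 * r + 1))) := h1
    rw [e1] at h1'
    have e2 : g i j x - (∑ a, pder i (u2 a q2) x * pder j (u2 a q2) x) - (s / κ ^ r) ^ 2 * Y.H0 i j =
      - (mol ψ (l p) (g i j) x - g i j x) - (Hm u2 i j q2 x - Hm (fun b p => mol ψ (l p) (p.1.u b)) i j p x - (mol ψ (l p) (g i j) x - (s / κ ^ r) ^ 2 * Y.H0 i j
      - Hm (fun b p => mol ψ (l p) (p.1.u b)) i j p x)) := by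
      simp only [Hm]; ring
    rw [e2]
    refine (abs_sub _ _).trans ?_
    rw [abs_neg]
    linarith
  · refine le_trans ?_ hSt.ss
    exact mul_le_mul_of_nonneg_right (div_le_self s0.le (one_le_pow₀ κ1)) (by positivity)
  · have e : (s / κ ^ r) ^ 2 * (lam * κ ^ (r + 3 + N * (2 * r + 1))) = (s ^ 2 * lam) * κ ^ (r + 3 + N * (2 * r + 1) - 2 * r) := by
      have h1 : 2 * r ≤ r + 3 + N * (2 * r + 1) := by nlinarith
      rw [pow_sub₀ _ κp.ne' h1]
      have : κ ^ (2 * r) ≠ 0 := by positivity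
      rw [div_pow, ← pow_mul, mul_comm r 2]
      field_simp
    rw [e]
    exact hSt.sl.trans (le_mul_of_one_le_right (by positivity) (one_le_pow₀ κ1))
  · have h1 := abs_tri (n31 a q1 x) (n41 a q2 x)
    refine h1.trans ?_
    show C3 * l p + C4 * (s / Λ 0 q1) ≤ 1 / lam
    rw [hlp, hL0]
    have s1 : s ≤ 1 := by
      refine le_trans ?_ hSt.ss
      exact le_mul_of_one_le_right s0.le (one_le_pow₀ κ1)
    have h2 : s / (lam * κ ^ (r + 1) * κ) ≤ 1 / (lam * κ ^ (r+1)) := by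
      refine div_le_div₀ (by norm_num) s1 (by positivity) ?_
      exact le_mul_of_one_le_right (by positivity) κ1
    have h3 := mul_le_mul_of_nonneg_left h2 hC4
    have h4 : (C3 + C4) * (1 / (lam * κ ^ (r+1))) ≤ 1 / lam := by
      rw [← div_div, ← mul_div_assoc, div_le_iff₀ (by positivity), mul_comm]
      refine mul_le_mul_of_nonneg_left ?_ (by positivity)
      have : κ ≤ κ ^ (r + 1) := le_self_pow₀ κ1 (by omega)
      linarith
    rw [← one_div]; linarith
  · refine (du i a x).trans (mul_le_mul_of_nonneg_right (by linarith) s0.le)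
end CI

namespace CI
open scoped ContDiff


lemma fderiv_eq_sum {n : ℕ} {f : (Fin n → ℝ) → ℝ} (x v : Fin n → ℝ) : fderiv ℝ f x v = ∑ i, v i * pder i f x := by
  conv_lhs => rw [pi_eq_sum_univ' v]
  simp [_root_.pder, map_sum]

lemma c1_limit {n : ℕ} {f : ℕ → (Fin n → ℝ) → ℝ} (hf : ∀ q, Smo (f q)) {A B H θ : ℝ}
    (hA : ∀ q x, |f (q+1) x - f q x| ≤ A * (1/2) ^ q) (hB : ∀ q i x, |pder i (f (q+1)) x - pder i (f q) x| ≤ B * (1/2) ^ q)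
    (hH : ∀ q i x y, |pder i (f q) x - pder i (f q) y| ≤ H * ‖x - y‖ ^ θ) :
    ∃ F : (Fin n → ℝ) → ℝ, ContDiff ℝ 1 F ∧ (∀ q x, |F x - f q x| ≤ 2 * A * (1/2) ^ q) ∧
      (∀ q i x, |pder i F x - pder i (f q) x| ≤ 2 * B * (1/2) ^ q) ∧
      ∀ i x y, |pder i F x - pder i F y| ≤ H * ‖x - y‖ ^ θ := by
  have gen : ∀ {a : ℕ → ℝ} {C : ℝ}, (∀ q, |a (q+1) - a q| ≤ C * (1/2) ^ q) → ∃ L, Filter.Tendsto a Filter.atTop (nhds L) ∧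
      ∀ q, |L - a q| ≤ 2 * C * (1/2) ^ q := by
    intro a C h
    have h' : ∀ q, dist (a q) (a (q+1)) ≤ C * (1/2) ^ q := fun q => by rw [dist_comm]; exact h q
    obtain ⟨L, hL⟩ := cauchySeq_tendsto_of_complete (cauchySeq_of_le_geometric _ _ (by norm_num) h')
    refine ⟨L, hL, fun q => ?_⟩
    have := dist_le_of_le_geometric_of_tendsto _ _ (by norm_num) h' hL q
    rw [dist_comm] at this
    exact this.trans (le_of_eq (by ring))
  choose F hF hF2 using fun x => gen (a := fun q => f q x) (C := A) (fun q => hA q x)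
  choose G hG hG2 using fun i x => gen (a := fun q => pder i (f q) x) (C := B) (fun q => hB q i x)
  let F' : (Fin n → ℝ) → ((Fin n → ℝ) →L[ℝ] ℝ) := fun x => ∑ i, (G i x) • ContinuousLinearMap.proj (R := ℝ) i
  have hpw : Filter.Tendsto (fun q : ℕ => (n:ℝ) * (2 * |B| * (1/2) ^ q)) Filter.atTop (nhds 0) := by
    have := (tendsto_pow_atTop_nhds_zero_of_lt_one (r := (1/2:ℝ)) (by norm_num) (by norm_num)).const_mul ((n:ℝ) * (2 * |B|))
    simpa [mul_assoc] using this
  have unif : TendstoUniformly (fun q => fderiv ℝ (f q)) F' Filter.atTop := by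
    rw [Metric.tendstoUniformly_iff]
    intro ε hε
    filter_upwards [(tendsto_order.1 hpw).2 ε hε] with q hq x
    refine lt_of_le_of_lt ?_ hq
    rw [dist_eq_norm]
    refine ContinuousLinearMap.opNorm_le_bound _ (by positivity) fun v => ?_
    have e : (F' x - fderiv ℝ (f q) x) v = ∑ i, v i * (G i x - pder i (f q) x) := by
      simp only [ContinuousLinearMap.sub_apply, fderiv_eq_sum, F', ContinuousLinearMap.sum_apply]
      rw [← Finset.sum_sub_distrib]
      exact Finset.sum_congr rfl fun i _ => by simp; ring
    rw [e, Real.norm_eq_abs]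
    refine (abs_sum_le' fun i => abs_mul_le' (norm_le_pi_norm v i) ((hG2 i x q).trans (?_ : _ ≤ 2 * |B| * (1/2) ^ q))).trans (le_of_eq (by ring))
    exact mul_le_mul_of_nonneg_right (mul_le_mul_of_nonneg_left (le_abs_self B) (by norm_num)) (by positivity)
  have hd : ∀ x, HasFDerivAt F (F' x) x := fun x =>
    hasFDerivAt_of_tendstoUniformly unif (fun q x => ((hf q).diffAt x).hasFDerivAt) hF x
  have hfd : fderiv ℝ F = F' := funext fun x => (hd x).fderiv
  have hp : ∀ i x, pder i F x = G i x := fun i x => by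
    simp [_root_.pder, hfd, F', Pi.single_apply]
  refine ⟨F, contDiff_one_iff_fderiv.2 ⟨fun x => (hd x).differentiableAt, ?_⟩, fun q x => hF2 x q,
    fun q i x => by rw [hp]; exact hG2 i x q, fun i x y => ?_⟩
  · rw [hfd]
    exact unif.continuous (Filter.Frequently.of_forall fun q => (hf q).continuous_fderiv (by simp))
  · rw [hp, hp]
    exact le_of_tendsto ((hG i x).sub (hG i y)).abs (Filter.Eventually.of_forall fun q => hH q i x y)

lemma interp {a A B t θ : ℝ} (hA : |a| ≤ A) (hB : |a| ≤ B * t) (h0 : 0 ≤ θ) (h1 : θ ≤ 1) (ht : 0 ≤ t) (hB0 : 0 ≤ B) :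
    |a| ≤ A ^ (1 - θ) * B ^ θ * t ^ θ := by
  have h := Real.rpow_add_of_nonneg (abs_nonneg a) (show 0 ≤ 1 - θ by linarith) h0
  rw [sub_add_cancel, Real.rpow_one] at h
  rw [h, mul_assoc, ← Real.mul_rpow hB0 ht]
  exact mul_le_mul (Real.rpow_le_rpow (abs_nonneg _) hA (by linarith)) (Real.rpow_le_rpow (abs_nonneg _) hB h0)
    (by positivity) (Real.rpow_nonneg ((abs_nonneg _).trans hA) _)

theorem iter {n d N r : ℕ} {H0 : Fin n → Fin n → ℝ} {σ M K κ s lam θ : ℝ} {g : Fin n → Fin n → (Fin n → ℝ) → ℝ}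
    (F : ∀ κ s lam (u : Fin d → (Fin n → ℝ) → ℝ) (ν θ : Fin n → Fin d → (Fin n → ℝ) → ℝ), K ≤ κ →
      St H0 g σ M r κ s lam u ν θ → ∃ (u' : Fin d → (Fin n → ℝ) → ℝ) (ν' θ' : Fin n → Fin d → (Fin n → ℝ) → ℝ),
      St H0 g σ M r κ (s / κ ^ r) (lam * κ ^ (r + 3 + N * (2 * r + 1))) u' ν' θ' ∧
      (∀ a x, |u' a x - u a x| ≤ 1 / lam) ∧ (∀ i a x, |pder i (u' a) x - pder i (u a) x| ≤ κ * s))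
    (hr : 1 ≤ r) (hK : K ≤ κ) (hκ : 2 ≤ κ) (h0 : 0 ≤ θ) (h1 : θ ≤ 1) (hθ : (r + 3 + N * (2 * r + 1) : ℝ) * θ < r)
    {u : Fin d → (Fin n → ℝ) → ℝ} {ν ϑ : Fin n → Fin d → (Fin n → ℝ) → ℝ} (S0 : St H0 g σ M r κ s lam u ν ϑ) :
    ∃ v : (Fin n → ℝ) → (Fin d → ℝ), ContDiff ℝ 1 v ∧ (∃ C, ∀ i x y, ‖pder i v x - pder i v y‖ ≤ C * ‖x - y‖ ^ θ) ∧
      (∀ x i j, ∑ a, pder i v x a * pder j v x a = g i j x) ∧ (∀ x a, |v x a - u a x| ≤ 2 / lam) ∧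
      (∀ i a x, |pder i v x a - pder i (u a) x| ≤ 2 * κ * s) := by
  have κp : 0 < κ := by linarith
  have κ1 : 1 ≤ κ := by linarith
  set b : ℕ := r + 3 + N * (2 * r + 1) with hb
  have hbr : ((b:ℕ):ℝ) = (r + 3 + N * (2 * r + 1) : ℝ) := by rw [hb]; push_cast; ring
  rw [← hbr] at hθ
  -- the sequence
  let T := (Fin d → (Fin n → ℝ) → ℝ) × (Fin n → Fin d → (Fin n → ℝ) → ℝ) × (Fin n → Fin d → (Fin n → ℝ) → ℝ)
  let sq : ℕ → ℝ := fun q => s / (κ ^ r) ^ q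
  let lq : ℕ → ℝ := fun q => lam * (κ ^ b) ^ q
  let X : ℕ → Type := fun q => {w : T // St H0 g σ M r κ (sq q) (lq q) w.1 w.2.1 w.2.2}
  have nxt : ∀ q (w : X q), ∃ w' : X (q+1), (∀ a x, |w'.1.1 a x - w.1.1 a x| ≤ 1 / lq q) ∧
      (∀ i a x, |pder i (w'.1.1 a) x - pder i (w.1.1 a) x| ≤ κ * sq q) := by
    rintro q ⟨w, hw⟩
    obtain ⟨u', ν', θ', h1, h2, h3⟩ := F _ _ _ _ _ _ hK hw
    refine ⟨⟨(u', ν', θ'), ?_⟩, h2, h3⟩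
    have e1 : sq (q+1) = sq q / κ ^ r := by simp only [sq, pow_succ, div_div]
    have e2 : lq (q+1) = lq q * κ ^ b := by simp only [lq, pow_succ, mul_assoc]
    rw [e1, e2]; exact h1
  choose nx hn1 hn2 using nxt
  let W : ∀ q, X q := fun q => Nat.rec ⟨(u, ν, ϑ), by simpa [sq, lq] using S0⟩ (fun q w => nx q w) q
  let f : ℕ → Fin d → (Fin n → ℝ) → ℝ := fun q => (W q).1.1
  have f0 : f 0 = u := rfl
  have hS : ∀ q, St H0 g σ M r κ (sq q) (lq q) (f q) (W q).1.2.1 (W q).1.2.2 := fun q => (W q).2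
  have d1 : ∀ q a x, |f (q+1) a x - f q a x| ≤ 1 / lq q := fun q => hn1 q (W q)
  have d2 : ∀ q i a x, |pder i (f (q+1) a) x - pder i (f q a) x| ≤ κ * sq q := fun q => hn2 q (W q)
  have s0 := S0.sp
  have l0 := S0.lp
  have kr2 : 2 ≤ κ ^ r := hκ.trans (le_self_pow₀ κ1 (by omega))
  have kb2 : 2 ≤ κ ^ b := hκ.trans (le_self_pow₀ κ1 (by omega))
  have sb : ∀ q, sq q ≤ s * (1/2) ^ q := fun q => by
    simp only [sq]
    rw [div_eq_mul_inv, one_div, inv_pow]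
    exact mul_le_mul_of_nonneg_left (inv_anti₀ (by positivity) (pow_le_pow_left₀ (by norm_num) kr2 q)) s0.le
  have lb : ∀ q, 1 / lq q ≤ 1 / lam * (1/2) ^ q := fun q => by
    simp only [lq]
    rw [one_div, one_div, one_div, mul_inv, inv_pow]
    exact mul_le_mul_of_nonneg_left (inv_anti₀ (by positivity) (pow_le_pow_left₀ (by norm_num) kb2 q)) (by positivity)
  have sqp : ∀ q, 0 < sq q := fun q => (hS q).sp
  have lqp : ∀ q, 0 < lq q := fun q => (hS q).lp
  -- Hoelder
  set c : ℝ := n * (κ ^ r + κ ^ b) with hc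
  have c0 : 0 ≤ c := by positivity
  set ρ : ℝ := (κ ^ b) ^ θ / κ ^ r with hρ
  have ρ0 : 0 ≤ ρ := by positivity
  have ρ1 : ρ < 1 := by
    rw [hρ, div_lt_one (by positivity), ← Real.rpow_natCast, ← Real.rpow_natCast, ← Real.rpow_mul κp.le]
    exact Real.rpow_lt_rpow_of_exponent_lt (by linarith) hθ
  have lipq : ∀ q i a x y, |pder i (f q a) x - pder i (f q a) y| ≤ n * (sq q * κ ^ r * lq q) * ‖x - y‖ := fun q i a x y =>
    lip_of_pder ((((hS q).us a).pder i).differentiable (by simp)) (fun j => (hS q).b2 i j a) x y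
  have M0 : ∀ q i a x, |pder i (f q a) x| ≤ M := fun q i a x => ((hS q).b1 i a x).trans (by
    have := mul_pos κp (sqp q); linarith)
  set Z : ℝ := (2 * κ) ^ (1 - θ) * c ^ θ * (s * lam ^ θ) with hZ
  have Z0 : 0 ≤ Z := by positivity
  have step : ∀ q i a x y, |(pder i (f (q+1) a) x - pder i (f q a) x) - (pder i (f (q+1) a) y - pder i (f q a) y)| ≤
      Z * ρ ^ q * ‖x - y‖ ^ θ := by
    intro q i a x y
    have h3 := d2 q i a x
    have h4 := d2 q i a y
    have h5 := lipq q i a x y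
    have h6 := lipq (q+1) i a x y
    have e1 : sq (q+1) * κ ^ r * lq (q+1) = sq q * κ ^ b * lq q := by
      simp only [sq, lq, pow_succ]; field_simp; try ring
    rw [e1] at h6
    have := interp (A := 2 * κ * sq q) (B := c * lq q * sq q) (t := ‖x - y‖)
      (a := (pder i (f (q+1) a) x - pder i (f q a) x) - (pder i (f (q+1) a) y - pder i (f q a) y))
      ((abs_sub _ _).trans (by linarith)) (by
        rw [sub_sub_sub_comm]
        refine (abs_sub _ _).trans ((add_le_add h6 h5).trans (le_of_eq ?_))
        rw [hc]; ring) h0 h1 (norm_nonneg _) (by have := lqp q; have := sqp q; positivity)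
    refine this.trans (le_of_eq ?_)
    congr 1
    rw [hZ, Real.mul_rpow (by positivity) (sqp q).le, Real.mul_rpow (mul_nonneg c0 (lqp q).le) (sqp q).le, Real.mul_rpow c0 (lqp q).le]
    have e2 : sq q ^ (1 - θ) * sq q ^ θ = sq q := by
      rw [← Real.rpow_add (sqp q)]; simp
    have e3 : lq q ^ θ = lam ^ θ * ((κ ^ b) ^ θ) ^ q := by
      simp only [lq]
      rw [Real.mul_rpow l0.le (by positivity)]
      congr 1
      generalize hE : κ ^ b = E
      have hE0 : 0 ≤ E := by rw [← hE]; positivity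
      rw [← Real.rpow_natCast, ← Real.rpow_natCast, ← Real.rpow_mul hE0, ← Real.rpow_mul hE0, mul_comm]
    calc _ = (2 * κ) ^ (1 - θ) * c ^ θ * (sq q ^ (1 - θ) * sq q ^ θ) * lq q ^ θ := by ring
      _ = _ := by
        rw [e2, e3, hρ, div_pow]; simp only [sq]; ring
  set B0 : ℝ := (2 * M) ^ (1 - θ) * (n * (s * κ ^ r * lam)) ^ θ with hB0
  have hol : ∀ q i a x y, |pder i (f q a) x - pder i (f q a) y| ≤ (B0 + Z * ∑ j ∈ Finset.range q, ρ ^ j) * ‖x - y‖ ^ θ := by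
    intro q i a x y
    induction q with
    | zero =>
      simp only [Finset.range_zero, Finset.sum_empty, mul_zero, add_zero]
      refine interp ((abs_sub _ _).trans ?_) ?_ h0 h1 (norm_nonneg _) (by positivity)
      · have := M0 0 i a x; have := M0 0 i a y; linarith
      · have := lipq 0 i a x y
        simpa [sq, lq] using this
    | succ q ih =>
      rw [Finset.sum_range_succ]
      have := step q i a x y
      have e : pder i (f (q+1) a) x - pder i (f (q+1) a) y = ((pder i (f (q+1) a) x - pder i (f q a) x) - (pder i (f (q+1) a) y - pder i (f q a) y))
        + (pder i (f q a) x - pder i (f q a) y) := by ring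
      rw [e]
      refine (abs_add_le _ _).trans ((add_le_add this ih).trans (le_of_eq (by ring)))
  set H : ℝ := B0 + Z * (1 - ρ)⁻¹ with hH
  have hol' : ∀ q i a x y, |pder i (f q a) x - pder i (f q a) y| ≤ H * ‖x - y‖ ^ θ := by
    intro q i a x y
    refine (hol q i a x y).trans (mul_le_mul_of_nonneg_right ?_ (by positivity))
    refine add_le_add_right (mul_le_mul_of_nonneg_left ?_ Z0) _
    rw [← tsum_geometric_of_lt_one ρ0 ρ1]
    exact (summable_geometric_of_lt_one ρ0 ρ1).sum_le_tsum _ (fun _ _ => by positivity)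
  have lim := fun a => c1_limit (f := fun q => f q a) (fun q => (hS q).us a) (A := 1 / lam) (B := κ * s) (H := H) (θ := θ)
    (fun q x => (d1 q a x).trans (lb q)) (fun q i x => (d2 q i a x).trans
      ((mul_le_mul_of_nonneg_left (sb q) κp.le).trans (le_of_eq (by ring)))) (fun q i => hol' q i a)
  choose v v1 v2 v3 v4 using lim
  have vc : ContDiff ℝ 1 (fun x a => v a x) := contDiff_pi.2 v1
  have vp : ∀ i x a, pder i (fun x a => v a x) x a = pder i (v a) x := fun i x a => by
    simp only [_root_.pder]
    rw [fderiv_pi fun a => (v1 a).differentiable (by simp) x]; rfl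
  refine ⟨fun x a => v a x, vc, ⟨|H|, fun i x y => ?_⟩, fun x i j => ?_, fun x a => ?_, fun i a x => ?_⟩
  · rw [pi_norm_le_iff_of_nonneg (by positivity)]
    intro a
    simp only [Pi.sub_apply, vp, Real.norm_eq_abs]
    exact (v4 a i x y).trans (mul_le_mul_of_nonneg_right (le_abs_self H) (by positivity))
  · simp only [vp]
    have t0 : ∀ C, Filter.Tendsto (fun q : ℕ => C * (1/2:ℝ) ^ q) Filter.atTop (nhds 0) := fun C => by
      have := (tendsto_pow_atTop_nhds_zero_of_lt_one (r := (1/2:ℝ)) (by norm_num) (by norm_num)).const_mul C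
      simpa using this
    have t1 : ∀ i a, Filter.Tendsto (fun q => pder i (f q a) x) Filter.atTop (nhds (pder i (v a) x)) := fun i a => by
      rw [tendsto_iff_dist_tendsto_zero]
      refine squeeze_zero (fun _ => dist_nonneg) (fun q => ?_) (t0 (2 * (κ * s)))
      rw [dist_comm]; exact v3 a q i x
    have t2 : Filter.Tendsto (fun q => ∑ a, pder i (f q a) x * pder j (f q a) x) Filter.atTop (nhds (∑ a, pder i (v a) x * pder j (v a) x)) :=
      tendsto_finset_sum _ fun a _ => (t1 i a).mul (t1 j a)
    have t3 : Filter.Tendsto sq Filter.atTop (nhds 0) := squeeze_zero (fun q => (sqp q).le) sb (t0 s)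
    have t4 : Filter.Tendsto (fun q => σ / 2 * sq q ^ 2 ) Filter.atTop (nhds 0) := by
      simpa using (t3.pow 2).const_mul (σ / 2)
    have t5 := ((tendsto_const_nhds (x := g i j x)).sub t2).sub ((t3.pow 2).mul_const (H0 i j))
    have := squeeze_zero_norm (f := fun q => g i j x - ∑ a, pder i (f q a) x * pder j (f q a) x - sq q ^ 2 * H0 i j) (fun q => (hS q).er i j x) t4
    have := tendsto_nhds_unique t5 this
    simp at this
    linarith
  · have := v2 a 0 x
    simp only [pow_zero, mul_one] at this
    rw [f0] at this
    exact this.trans (le_of_eq (by ring))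
  · have := v3 a 0 i x
    simp only [pow_zero, mul_one] at this
    rw [vp]
    rw [f0] at this
    exact this.trans (le_of_eq (by ring))
end CI

namespace CI
open scoped ContDiff

lemma taylor2 {n : ℕ} {f : (Fin n → ℝ) → ℝ} (hf : Smo f) {D : ℝ} (hD : ∀ i j x, |pder j (pder i f) x| ≤ D) (x y : Fin n → ℝ) :
    |f x - f y - ∑ j, (x j - y j) * pder j f y| ≤ n * (n * D * ‖x - y‖) * ‖x - y‖ := by
  by_cases hn : n = 0
  · subst hn
    have : x = y := Subsingleton.elim _ _
    subst this; simp
  have D0 : 0 ≤ D := (abs_nonneg _).trans (hD ⟨0, Nat.pos_of_ne_zero hn⟩ ⟨0, Nat.pos_of_ne_zero hn⟩ 0)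
  have := Convex.norm_image_sub_le_of_norm_fderiv_le' (𝕜 := ℝ) (f := f) (s := Metric.closedBall y ‖x - y‖) (C := n * (n * D * ‖x - y‖))
    (φ := fderiv ℝ f y) (x := y) (y := x) (fun z _ => hf.diffAt z) (fun z hz => ?_) (convex_closedBall _ _) (by simp)
    (by simp [dist_eq_norm])
  · have e : fderiv ℝ f y (x - y) = ∑ j, (x j - y j) * pder j f y := by rw [fderiv_eq_sum]; rfl
    rw [e] at this; exact this
  · refine ContinuousLinearMap.opNorm_le_bound _ (by positivity) fun v => ?_
    rw [ContinuousLinearMap.sub_apply, fderiv_eq_sum, fderiv_eq_sum, ← Finset.sum_sub_distrib, Real.norm_eq_abs]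
    have hz' : ‖z - y‖ ≤ ‖x - y‖ := by simpa [dist_eq_norm] using hz
    refine (abs_sum_le' (c := ‖v‖ * (n * D * ‖x - y‖)) fun i => ?_).trans (le_of_eq (by ring))
    rw [← mul_sub]
    refine abs_mul_le' (norm_le_pi_norm v i) ?_
    refine (lip_of_pder ((hf.pder i).differentiable (by simp)) (fun j => hD i j) z y).trans ?_
    exact mul_le_mul_of_nonneg_left hz' (by positivity)

lemma inj_stab {n d : ℕ} {u : Fin d → (Fin n → ℝ) → ℝ} {θ : Fin n → Fin d → (Fin n → ℝ) → ℝ} {D B : ℝ} (us : ∀ a, Smo (u a))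
    (hD : ∀ i j a x, |pder j (pder i (u a)) x| ≤ D) (hB : ∀ l a x, |θ l a x| ≤ B) (hB0 : 0 ≤ B) (hD0 : 0 ≤ D)
    (ut : ∀ x i l, ∑ a, pder i (u a) x * θ l a x = if i = l then 1 else 0) {K : Set (Fin n → ℝ)} (hK : IsCompact K)
    (inj : Set.InjOn (fun x a => u a x) K) :
    ∃ η > 0, ∀ v : Fin d → (Fin n → ℝ) → ℝ, (∀ a, ∀ x ∈ K, |v a x - u a x| ≤ η) →
      (∀ l, ∀ x ∈ K, ∀ y ∈ K, |∑ a, ((v a x - u a x) - (v a y - u a y)) * θ l a y| ≤ 1/2 * ‖x - y‖) →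
      Set.InjOn (fun x a => v a x) K := by
  set c : ℝ := d * (n * (n * D) * B) with hc
  have c0 : 0 ≤ c := by positivity
  set ρ : ℝ := 1 / (4 * (c + 1)) with hρ
  have ρ0 : 0 < ρ := by positivity
  have ρc : c * ρ ≤ 1/4 := by
    rw [hρ, mul_one_div, div_le_iff₀ (by positivity)]; linarith
  -- far part
  have far : ∃ η > 0, ∀ x ∈ K, ∀ y ∈ K, ρ ≤ ‖x - y‖ → 4 * η ≤ ‖(fun a => u a x - u a y : Fin d → ℝ)‖ := by
    have Sc : IsCompact ((K ×ˢ K) ∩ {z : (Fin n → ℝ) × (Fin n → ℝ) | ρ ≤ ‖z.1 - z.2‖}) :=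
      (hK.prod hK).inter_right (isClosed_le continuous_const (by fun_prop))
    rcases ((K ×ˢ K) ∩ {z : (Fin n → ℝ) × (Fin n → ℝ) | ρ ≤ ‖z.1 - z.2‖}).eq_empty_or_nonempty with h | h
    · refine ⟨1, one_pos, fun x hx y hy hxy => ?_⟩
      have hm : (x, y) ∈ (K ×ˢ K) ∩ {z : (Fin n → ℝ) × (Fin n → ℝ) | ρ ≤ ‖z.1 - z.2‖} := ⟨⟨hx, hy⟩, hxy⟩
      rw [h] at hm
      exact absurd hm (Set.notMem_empty _)
    · have uc : ∀ a, Continuous (u a) := fun a => (us a).continuous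
      obtain ⟨z, hz, hm⟩ := Sc.exists_isMinOn h (f := fun z => ‖(fun a => u a z.1 - u a z.2 : Fin d → ℝ)‖)
        (Continuous.continuousOn (by
          refine continuous_norm.comp (continuous_pi fun a => ?_)
          exact ((uc a).comp continuous_fst).sub ((uc a).comp continuous_snd)))
      have pos : 0 < ‖(fun a => u a z.1 - u a z.2 : Fin d → ℝ)‖ := by
        rw [norm_pos_iff]
        intro h0
        have : z.1 = z.2 := inj hz.1.1 hz.1.2 (funext fun a => sub_eq_zero.1 (congrFun h0 a))
        have h2 := hz.2
        simp only [Set.mem_setOf_eq, this, sub_self, norm_zero] at h2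
        linarith
      refine ⟨_, div_pos pos (by norm_num : (0:ℝ) < 4), fun x hx y hy hxy => ?_⟩
      have := hm (⟨⟨hx, hy⟩, hxy⟩ : (x, y) ∈ (K ×ˢ K) ∩ {z : (Fin n → ℝ) × (Fin n → ℝ) | ρ ≤ ‖z.1 - z.2‖})
      simp only [Set.mem_setOf_eq] at this
      linarith
  obtain ⟨η, η0, hη⟩ := far
  refine ⟨η, η0, fun v h1 h2 x hx y hy hxy => ?_⟩
  have hxy' : ∀ a, v a x = v a y := fun a => congrFun hxy a
  have near : ‖x - y‖ < ρ := by
    by_contra hcon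
    push Not at hcon
    have h3 := hη x hx y hy hcon
    have h4 : ‖(fun a => u a x - u a y : Fin d → ℝ)‖ ≤ 2 * η := by
      rw [pi_norm_le_iff_of_nonneg (by linarith)]
      intro a
      have ha := h1 a x hx
      have hb := h1 a y hy
      rw [Real.norm_eq_abs, abs_le]
      rw [abs_le] at ha hb
      rw [hxy' a] at ha
      constructor <;> linarith
    linarith
  have comp : ∀ l, |x l - y l| ≤ 3/4 * ‖x - y‖ := by
    intro l
    have e : x l - y l = -(∑ a, ((v a x - u a x) - (v a y - u a y)) * θ l a y) -
        ∑ a, (u a x - u a y - ∑ j, (x j - y j) * pder j (u a) y) * θ l a y := by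
      have e1 : ∑ a, (∑ j, (x j - y j) * pder j (u a) y) * θ l a y = x l - y l := by
        simp only [Finset.sum_mul]
        rw [Finset.sum_comm]
        simp only [mul_assoc, ← Finset.mul_sum, ut]
        simp
      rw [← sub_eq_zero]
      nth_rewrite 1 [← e1]
      rw [← Finset.sum_neg_distrib, ← Finset.sum_sub_distrib, ← Finset.sum_sub_distrib]
      refine Finset.sum_eq_zero fun a _ => ?_
      rw [hxy' a]; ring
    rw [e]
    refine (abs_sub _ _).trans ?_
    rw [abs_neg]
    have h3 := h2 l x hx y hy
    have h4 : |∑ a, (u a x - u a y - ∑ j, (x j - y j) * pder j (u a) y) * θ l a y| ≤ c * ‖x - y‖ * ‖x - y‖ := by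
      refine (abs_sum_le' fun a => abs_mul_le' (taylor2 (us a) (fun i j => hD i j a) x y) (hB l a y)).trans (le_of_eq ?_)
      rw [hc]; ring
    have h5 : c * ‖x - y‖ ≤ 1/4 := (mul_le_mul_of_nonneg_left near.le c0).trans ρc
    have h6 := mul_le_mul_of_nonneg_right h5 (norm_nonneg (x - y))
    linarith
  have : ‖x - y‖ ≤ 3/4 * ‖x - y‖ := by
    rw [pi_norm_le_iff_of_nonneg (by positivity)]
    exact fun l => comp l
  have h0 : ‖x - y‖ = 0 := le_antisymm (by linarith) (norm_nonneg _)
  exact sub_eq_zero.1 (norm_eq_zero.1 h0)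

/-- Smooth functions with all derivatives bounded. -/
def Bd {n : ℕ} (f : (Fin n → ℝ) → ℝ) : Prop := SC (P := Unit) (fun _ => 1) (fun _ => 1) (fun _ => f)

section bd
variable {n : ℕ} {f g : (Fin n → ℝ) → ℝ}
lemma Bd.smo (h : Bd f) : Smo f := SC.smo h ()
lemma Bd.bd (h : Bd f) : ∃ C : ℝ, 0 ≤ C ∧ ∀ x, |f x| ≤ C := by
  obtain ⟨C, c0, hC⟩ := SC.bd h
  exact ⟨C, c0, fun x => by simpa using hC () x⟩
lemma Bd.pd (h : Bd f) (i : Fin n) : Bd (pder i f) := (SC.pd h i).congrA (by simp)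
lemma Bd.add (hf : Bd f) (hg : Bd g) : Bd (fun x => f x + g x) := SC.add hf hg
lemma Bd.sub (hf : Bd f) (hg : Bd g) : Bd (fun x => f x - g x) := SC.sub hf hg
lemma Bd.mul (hf : Bd f) (hg : Bd g) : Bd (fun x => f x * g x) := (SC.mul hf hg).congrA (by simp)
lemma Bd.const (c : ℝ) : Bd (fun _ : Fin n → ℝ => c) := SC.const c
lemma Bd.cmul (c : ℝ) (hf : Bd f) : Bd (fun x => c * f x) := SC.const_mul c hf
lemma Bd.sum {ι : Type*} (s : Finset ι) {F : ι → (Fin n → ℝ) → ℝ} (h : ∀ j ∈ s, Bd (F j)) : Bd (fun x => ∑ j ∈ s, F j x) :=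
  SC.sum s h
lemma Bd.congr (hf : Bd f) (h : ∀ x, f x = g x) : Bd g := SC.congr hf (fun _ => h)
lemma Bd.co (hf : Bd f) : CO (P := Unit) (fun _ => 1) (fun _ => 1) (fun _ => f) :=
  ⟨hf, fun j => (SC.pd hf j)⟩
lemma Bd.of_co {f : Fam Unit n} (hf : CO (P := Unit) (fun _ => 1) (fun _ => 1) f) : Bd (f ()) :=
  SC.congr hf.1 (fun _ _ => rfl)
lemma ph_smul (lam : ℝ) (ξ x : Fin n → ℝ) : ph (fun i => lam * ξ i) x = lam * ph ξ x := by
  simp only [ph, Finset.mul_sum, mul_assoc]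
lemma Bd.cosph (lam : ℝ) (ξ : Fin n → ℝ) : Bd (fun x => Real.cos (lam * ph ξ x)) :=
  SC.congr (SC.cosph (P := Unit) (lam := fun _ => 1) (by simp) (fun i => lam * ξ i)) (fun p x => by rw [ph_smul, one_mul])
lemma Bd.sinph (lam : ℝ) (ξ : Fin n → ℝ) : Bd (fun x => Real.sin (lam * ph ξ x)) :=
  SC.congr (SC.sinph (P := Unit) (lam := fun _ => 1) (by simp) (fun i => lam * ξ i)) (fun p x => by rw [ph_smul, one_mul])
end bd
end CI

namespace CI
open scoped ContDiff

open Matrix in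
lemma spiral_alg {n d : ℕ} {A θ ν : Fin n → Fin d → ℝ} (un : ∀ i k, A i ⬝ᵥ ν k = 0) (nn : ∀ k l, ν k ⬝ᵥ ν l = if k = l then 1 else 0)
    (ut : ∀ i l, A i ⬝ᵥ θ l = if i = l then 1 else 0) (tn : ∀ l k, θ l ⬝ᵥ ν k = 0) {c s α m : ℝ} (hcs : c ^ 2 + s ^ 2 = 1)
    (ξ : Fin n → ℝ) {k0 k1 : Fin n} (hk : k0 ≠ k1) {w b t : Fin d → ℝ} (hw : w = ∑ l, ξ l • θ l)
    (hm : m ^ 2 * (1 + α ^ 2 * (w ⬝ᵥ w)) = 1) (hb : b = c • ν k0 + s • ν k1) (ht : t = c • ν k1 - s • ν k0)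
    {N : Fin n → Fin d → ℝ} (hN : N = fun k => if k = k0 then b else if k = k1 then m • (t - α • w) else ν k) :
    (∀ i l, (A i + (α * ξ i) • t) ⬝ᵥ θ l = if i = l then 1 else 0) ∧ (∀ i k, (A i + (α * ξ i) • t) ⬝ᵥ N k = 0) ∧
    (∀ k l, N k ⬝ᵥ N l = if k = l then 1 else 0) ∧
    (∀ i j, (A i + (α * ξ i) • t) ⬝ᵥ (A j + (α * ξ j) • t) = A i ⬝ᵥ A j + α ^ 2 * ξ i * ξ j) ∧ t ⬝ᵥ t = 1 ∧ (∀ l, b ⬝ᵥ θ l = 0) ∧ b ⬝ᵥ b = 1 := by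
  have nt : ∀ k l, ν k ⬝ᵥ θ l = 0 := fun k l => by rw [dotProduct_comm]; exact tn l k
  have nu : ∀ k i, ν k ⬝ᵥ A i = 0 := fun k i => by rw [dotProduct_comm]; exact un i k
  have hk' := hk.symm
  have wn : ∀ k, w ⬝ᵥ ν k = 0 := fun k => by rw [hw, sum_dotProduct]; simp [tn]
  have nw : ∀ k, ν k ⬝ᵥ w = 0 := fun k => by rw [dotProduct_comm]; exact wn k
  have Aw : ∀ i, A i ⬝ᵥ w = ξ i := fun i => by rw [hw, dotProduct_sum]; simp [ut]
  have bb : b ⬝ᵥ b = 1 := by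
    rw [hb]; simp [nn, hk, hk']; nlinarith
  have tt : t ⬝ᵥ t = 1 := by
    rw [ht]; simp [sub_dotProduct, dotProduct_sub, nn, hk, hk']; nlinarith
  have bt : b ⬝ᵥ t = 0 := by
    rw [ht, hb]; simp [dotProduct_sub, nn, hk, hk']; ring
  have tb : t ⬝ᵥ b = 0 := by rw [dotProduct_comm]; exact bt
  have bw : b ⬝ᵥ w = 0 := by rw [hb]; simp [nw]
  have wb : w ⬝ᵥ b = 0 := by rw [dotProduct_comm]; exact bw
  have tw : t ⬝ᵥ w = 0 := by rw [ht]; simp [sub_dotProduct, nw]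
  have wt : w ⬝ᵥ t = 0 := by rw [dotProduct_comm]; exact tw
  have tθ : ∀ l, t ⬝ᵥ θ l = 0 := fun l => by rw [ht]; simp [sub_dotProduct, nt]
  have tA : ∀ l, t ⬝ᵥ A l = 0 := fun l => by rw [ht]; simp [sub_dotProduct, nu]
  have At : ∀ l, A l ⬝ᵥ t = 0 := fun l => by rw [dotProduct_comm]; exact tA l
  have Ab : ∀ l, A l ⬝ᵥ b = 0 := fun l => by rw [hb]; simp [un]
  have nb : ∀ k, k ≠ k0 → k ≠ k1 → ν k ⬝ᵥ b = 0 := fun k h1 h2 => by rw [hb]; simp [nn, h1, h2]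
  have bn : ∀ k, k ≠ k0 → k ≠ k1 → b ⬝ᵥ ν k = 0 := fun k h1 h2 => by rw [dotProduct_comm]; exact nb k h1 h2
  have nt' : ∀ k, k ≠ k0 → k ≠ k1 → ν k ⬝ᵥ t = 0 := fun k h1 h2 => by rw [ht]; simp [dotProduct_sub, nn, h1, h2]
  have tn' : ∀ k, k ≠ k0 → k ≠ k1 → t ⬝ᵥ ν k = 0 := fun k h1 h2 => by rw [dotProduct_comm]; exact nt' k h1 h2
  refine ⟨fun i l => ?_, fun i k => ?_, fun k l => ?_, fun i j => ?_, tt, fun l => ?_, bb⟩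
  · simp [tθ, ut]
  · rw [hN]
    by_cases h0 : k = k0
    · simp [h0, Ab, tb]
    by_cases h1 : k = k1
    · simp [h1, hk', dotProduct_sub, At, Aw, tt, tw]
    · simp [h0, h1, un, tn' k h0 h1]
  · rw [hN]
    by_cases h0 : k = k0
    · by_cases l0 : l = k0
      · simp [h0, l0, bb]
      by_cases l1 : l = k1
      · simp [h0, l1, hk', hk, dotProduct_sub, bt, bw]
      · simp [h0, l0, l1, bn l l0 l1, Ne.symm l0]
    by_cases h1 : k = k1
    · by_cases l0 : l = k0
      · simp [h1, l0, hk', sub_dotProduct, tb, wb]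
      by_cases l1 : l = k1
      · simp [h1, l1, hk', sub_dotProduct, dotProduct_sub, tt, tw, wt]
        linarith
      · simp [h1, l0, l1, Ne.symm l1, hk', sub_dotProduct, tn' l l0 l1, wn]
    · by_cases l0 : l = k0
      · simp [h0, h1, l0, nb k h0 h1]
      by_cases l1 : l = k1
      · simp [h0, h1, l1, hk', dotProduct_sub, nt' k h0 h1, nw]
      · simp [h0, h1, l0, l1, nn]
  · simp [At, tA, tt]; ring
  · rw [hb]; simp [nt]

/-- Initial-type states. -/
structure In {n d : ℕ} (u : Fin d → (Fin n → ℝ) → ℝ) (ν θ : Fin n → Fin d → (Fin n → ℝ) → ℝ) : Prop where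
  us : ∀ a, Smo (u a)
  ub : ∀ i a, Bd (pder i (u a))
  nb : ∀ k a, Bd (ν k a)
  tb : ∀ k a, Bd (θ k a)
  un : ∀ x i k, ∑ a, pder i (u a) x * ν k a x = 0
  nn : ∀ x k l, ∑ a, ν k a x * ν l a x = if k = l then 1 else 0
  ut : ∀ x i l, ∑ a, pder i (u a) x * θ l a x = if i = l then 1 else 0
  tn : ∀ x l k, ∑ a, θ l a x * ν k a x = 0

lemma ev_small (C : ℝ) {t : ℝ} (ht : 0 < t) : ∀ᶠ lam : ℝ in Filter.atTop, C * (1 / lam) ≤ t := by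
  have : Filter.Tendsto (fun lam : ℝ => C * (1 / lam)) Filter.atTop (nhds (C * 0)) := by
    simpa using (tendsto_inv_atTop_zero (𝕜 := ℝ)).const_mul C
  rw [mul_zero] at this
  exact ((tendsto_order.1 this).2 t ht).mono fun _ h => h.le

lemma Bd.bd2 {n m d : ℕ} {F : Fin m → Fin d → (Fin n → ℝ) → ℝ} (h : ∀ i a, Bd (F i a)) : ∃ C : ℝ, 0 ≤ C ∧ ∀ i a x, |F i a x| ≤ C := by
  choose C c0 hC using fun i a => (h i a).bd
  refine ⟨∑ i, ∑ a, C i a, Finset.sum_nonneg fun i _ => Finset.sum_nonneg fun a _ => c0 i a, fun i a x => (hC i a x).trans ?_⟩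
  refine (Finset.single_le_sum (f := fun a => C i a) (fun a _ => c0 i a) (Finset.mem_univ a)).trans ?_
  exact Finset.single_le_sum (f := fun i => ∑ a, C i a) (fun i _ => Finset.sum_nonneg fun a _ => c0 i a) (Finset.mem_univ i)
end CI

namespace CI
open scoped ContDiff

lemma Bd.bd1 {n m : ℕ} {F : Fin m → (Fin n → ℝ) → ℝ} (h : ∀ i, Bd (F i)) : ∃ C : ℝ, 0 ≤ C ∧ ∀ i x, |F i x| ≤ C := by
  obtain ⟨C, c0, hC⟩ := Bd.bd2 (F := fun i (_ : Fin 1) => F i) (fun i _ => h i)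
  exact ⟨C, c0, fun i => hC i 0⟩

lemma Bd.bd3 {n m d e : ℕ} {F : Fin e → Fin m → Fin d → (Fin n → ℝ) → ℝ} (h : ∀ j i a, Bd (F j i a)) :
    ∃ C : ℝ, 0 ≤ C ∧ ∀ j i a x, |F j i a x| ≤ C := by
  choose C c0 hC using fun j => Bd.bd2 (h j)
  refine ⟨∑ j, C j, Finset.sum_nonneg fun i _ => c0 i, fun j i a x => (hC j i a x).trans ?_⟩
  exact Finset.single_le_sum (f := C) (fun a _ => c0 a) (Finset.mem_univ j)

lemma Bd.invsqrt {n : ℕ} {f : (Fin n → ℝ) → ℝ} (hf : Bd f) (h1 : ∀ x, 1 ≤ f x) : Bd (fun x => (√(f x))⁻¹) := by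
  obtain ⟨C, c0, hC⟩ := hf.bd
  refine SC.comp1 (F := fun t => (√t)⁻¹) (a := 1) (b := C) (fun t ht => ?_) hf (fun _ x => ⟨h1 x, (le_abs_self _).trans (hC x)⟩)
  have t0 : t ≠ 0 := by have := ht.1; intro h; rw [h] at this; linarith
  have tp : 0 < t := by have := ht.1; linarith
  exact (Real.contDiffAt_sqrt t0).inv (Real.sqrt_pos.2 tp).ne'

set_option maxHeartbeats 1600000 in
theorem spiral {n d : ℕ} {u : Fin d → (Fin n → ℝ) → ℝ} {ν θ : Fin n → Fin d → (Fin n → ℝ) → ℝ} (S : In u ν θ) {k0 k1 : Fin n}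
    (hk : k0 ≠ k1) (ξ : Fin n → ℝ) {α : (Fin n → ℝ) → ℝ} (hα : Bd α) {K : Set (Fin n → ℝ)} (hK : IsCompact K)
    (inj : Set.InjOn (fun x a => u a x) K) {δ : ℝ} (hδ : 0 < δ) :
    ∃ (u' : Fin d → (Fin n → ℝ) → ℝ) (ν' θ' : Fin n → Fin d → (Fin n → ℝ) → ℝ), In u' ν' θ' ∧ Set.InjOn (fun x a => u' a x) K ∧
      (∀ i j x, |(∑ a, pder i (u' a) x * pder j (u' a) x) - (∑ a, pder i (u a) x * pder j (u a) x) - α x ^ 2 * ξ i * ξ j| ≤ δ) ∧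
      (∀ l x, ∑ a, θ' l a x * θ' l a x ≤ ∑ a, θ l a x * θ l a x + δ) := by
  obtain ⟨Cu, Cu0, hCu⟩ := Bd.bd2 S.ub
  obtain ⟨C2, C20, hC2⟩ := Bd.bd3 (F := fun i j a => pder j (pder i (u a))) (fun i j a => (S.ub i a).pd j)
  obtain ⟨Cn, Cn0, hCn⟩ := Bd.bd3 (F := fun j k a => pder j (ν k a)) (fun j k a => (S.nb k a).pd j)
  obtain ⟨Ct, Ct0, hCt⟩ := Bd.bd2 S.tb
  obtain ⟨Dt, Dt0, hDt⟩ := Bd.bd3 (F := fun j k a => pder j (θ k a)) (fun j k a => (S.tb k a).pd j)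
  obtain ⟨Ca, Ca0, hCa⟩ := hα.bd
  obtain ⟨Da, Da0, hDa⟩ := Bd.bd1 (F := fun i => pder i α) (fun i => hα.pd i)
  obtain ⟨η, η0, hη⟩ := inj_stab S.us hC2 hCt Ct0 C20 S.ut hK inj
  set Cx : ℝ := ∑ i, |ξ i| with hCx
  have Cx0 : 0 ≤ Cx := Finset.sum_nonneg fun _ _ => abs_nonneg _
  have hx : ∀ i, |ξ i| ≤ Cx := fun i => Finset.single_le_sum (f := fun i => |ξ i|) (fun _ _ => abs_nonneg _) (Finset.mem_univ i)
  set C1 : ℝ := Da * 1 + Ca * (1 * Cn + 1 * Cn) with hC1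
  have C10 : 0 ≤ C1 := by positivity
  set C : ℝ := Cu + Ca * Cx * 1 + C1 + Ct + 1 with hC
  have C0 : 0 ≤ C := by positivity
  have C1C : C1 ≤ C := by have : 0 ≤ Ca * Cx * 1 := by positivity
                          linarith
  have CtC : Ct ≤ C := by have : 0 ≤ Ca * Cx * 1 := by positivity
                          linarith
  obtain ⟨t0, t0p, C', C'0, fr⟩ := frame n d C C0
  obtain ⟨lam, hl1, c1, c2, c3, c4, c5⟩ := ((Filter.eventually_ge_atTop (1:ℝ)).and ((ev_small (d * (C * C)) t0p).and
    ((ev_small (d * (3 * C * C)) hδ).and ((ev_small (d * ((2 * C * C' + C' * C' * t0) * (d * (C * C)))) hδ).and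
    ((ev_small Ca η0).and (ev_small (d * (Ca * (n * Dt))) (by norm_num : (0:ℝ) < 1/2))))))).exists
  have lp : 0 < lam := by linarith
  set e : ℝ := 1 / lam with he
  have e0 : 0 ≤ e := by positivity
  have e1 : e ≤ 1 := by rw [he, div_le_one lp]; exact hl1
  have el : e * lam = 1 := by rw [he]; field_simp
  let c : (Fin n → ℝ) → ℝ := fun x => Real.cos (lam * ph ξ x)
  let s : (Fin n → ℝ) → ℝ := fun x => Real.sin (lam * ph ξ x)
  have cB : Bd c := Bd.cosph lam ξ
  have sB : Bd s := Bd.sinph lam ξ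
  have cs : ∀ x, c x ^ 2 + s x ^ 2 = 1 := fun x => by simp only [c, s]; exact Real.cos_sq_add_sin_sq _
  have cl : ∀ x, |c x| ≤ 1 := fun x => Real.abs_cos_le_one _
  have sl : ∀ x, |s x| ≤ 1 := fun x => Real.abs_sin_le_one _
  let b : Fin d → (Fin n → ℝ) → ℝ := fun a x => c x * ν k0 a x + s x * ν k1 a x
  let t : Fin d → (Fin n → ℝ) → ℝ := fun a x => c x * ν k1 a x - s x * ν k0 a x
  have bB : ∀ a, Bd (b a) := fun a => (cB.mul (S.nb _ a)).add (sB.mul (S.nb _ a))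
  have tB : ∀ a, Bd (t a) := fun a => (cB.mul (S.nb _ a)).sub (sB.mul (S.nb _ a))
  let w : Fin d → (Fin n → ℝ) → ℝ := fun a x => ∑ l, ξ l * θ l a x
  have wB : ∀ a, Bd (w a) := fun a => Bd.sum _ fun l _ => (S.tb l a).cmul _
  let f : (Fin n → ℝ) → ℝ := fun x => 1 + α x * α x * ∑ a, w a x * w a x
  have fB : Bd f := (Bd.const 1).add ((hα.mul hα).mul (Bd.sum _ fun a _ => (wB a).mul (wB a)))
  have f1 : ∀ x, 1 ≤ f x := fun x => by
    have : 0 ≤ ∑ a, w a x * w a x := Finset.sum_nonneg fun _ _ => mul_self_nonneg _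
    have := mul_nonneg (mul_self_nonneg (α x)) this
    simp only [f]; linarith
  let m : (Fin n → ℝ) → ℝ := fun x => (√(f x))⁻¹
  have mB : Bd m := fB.invsqrt f1
  let N : Fin n → Fin d → (Fin n → ℝ) → ℝ := fun k a x => if k = k0 then b a x else if k = k1 then m x * (t a x - α x * w a x) else ν k a x
  have NB : ∀ k a, Bd (N k a) := fun k a => by
    simp only [N]
    by_cases h0 : k = k0
    · simpa [h0] using bB a
    by_cases h1 : k = k1
    · simpa [h1, hk.symm] using mB.mul ((tB a).sub (hα.mul (wB a)))
    · simpa [h0, h1] using S.nb k a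
  have alg := fun x => spiral_alg (A := fun i a => pder i (u a) x) (θ := fun i a => θ i a x) (ν := fun i a => ν i a x)
    (S.un x) (S.nn x) (S.ut x) (S.tn x) (c := c x) (s := s x) (α := α x) (m := m x) (cs x) ξ hk (w := fun a => w a x) (b := fun a => b a x)
    (t := fun a => t a x) (by funext a; simp [w]) (by
      change m x ^ 2 * (1 + α x ^ 2 * (∑ a, w a x * w a x)) = 1
      have : 1 + α x ^ 2 * (∑ a, w a x * w a x) = f x := by simp only [f]; ring
      rw [this]; simp only [m]
      rw [inv_pow, Real.sq_sqrt (by linarith [f1 x]), inv_mul_cancel₀ (by linarith [f1 x])]) rfl rfl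
    (N := fun i a => N i a x) (by
      funext k a
      simp only [N]
      split_ifs <;> rfl)
  have g1 : ∀ x i l, ∑ a, (pder i (u a) x + α x * ξ i * t a x) * θ l a x = if i = l then 1 else 0 := fun x => (alg x).1
  have g2 : ∀ x i k, ∑ a, (pder i (u a) x + α x * ξ i * t a x) * N k a x = 0 := fun x => (alg x).2.1
  have g3 : ∀ x k l, ∑ a, N k a x * N l a x = if k = l then 1 else 0 := fun x => (alg x).2.2.1
  have g4 : ∀ x i j, ∑ a, (pder i (u a) x + α x * ξ i * t a x) * (pder j (u a) x + α x * ξ j * t a x) =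
    (∑ a, pder i (u a) x * pder j (u a) x) + α x ^ 2 * ξ i * ξ j := fun x => (alg x).2.2.2.1
  have g5 : ∀ x, ∑ a, t a x * t a x = 1 := fun x => (alg x).2.2.2.2.1
  have g6 : ∀ x l, ∑ a, b a x * θ l a x = 0 := fun x => (alg x).2.2.2.2.2.1
  have g7 : ∀ x, ∑ a, b a x * b a x = 1 := fun x => (alg x).2.2.2.2.2.2
  have bl : ∀ a x, |b a x| ≤ 1 := fun a x => abs_le_one_of_unit (v := fun a => b a x) (g7 x) a
  have tl : ∀ a x, |t a x| ≤ 1 := fun a x => abs_le_one_of_unit (v := fun a => t a x) (g5 x) a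
  have Nl : ∀ k a x, |N k a x| ≤ 1 := fun k a x => abs_le_one_of_unit (v := fun a => N k a x) (by simpa using g3 x k k) a
  let u' : Fin d → (Fin n → ℝ) → ℝ := fun a x => u a x + e * (α x * b a x)
  have us' : ∀ a, Smo (u' a) := fun a => (S.us a).add (contDiff_const.mul (hα.mul (bB a)).smo)
  let E : Fin n → Fin d → (Fin n → ℝ) → ℝ := fun i a x => pder i α x * b a x + α x * (c x * pder i (ν k0 a) x + s x * pder i (ν k1 a) x)
  have El : ∀ i a x, |E i a x| ≤ C1 := fun i a x => by
    refine (abs_add_le _ _).trans (add_le_add (abs_mul_le' (hDa i x) (bl a x)) (abs_mul_le' (hCa x) ?_))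
    exact (abs_add_le _ _).trans (add_le_add (abs_mul_le' (cl x) (hCn i k0 a x)) (abs_mul_le' (sl x) (hCn i k1 a x)))
  have pu : ∀ i a x, pder i (u' a) x = pder i (u a) x + α x * ξ i * t a x + e * E i a x := by
    intro i a x
    have p1 : pder i (b a) = fun x => (lam * ξ i) * t a x + (c x * pder i (ν k0 a) x + s x * pder i (ν k1 a) x) := by
      simp only [b]
      rw [pder_add (cB.mul (S.nb _ a)).smo (sB.mul (S.nb _ a)).smo, pder_mul cB.smo (S.nb _ a).smo, pder_mul sB.smo (S.nb _ a).smo]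
      simp only [c, s, pder_cos, pder_sin, t]
      funext x; ring
    simp only [u']
    rw [pder_add (S.us a) (contDiff_const.mul (hα.mul (bB a)).smo), pder_const_mul _ (hα.mul (bB a)).smo, pder_mul hα.smo (bB a).smo, p1]
    simp only [E]
    linear_combination (α x * ξ i * t a x) * el
  have ub' : ∀ i a, Bd (pder i (u' a)) := fun i a =>
    (((S.ub i a).add ((hα.mul (Bd.const (ξ i))).mul (tB a))).add (Bd.cmul e (((hα.pd i).mul (bB a)).add
      (hα.mul ((cB.mul ((S.nb k0 a).pd i)).add (sB.mul ((S.nb k1 a).pd i))))))).congr (fun x => (pu i a x).symm)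
  have A0l : ∀ i a x, |pder i (u a) x + α x * ξ i * t a x| ≤ Cu + Ca * Cx * 1 := fun i a x =>
    (abs_add_le _ _).trans (add_le_add (hCu i a x) (abs_mul_le' (abs_mul_le' (hCa x) (hx i)) (tl a x)))
  have eEl : ∀ i a x, |e * E i a x| ≤ e * C1 := fun i a x => abs_mul_le' (by rw [abs_of_nonneg e0]) (El i a x)
  have eC1 : e * C1 ≤ C1 := by nlinarith
  have Al : ∀ i a x, |pder i (u' a) x| ≤ C := fun i a x => by
    rw [pu]
    refine (abs_add_le _ _).trans ((add_le_add (A0l i a x) (eEl i a x)).trans ?_)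
    linarith
  have C1l : 1 ≤ C := by have : 0 ≤ Ca * Cx * 1 := by positivity
                         linarith
  have tval : ∀ {X : Fin d → ℝ} {c0 : ℝ} i x, (∀ a, |X a| ≤ C) → (∑ a, (pder i (u a) x + α x * ξ i * t a x) * X a = c0) →
      |(∑ a, pder i (u' a) x * X a) - c0| ≤ d * (C * C) * e := by
    intro X c0 i x hX h
    rw [← h, ← Finset.sum_sub_distrib]
    refine (abs_sum_le' (c := (e * C1) * C) fun a => ?_).trans ?_
    · rw [pu, ← sub_mul, add_sub_cancel_left]
      exact abs_mul_le' (eEl i a x) (hX a)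
    · have : (d:ℝ) * ((e * C1) * C) = d * (C1 * C) * e := by ring
      rw [this]
      gcongr
  obtain ⟨ν', θ', hν, hθ, r1, r2, r3, r4, r5⟩ := fr (P := Unit) (s := fun _ => 1) (μ := fun _ => 1) (t := fun _ => d * (C * C) * e)
    (A := fun i a _ => pder i (u' a)) (N := fun i a _ => N i a) (T := fun i a _ => θ i a) (fun i a => (ub' i a).co) (fun i a => (NB i a).co)
    (fun i a => (S.tb i a).co) (fun i a _ => Al i a) (fun i a _ x => (Nl i a x).trans C1l) (fun i a _ x => (hCt i a x).trans CtC)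
    (fun _ => c1) (fun _ x i l => tval i x (fun a => (hCt l a x).trans CtC) (g1 x i l))
    (fun _ x i k => by simpa using tval i x (fun a => (Nl k a x).trans C1l) (g2 x i k))
    (fun _ x k l => by rw [g3, sub_self, abs_zero]; positivity)
  have hν' : ∀ k a, Bd (ν' k a ()) := fun k a => Bd.of_co (hν k a)
  have hθ' : ∀ k a, Bd (θ' k a ()) := fun k a => Bd.of_co (hθ k a)
  let Θ : Fin n → Fin d → (Fin n → ℝ) → ℝ := fun l a x => θ' l a () x - ∑ k, (∑ a', θ' l a' () x * ν' k a' () x) * ν' k a () x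
  have z1 : ∀ (X : Fin d → ℝ) l x, ∑ a, X a * Θ l a x = (∑ a, X a * θ' l a () x) - ∑ k, (∑ a', θ' l a' () x * ν' k a' () x) * ∑ a, X a * ν' k a () x := by
    intro X l x
    simp only [Θ, mul_sub, Finset.sum_sub_distrib, Finset.mul_sum]
    congr 1
    rw [Finset.sum_comm]
    exact Finset.sum_congr rfl fun k _ => Finset.sum_congr rfl fun a _ => by ring
  have z2 : ∀ x l k, ∑ a, Θ l a x * ν' k a () x = 0 := fun x l k => by
    have := z1 (fun a => ν' k a () x) l x
    simp only [r2 () x k] at this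
    simp only [mul_ite, mul_one, mul_zero, Finset.sum_ite_eq, Finset.mem_univ, if_true] at this
    have h3 : ∑ a, Θ l a x * ν' k a () x = ∑ a, ν' k a () x * Θ l a x := Finset.sum_congr rfl fun a _ => mul_comm _ _
    rw [h3, this, sub_eq_zero]
    exact Finset.sum_congr rfl fun a _ => mul_comm _ _
  refine ⟨u', fun k a => ν' k a (), Θ, ⟨us', ub', hν', fun l a => (hθ' l a).sub (Bd.sum _ fun k _ => (Bd.sum _ fun a' _ =>
    (hθ' l a').mul (hν' k a')).mul (hν' k a)), r1 (), r2 (), fun x i l => ?_, z2⟩, ?_, fun i j x => ?_, fun l x => ?_⟩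
  · rw [z1 (fun a => pder i (u' a) x)]
    simp [r1 () x i, r3 () x i l]
  · refine hη u' (fun a x _ => ?_) (fun l x _ y _ => ?_)
    · simp only [u', add_sub_cancel_left]
      refine (abs_mul_le' (le_of_eq (abs_of_nonneg e0)) (abs_mul_le' (hCa x) (bl a x))).trans ?_
      calc e * (Ca * 1) = Ca * e := by ring
        _ ≤ η := c4
    · have : ∑ a, (u' a x - u a x - (u' a y - u a y)) * θ l a y = ∑ a, e * (α x * b a x) * (θ l a y - θ l a x) := by
        have h1 : ∑ a, (u' a x - u a x - (u' a y - u a y)) * θ l a y - ∑ a, e * (α x * b a x) * (θ l a y - θ l a x) =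
            e * α x * ∑ a, b a x * θ l a x - e * α y * ∑ a, b a y * θ l a y := by
          simp only [Finset.mul_sum]
          rw [← Finset.sum_sub_distrib, ← Finset.sum_sub_distrib]
          exact Finset.sum_congr rfl fun a _ => by simp only [u']; ring
        rw [g6, g6] at h1
        linarith
      rw [this]
      refine (abs_sum_le' fun a => abs_mul_le' (abs_mul_le' (le_of_eq (abs_of_nonneg e0)) (abs_mul_le' (hCa x) (bl a x)))
        (lip_of_pder ((S.tb l a).smo.differentiable (by simp)) (fun j => hDt j l a) y x)).trans ?_
      rw [norm_sub_rev]
      calc (d:ℝ) * (e * (Ca * 1) * (n * Dt * ‖x - y‖)) = (d * (Ca * (n * Dt)) * e) * ‖x - y‖ := by ring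
        _ ≤ _ := mul_le_mul_of_nonneg_right c5 (norm_nonneg _)
  · rw [sub_sub, ← g4 x i j, ← Finset.sum_sub_distrib]
    refine (abs_sum_le' (c := (e * C1) * C + C * (e * C1)) fun a => ?_).trans ?_
    · have : pder i (u' a) x * pder j (u' a) x - (pder i (u a) x + α x * ξ i * t a x) * (pder j (u a) x + α x * ξ j * t a x) =
        e * E i a x * pder j (u' a) x + (pder i (u a) x + α x * ξ i * t a x) * (e * E j a x) := by
        rw [pu i, pu j]; ring
      rw [this]
      refine (abs_add_le _ _).trans (add_le_add (abs_mul_le' (eEl i a x) (Al j a x)) (abs_mul_le' ((A0l i a x).trans ?_) (eEl j a x)))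
      linarith
    · refine le_trans ?_ c2
      have h1 : C1 * C ≤ C * C := by gcongr
      have : (d:ℝ) * ((e * C1) * C + C * (e * C1)) = d * (2 * (C1 * C)) * e := by ring
      rw [this]
      have h0 := mul_nonneg C0 C0
      have h2 : 2 * (C1 * C) ≤ 3 * C * C := by linarith
      exact mul_le_mul_of_nonneg_right (mul_le_mul_of_nonneg_left h2 (Nat.cast_nonneg d)) e0
  · have h1 : ∑ a, Θ l a x * Θ l a x ≤ ∑ a, θ' l a () x * θ' l a () x := by
      rw [z1 (fun a => Θ l a x)]
      simp only [z2 x l, mul_zero, Finset.sum_const_zero, sub_zero]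
      have : ∑ a, Θ l a x * θ' l a () x = ∑ a, θ' l a () x * Θ l a x := Finset.sum_congr rfl fun a _ => mul_comm _ _
      rw [this, z1 (fun a => θ' l a () x)]
      have : 0 ≤ ∑ k, (∑ a', θ' l a' () x * ν' k a' () x) * ∑ a, θ' l a () x * ν' k a () x :=
        Finset.sum_nonneg fun _ _ => mul_self_nonneg _
      linarith
    refine h1.trans ?_
    set T : ℝ := d * (C * C) * e with hT
    have T0 : 0 ≤ T := by positivity
    have h2 : |∑ a, θ' l a () x * θ' l a () x - ∑ a, θ l a x * θ l a x| ≤ d * ((2 * C + C' * T) * (C' * T)) := by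
      rw [← Finset.sum_sub_distrib]
      refine abs_sum_le' fun a => ?_
      have h3 := r5 l a () x
      have h4 := (hCt l a x).trans CtC
      have : θ' l a () x * θ' l a () x - θ l a x * θ l a x = (2 * θ l a x + (θ' l a () x - θ l a x)) * (θ' l a () x - θ l a x) := by ring
      rw [this]
      refine abs_mul_le' ((abs_add_le _ _).trans (add_le_add ?_ h3)) h3
      rw [abs_mul, abs_two]; linarith
    have h5 : d * ((2 * C + C' * T) * (C' * T)) ≤ δ := by
      refine le_trans ?_ c3
      have : (d:ℝ) * ((2 * C * C' + C' * C' * t0) * (d * (C * C))) * e = d * ((2 * C + C' * t0) * (C' * T)) := by rw [hT]; ring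
      rw [this]
      gcongr
    have := (abs_le.1 (h2.trans h5)).2
    linarith
end CI

namespace CI
open scoped ContDiff

theorem spirals {n d : ℕ} {k0 k1 : Fin n} (hk : k0 ≠ k1) {K : Set (Fin n → ℝ)} (hK : IsCompact K) {ι : Type} (I : Finset ι)
    {α : ι → (Fin n → ℝ) → ℝ} (hα : ∀ p, Bd (α p)) (ξ : ι → Fin n → ℝ)
    {u : Fin d → (Fin n → ℝ) → ℝ} {ν θ : Fin n → Fin d → (Fin n → ℝ) → ℝ} (S : In u ν θ) 
    (inj : Set.InjOn (fun x a => u a x) K) {δ : ℝ} (hδ : 0 < δ) :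
    ∃ (u' : Fin d → (Fin n → ℝ) → ℝ) (ν' θ' : Fin n → Fin d → (Fin n → ℝ) → ℝ), In u' ν' θ' ∧ Set.InjOn (fun x a => u' a x) K ∧
      (∀ i j x, |(∑ a, pder i (u' a) x * pder j (u' a) x) - (∑ a, pder i (u a) x * pder j (u a) x) - ∑ p ∈ I, α p x ^ 2 * ξ p i * ξ p j| ≤ δ) ∧
      (∀ l x, ∑ a, θ' l a x * θ' l a x ≤ ∑ a, θ l a x * θ l a x + δ) := by
  classical
  induction I using Finset.induction_on generalizing δ with
  | empty => exact ⟨u, ν, θ, S, inj, fun i j x => by simpa using hδ.le, fun l x => by linarith⟩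
  | insert p I hp ih =>
    obtain ⟨u1, ν1, θ1, S1, j1, h1, t1⟩ := ih (half_pos hδ)
    obtain ⟨u2, ν2, θ2, S2, j2, h2, t2⟩ := spiral S1 hk (ξ p) (hα p) hK j1 (half_pos hδ)
    refine ⟨u2, ν2, θ2, S2, j2, fun i j x => ?_, fun l x => by linarith [t1 l x, t2 l x]⟩
    rw [Finset.sum_insert hp]
    have := abs_add_le _ _ |>.trans (add_le_add (h1 i j x) (h2 i j x))
    rw [add_halves] at this
    refine le_trans (le_of_eq ?_) this
    congr 1; ring

lemma decompose {n : ℕ} {Q : Fin n → Fin n → (Fin n → ℝ) → ℝ} (hQ : ∀ i j, Bd (Q i j))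
    (hp : ∀ x, ∃ (m : ℕ) (B : Fin m → Fin n → ℝ), ∀ i j, Q i j x = ∑ k, B k i * B k j) {δ : ℝ} (hδ : 0 < δ) :
    ∃ (ι : Type) (I : Finset ι) (α : ι → (Fin n → ℝ) → ℝ) (ξ : ι → Fin n → ℝ), (∀ p, Bd (α p)) ∧
      ∀ i j x, |Q i j x - ∑ p ∈ I, α p x ^ 2 * ξ p i * ξ p j| ≤ δ := by
  classical
  let q : (Fin n → ℝ) → (Fin n × Fin n → ℝ) := fun x z => Q z.1 z.2 x
  obtain ⟨C, c0, hC⟩ := Bd.bd2 hQ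
  have rb : Set.range q ⊆ Metric.closedBall 0 C := by
    rintro _ ⟨x, rfl⟩
    rw [mem_closedBall_zero_iff, pi_norm_le_iff_of_nonneg c0]
    exact fun z => hC z.1 z.2 x
  have tb : TotallyBounded (Set.range q) := (isCompact_closedBall (0 : Fin n × Fin n → ℝ) C).totallyBounded.subset rb
  obtain ⟨t, ht, tf, tc⟩ := Metric.finite_approx_of_totallyBounded tb (δ/2) (half_pos hδ)
  have : ∀ y : Fin n × Fin n → ℝ, y ∈ t → ∃ (m : ℕ) (B : Fin m → Fin n → ℝ), ∀ i j, y (i, j) = ∑ k, B k i * B k j := by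
    intro y hy
    obtain ⟨x, rfl⟩ := ht hy
    exact hp x
  choose! m B hB using this
  let bump : ∀ y : Fin n × Fin n → ℝ, ContDiffBump y := fun y => ⟨δ/2, δ, half_pos hδ, by linarith⟩
  let W : (Fin n × Fin n → ℝ) → ℝ := fun z => ∑ y ∈ tf.toFinset, bump y z * bump y z
  have Ws : ContDiff ℝ ∞ W := ContDiff.sum fun y _ => (bump y).contDiff.mul (bump y).contDiff
  have Kc : IsCompact (closure (Set.range q)) := tb.closure.isCompact_of_isClosed isClosed_closure
  have W1 : ∀ z ∈ closure (Set.range q), 1 ≤ W z := by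
    intro z hz
    refine closure_minimal (s := Set.range q) (t := {z | 1 ≤ W z}) ?_ (isClosed_le continuous_const Ws.continuous) hz
    intro z hz
    obtain ⟨y, hy, hyz⟩ := Set.mem_iUnion₂.1 (tc hz)
    have h1 : bump y z = 1 := (bump y).one_of_mem_closedBall (Metric.ball_subset_closedBall hyz)
    have := Finset.single_le_sum (f := fun y => bump y z * bump y z) (fun y _ => mul_self_nonneg _) (tf.mem_toFinset.2 hy)
    simp only [h1, mul_one] at this
    exact this
  let β : (Fin n × Fin n → ℝ) → (Fin n → ℝ) → ℝ := fun y x => bump y (q x) * (√(W (q x)))⁻¹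
  have βB : ∀ y, Bd (β y) := fun y => by
    refine SC.comp (P := Unit) Kc (F := fun z => bump y z * (√(W z))⁻¹) (fun z hz => ?_) (φ := fun z _ => Q z.1 z.2)
      (fun z => hQ z.1 z.2) (fun _ x => subset_closure ⟨x, rfl⟩)
    have wp : 0 < W z := by linarith [W1 z hz]
    exact (bump y).contDiffAt.mul ((Ws.contDiffAt.sqrt wp.ne').inv (Real.sqrt_pos.2 wp).ne')
  have W1' : ∀ x, 1 ≤ W (q x) := fun x => W1 _ (subset_closure ⟨x, rfl⟩)
  have βs : ∀ x, ∑ y ∈ tf.toFinset, β y x ^ 2 = 1 := fun x => by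
    have wp : 0 < W (q x) := by linarith [W1' x]
    have : ∀ y, β y x ^ 2 = bump y (q x) * bump y (q x) * (W (q x))⁻¹ := fun y => by
      simp only [β]; rw [mul_pow, inv_pow, Real.sq_sqrt wp.le, sq]
    simp only [this]
    rw [← Finset.sum_mul]
    exact mul_inv_cancel₀ wp.ne'
  refine ⟨Σ y : (Fin n × Fin n → ℝ), Fin (m y), tf.toFinset.sigma fun y => Finset.univ, fun p => β p.1, fun p => B p.1 p.2,
    fun p => βB p.1, fun i j x => ?_⟩
  rw [Finset.sum_sigma]
  have e1 : ∑ y ∈ tf.toFinset, ∑ k : Fin (m y), β y x ^ 2 * B y k i * B y k j = ∑ y ∈ tf.toFinset, β y x ^ 2 * y (i, j) := by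
    refine Finset.sum_congr rfl fun y hy => ?_
    rw [hB y (tf.mem_toFinset.1 hy), Finset.mul_sum]
    exact Finset.sum_congr rfl fun k _ => by ring
  rw [e1]
  have e2 : Q i j x = ∑ y ∈ tf.toFinset, β y x ^ 2 * Q i j x := by rw [← Finset.sum_mul, βs, one_mul]
  rw [e2, ← Finset.sum_sub_distrib]
  calc _ ≤ ∑ y ∈ tf.toFinset, |β y x ^ 2 * Q i j x - β y x ^ 2 * y (i, j)| := Finset.abs_sum_le_sum_abs _ _
    _ ≤ ∑ y ∈ tf.toFinset, β y x ^ 2 * δ := by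
      refine Finset.sum_le_sum fun y _ => ?_
      rw [← mul_sub, abs_mul, abs_of_nonneg (sq_nonneg _)]
      by_cases h : dist (q x) y < δ
      · refine mul_le_mul_of_nonneg_left ?_ (sq_nonneg _)
        exact (dist_le_pi_dist (q x) y (i, j)).trans h.le
      · have : bump y (q x) = 0 := (bump y).zero_of_le_dist (not_lt.1 h)
        simp [β, this]
    _ = δ := by rw [← Finset.sum_mul, βs, one_mul]
end CI

namespace CI
open scoped ContDiff

lemma SO.unit {n k : ℕ} {μ A : Unit → ℝ} {f : Fam Unit n} (hf : SO (fun _ => Set.univ) μ k A f) :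
    SO (fun _ => Set.univ) (fun _ => 1) k (fun _ => 1) f := by
  have key : ∀ {A : Unit → ℝ} {f : Fam Unit n}, (∃ C : ℝ, ∀ p, ∀ x ∈ (Set.univ : Set (Fin n → ℝ)), |f p x| ≤ C * A p) →
      (∃ C : ℝ, ∀ p, ∀ x ∈ (Set.univ : Set (Fin n → ℝ)), |f p x| ≤ C * 1) := by
    rintro A f ⟨C, hC⟩
    exact ⟨C * A (), fun p x hx => by simpa using hC p x hx⟩
  induction k generalizing A f with
  | zero => exact key hf
  | succ k ih =>
    refine ⟨key hf.1, fun i => ?_⟩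
    have := ih (hf.2 i)
    simpa using this

lemma Bd.mol {n : ℕ} {ψ : (Fin n → ℝ) → ℝ} (h : Ker ψ) {l B : ℝ} (hl : 0 < l) {f : (Fin n → ℝ) → ℝ} (hf : Continuous f)
    (hB : ∀ x, |f x| ≤ B) : Bd (mol ψ l f) := by
  have := SC.mol (P := Unit) (l := fun _ => l) (f := fun _ => f) (A := fun _ => 1) (c := B) h (fun _ => hl) (fun _ => hf)
    (fun _ x => by simpa using hB x)
  exact ⟨this.1, fun k => SO.unit (this.2 k)⟩

lemma init0 {n d : ℕ} (lo hi : Fin n → Fin d) (hlo : Function.Injective lo) (hhi : Function.Injective hi)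
    (hne : ∀ i k, lo i ≠ hi k) {c : ℝ} (hc : 0 < c) :
    ∃ (u : Fin d → (Fin n → ℝ) → ℝ) (ν θ : Fin n → Fin d → (Fin n → ℝ) → ℝ), In u ν θ ∧
      (∀ K, Set.InjOn (fun x a => u a x) K) ∧
      (∀ i j x, (∑ a, pder i (u a) x * pder j (u a) x) = if i = j then c ^ 2 else 0) ∧
      (∀ l x, ∑ a, θ l a x * θ l a x = 1 / c ^ 2) := by
  let u : Fin d → (Fin n → ℝ) → ℝ := fun a => ph (fun i => if lo i = a then c else 0)
  have pu : ∀ i a, pder i (u a) = fun _ => if lo i = a then c else 0 := by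
    intro i a
    funext x
    simp only [u, pder, (hasFDerivAt_ph _ x).fderiv]
    rw [ContinuousLinearMap.sum_apply]
    simp only [ContinuousLinearMap.smul_apply, ContinuousLinearMap.proj_apply, smul_eq_mul, Pi.single_apply, mul_ite, mul_one, mul_zero,
      Finset.sum_ite_eq', Finset.sum_ite_eq, Finset.mem_univ, if_true]
  have us : ∀ a, Smo (u a) := fun a => smo_ph _
  have ne' : ∀ i k, hi k ≠ lo i := fun i k => (hne i k).symm
  refine ⟨u, fun k a _ => if hi k = a then 1 else 0, fun l a _ => if lo l = a then 1 / c else 0,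
    ⟨us, fun i a => ?_, fun k a => Bd.const _, fun k a => Bd.const _, fun x i k => ?_, fun x k l => ?_, fun x i l => ?_, fun x l k => ?_⟩,
    fun K x _ y _ hxy => ?_, fun i j x => ?_, fun l x => ?_⟩
  · rw [pu]; exact Bd.const _
  · simp [pu, hne]
  · simp [hhi.eq_iff, eq_comm]
  · simp [pu, hlo.eq_iff, hc.ne', eq_comm]
  · simp [hne]
  · funext i
    have := congrFun hxy (lo i)
    simp only [u, ph, hlo.eq_iff, ite_mul, zero_mul, Finset.sum_ite_eq', Finset.mem_univ, if_true] at this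
    exact mul_left_cancel₀ hc.ne' this
  · simp [pu, hlo.eq_iff, eq_comm, pow_two]
  · simp [pow_two]

lemma quad_le {n : ℕ} {Z : Fin n → Fin n → ℝ} {δ : ℝ} (hδ : 0 ≤ δ) (h : ∀ i j, |Z i j| ≤ δ) (v : Fin n → ℝ) :
    |∑ i, ∑ j, Z i j * (v i * v j)| ≤ n * δ * ∑ i, v i ^ 2 := by
  have h1 : ∀ i j, |Z i j * (v i * v j)| ≤ δ * ((v i ^ 2 + v j ^ 2) / 2) := by
    intro i j
    refine abs_mul_le' (h i j) ?_
    rw [abs_le]; constructor <;> nlinarith [sq_nonneg (v i + v j), sq_nonneg (v i - v j)]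
  refine (Finset.abs_sum_le_sum_abs _ _).trans ?_
  refine (Finset.sum_le_sum fun i _ => (Finset.abs_sum_le_sum_abs _ _).trans (Finset.sum_le_sum fun j _ => h1 i j)).trans (le_of_eq ?_)
  simp only [← Finset.mul_sum, ← Finset.sum_div, Finset.sum_add_distrib, Finset.sum_const, Finset.card_univ, Fintype.card_fin, nsmul_eq_mul]
  ring

lemma psd_sum {n : ℕ} {Z : Fin n → Fin n → ℝ} (hs : ∀ i j, Z i j = Z j i) (h : ∀ v : Fin n → ℝ, 0 ≤ ∑ i, ∑ j, Z i j * (v i * v j)) :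
    ∃ (m : ℕ) (B : Fin m → Fin n → ℝ), ∀ i j, Z i j = ∑ k, B k i * B k j := by
  have hp : (Matrix.of Z).PosSemidef := by
    rw [Matrix.posSemidef_iff_dotProduct_mulVec]
    refine ⟨?_, fun x => ?_⟩
    · ext i j; simp [hs i j]
    · refine (h x).trans (le_of_eq ?_)
      simp only [dotProduct, Matrix.mulVec, Matrix.of_apply, Finset.mul_sum, Pi.star_apply, star_trivial]
      exact Finset.sum_congr rfl fun i _ => Finset.sum_congr rfl fun j _ => by ring
  obtain ⟨m, v, hv⟩ := Matrix.posSemidef_iff_eq_sum_vecMulVec.1 hp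
  refine ⟨m, v, fun i j => ?_⟩
  have := congrFun (congrFun hv i) j
  simpa [Matrix.sum_apply, Matrix.vecMulVec_apply] using this

theorem init {n d : ℕ} {k0 k1 : Fin n} (hk : k0 ≠ k1) (lo hi : Fin n → Fin d) (hlo : Function.Injective lo) (hhi : Function.Injective hi)
    (hne : ∀ i k, lo i ≠ hi k) {K : Set (Fin n → ℝ)} (hK : IsCompact K)
    (g : Fin n → Fin n → (Fin n → ℝ) → ℝ) (hg : ∀ i j, Continuous (g i j)) (gs : ∀ i j x, g i j x = g j i x)
    {A : ℝ} (hA : 0 ≤ A) (gl : ∀ i j x y, |g i j x - g i j y| ≤ A * ‖x - y‖) {B : ℝ} (hB : 0 ≤ B) (gb : ∀ i j x, |g i j x| ≤ B)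
    {c : ℝ} (hc : 0 < c) (gp : ∀ x (v : Fin n → ℝ), 2 * c ^ 2 * ∑ i, v i ^ 2 ≤ ∑ i, ∑ j, g i j x * (v i * v j))
    (H0 : Fin n → Fin n → ℝ) (Hs : ∀ i j, H0 i j = H0 j i) {σ : ℝ} (hσ : 0 < σ) :
    ∃ s1 > 0, ∀ s, 0 < s → s ≤ s1 → ∃ (u : Fin d → (Fin n → ℝ) → ℝ) (ν θ : Fin n → Fin d → (Fin n → ℝ) → ℝ), In u ν θ ∧
      Set.InjOn (fun x a => u a x) K ∧
      (∀ i j x, |g i j x - (∑ a, pder i (u a) x * pder j (u a) x) - s ^ 2 * H0 i j| ≤ σ / 2 * s ^ 2) ∧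
      (∀ i a x, |pder i (u a) x| ≤ B + 2) ∧ (∀ l a x, |θ l a x| ≤ 1 / c ^ 2 + 2) := by
  obtain ⟨ψ, hψ, ψ0, ψ1⟩ := exists_ker n
  obtain ⟨h, hh⟩ : ∃ h : ℝ, 0 ≤ h ∧ ∀ i j, |H0 i j| ≤ h := by
    obtain ⟨C, c0, hC⟩ := Bd.bd2 (n := n) (F := fun i j _ => H0 i j) (fun i j => Bd.const _)
    exact ⟨C, c0, fun i j => hC i j 0⟩
  obtain ⟨h0, hh⟩ := hh
  set w : ℝ := (σ + h) * (n + 1) with hw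
  have w0 : 0 < w := by positivity
  refine ⟨min 1 (min (c ^ 2 / w) (1 / w)), by positivity, fun s s0 hs => ?_⟩
  have s1 : s ≤ 1 := hs.trans (min_le_left _ _)
  have s2 : s ^ 2 * w ≤ c ^ 2 := by
    have h2 := hs.trans ((min_le_right _ _).trans (min_le_left _ _))
    rw [le_div_iff₀ w0] at h2
    nlinarith
  have s3 : s ^ 2 * w ≤ 1 := by
    have h2 := hs.trans ((min_le_right _ _).trans (min_le_right _ _))
    rw [le_div_iff₀ w0] at h2
    nlinarith
  have s20 : 0 < s ^ 2 := by positivity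
  obtain ⟨l, l0, hl⟩ : ∃ l : ℝ, 0 < l ∧ A * l ≤ σ / 4 * s ^ 2 := by
    refine ⟨σ / 4 * s ^ 2 / (A + 1), by positivity, ?_⟩
    rw [← mul_div_assoc, div_le_iff₀ (by positivity)]
    nlinarith [show 0 < σ / 4 * s ^ 2 by positivity]
  have mc : ∀ i j x, |mol ψ l (g i j) x - g i j x| ≤ σ / 4 * s ^ 2 := fun i j x =>
    (mol_close hψ ψ1 ψ0 l0 (hg i j) hA (gl i j) x).trans hl
  let Q : Fin n → Fin n → (Fin n → ℝ) → ℝ := fun i j x => mol ψ l (g i j) x - s ^ 2 * H0 i j - (if i = j then c ^ 2 else 0)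
  have Qb : ∀ i j, Bd (Q i j) := fun i j => ((Bd.mol hψ l0 (hg i j) (gb i j)).sub (Bd.const _)).sub (Bd.const _)
  have Qp : ∀ x, ∃ (m : ℕ) (B : Fin m → Fin n → ℝ), ∀ i j, Q i j x = ∑ k, B k i * B k j := by
    intro x
    refine psd_sum (fun i j => ?_) (fun v => ?_)
    · simp only [Q, Hs i j, show g i j = g j i from funext (gs i j), eq_comm]
    · have h1 := gp x v
      have h2 := quad_le (Z := fun i j => mol ψ l (g i j) x - g i j x - s ^ 2 * H0 i j) (δ := (σ + h) * s ^ 2) (by positivity)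
        (fun i j => by
          refine (abs_sub _ _).trans ?_
          have e1 := mc i j x
          have e2 : |s ^ 2 * H0 i j| ≤ s ^ 2 * h := by
            rw [abs_mul, abs_of_pos s20]; exact mul_le_mul_of_nonneg_left (hh i j) s20.le
          nlinarith) v
      have e : ∑ i, ∑ j, Q i j x * (v i * v j) = (∑ i, ∑ j, (mol ψ l (g i j) x - g i j x - s ^ 2 * H0 i j) * (v i * v j)) +
          (∑ i, ∑ j, g i j x * (v i * v j)) - c ^ 2 * ∑ i, v i ^ 2 := by
        have e3 : c ^ 2 * ∑ i, v i ^ 2 = ∑ i, ∑ j, (if i = j then c ^ 2 else 0) * (v i * v j) := by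
          simp [Finset.mul_sum, pow_two]
        rw [e3]
        simp only [← Finset.sum_add_distrib, ← Finset.sum_sub_distrib]
        exact Finset.sum_congr rfl fun i _ => Finset.sum_congr rfl fun j _ => by simp only [Q]; ring
      rw [e]
      have h3 := (abs_le.1 h2).1
      have v0 : 0 ≤ ∑ i, v i ^ 2 := Finset.sum_nonneg fun i _ => sq_nonneg _
      have h4 : n * ((σ + h) * s ^ 2) * ∑ i, v i ^ 2 ≤ c ^ 2 * ∑ i, v i ^ 2 := by
        refine mul_le_mul_of_nonneg_right ?_ v0
        refine le_trans ?_ s2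
        rw [hw]
        nlinarith [mul_nonneg (add_nonneg hσ.le h0) s20.le]
      linarith
  obtain ⟨ι, I, α, ξ, hα, hd⟩ := decompose Qb Qp (δ := σ / 8 * s ^ 2) (by positivity)
  obtain ⟨u0, ν0, θ0, S0, j0, m0, t0⟩ := init0 lo hi hlo hhi hne hc
  obtain ⟨u, ν, θ, S, j, m, t⟩ := spirals hk hK I hα ξ S0 (j0 K) (δ := min 1 (σ / 8 * s ^ 2)) (by positivity)
  have er : ∀ i j x, |g i j x - (∑ a, pder i (u a) x * pder j (u a) x) - s ^ 2 * H0 i j| ≤ σ / 2 * s ^ 2 := by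
    intro i j x
    have e1 := abs_le.1 (mc i j x)
    have e2 := abs_le.1 (hd i j x)
    have e3 := abs_le.1 ((m i j x).trans (min_le_right _ _))
    rw [m0] at e3
    simp only [Q] at e2
    rw [abs_le]
    constructor <;> linarith [e1.1, e1.2, e2.1, e2.2, e3.1, e3.2]
  have sqb : ∀ (f : Fin d → ℝ) a {b : ℝ}, 0 ≤ b → ∑ a, f a * f a ≤ b + 1 → |f a| ≤ b + 2 := by
    intro f a b b0 hb
    have h1 : f a * f a ≤ ∑ a, f a * f a := Finset.single_le_sum (f := fun a => f a * f a) (fun a _ => mul_self_nonneg _) (Finset.mem_univ a)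
    exact abs_le_of_sq_le_sq (by nlinarith) (by linarith)
  refine ⟨u, ν, θ, S, j, er, fun i a x => ?_, fun l a x => ?_⟩
  · refine sqb (fun a => pder i (u a) x) a hB ?_
    have e1 := (abs_le.1 (er i i x)).1
    have e2 := (abs_le.1 (gb i i x)).2
    have e3 := (abs_le.1 (hh i i)).1
    have e4 := mul_le_mul_of_nonneg_left e3 s20.le
    have e5 : s ^ 2 * (σ + h) ≤ 1 := by
      refine le_trans ?_ s3
      rw [hw]
      refine mul_le_mul_of_nonneg_left ?_ s20.le
      have : (0:ℝ) ≤ n := Nat.cast_nonneg n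
      nlinarith
    nlinarith
  · refine sqb (fun a => θ l a x) a (by positivity) ?_
    have := t l x
    rw [t0] at this
    linarith [min_le_left 1 (σ / 8 * s ^ 2)]
end CI

namespace CI
open scoped ContDiff

lemma exists_r {N : ℕ} {θ : ℝ} (h1 : θ * (2 * N + 1) < 1) : ∃ r : ℕ, 1 ≤ r ∧ (r + 3 + N * (2 * r + 1) : ℝ) * θ < r := by
  obtain ⟨r, hr⟩ := exists_nat_gt ((3 + N) * |θ| / (1 - θ * (2 * N + 1)))
  have hp : 0 < 1 - θ * (2 * N + 1) := by linarith
  rw [div_lt_iff₀ hp] at hr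
  refine ⟨r + 1, by omega, ?_⟩
  have : (3 + N) * θ ≤ (3 + N) * |θ| := mul_le_mul_of_nonneg_left (le_abs_self _) (by positivity)
  push_cast
  nlinarith

theorem embed {n d N : ℕ} {k0 k1 : Fin n} (hk : k0 ≠ k1) (lo hi : Fin n → Fin d) (hlo : Function.Injective lo) (hhi : Function.Injective hi)
    (hne : ∀ i k, lo i ≠ hi k) {K : Set (Fin n → ℝ)} (hK : IsCompact K) (hn : 2 ≤ n) (hN : n * (n - 1) ≤ 2 * (N * n)) (hN1 : 1 ≤ N)
    (g : Fin n → Fin n → (Fin n → ℝ) → ℝ) (hg : ∀ i j, Continuous (g i j)) (gs : ∀ i j x, g i j x = g j i x)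
    {A : ℝ} (hA : 0 ≤ A) (gl : ∀ i j x y, |g i j x - g i j y| ≤ A * ‖x - y‖) {B : ℝ} (hB : 0 ≤ B) (gb : ∀ i j x, |g i j x| ≤ B)
    {c : ℝ} (hc : 0 < c) (gp : ∀ x (v : Fin n → ℝ), 2 * c ^ 2 * ∑ i, v i ^ 2 ≤ ∑ i, ∑ j, g i j x * (v i * v j))
    {θ : ℝ} (h0 : 0 ≤ θ) (h1 : θ ≤ 1) (hθ : θ * (2 * N + 1) < 1) :
    ∃ v : (Fin n → ℝ) → (Fin d → ℝ), ContDiff ℝ 1 v ∧ (∃ C, ∀ i x y, ‖pder i v x - pder i v y‖ ≤ C * ‖x - y‖ ^ θ) ∧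
      (∀ x i j, ∑ a, pder i v x a * pder j v x a = g i j x) ∧ Set.InjOn v K := by
  obtain ⟨Y⟩ := Dec.nonempty n N hn hN
  obtain ⟨σ, hσ, hY⟩ := Y.sig
  obtain ⟨r, hr, hr2⟩ := exists_r hθ
  set M : ℝ := (B + 2) + (1 / c ^ 2 + 2) + 1 with hM
  have c2 : 0 ≤ 1 / c ^ 2 := by positivity
  have M1 : 1 ≤ M := by rw [hM]; linarith
  obtain ⟨K0, hK0, F⟩ := stage (d := d) Y hσ hY g hg gs hA gl M1 r hr hN1
  set κ := max K0 2 with hκ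
  have κ2 : 2 ≤ κ := le_max_right _ _
  have κ1 : 1 ≤ κ := by linarith
  have κ0 : 0 < κ := by linarith
  have Hs : ∀ i j, Y.H0 i j = Y.H0 j i := by
    intro i j
    rw [Y.hH, Y.hH]
    simp only [eq_comm, mul_comm]
  obtain ⟨s1, s10, hI⟩ := init hk lo hi hlo hhi hne hK g hg gs hA gl hB gb hc gp Y.H0 Hs hσ
  set W : ℝ := κ ^ (2 * r + 1) + κ + 2 * (d * (n * (2 * κ) * M)) with hW
  have W0 : 0 < W := by positivity
  have wa : 0 < κ ^ (2 * r + 1) := by positivity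
  have wb : 0 ≤ 2 * (d * (n * (2 * κ) * M)) := by positivity
  set s := min s1 (1 / W) with hs
  have s0 : 0 < s := by positivity
  have sW : s * W ≤ 1 := by rw [← le_div_iff₀ W0]; exact min_le_right _ _
  have sa : s * κ ^ (2 * r + 1) ≤ 1 := (mul_le_mul_of_nonneg_left (by rw [hW]; linarith) s0.le).trans sW
  have sb : s * κ ≤ 1 := (mul_le_mul_of_nonneg_left (by rw [hW]; linarith) s0.le).trans sW
  have sc : s * (2 * (d * (n * (2 * κ) * M))) ≤ 1 := (mul_le_mul_of_nonneg_left (by rw [hW]; linarith) s0.le).trans sW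
  obtain ⟨u, ν, ϑ, S, inj, er, bu, bt⟩ := hI s s0 (min_le_left _ _)
  obtain ⟨D, D0, hD⟩ := Bd.bd3 (F := fun i j a => pder j (pder i (u a))) (fun i j a => (S.ub i a).pd j)
  obtain ⟨D', D0', hD'⟩ := Bd.bd3 (F := fun j k a => pder j (ν k a)) (fun j k a => (S.nb k a).pd j)
  obtain ⟨D'', D0'', hD''⟩ := Bd.bd3 (F := fun j k a => pder j (ϑ k a)) (fun j k a => (S.tb k a).pd j)
  have tM : ∀ l a x, |ϑ l a x| ≤ M := fun l a x => (bt l a x).trans (by rw [hM]; linarith)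
  obtain ⟨η, η0, hη⟩ := inj_stab S.us (fun i j a x => hD i j a x) tM (by linarith) D0 S.ut hK inj
  have skp : 0 < s * κ ^ r := by positivity
  obtain ⟨lam, lp, l1, l2, l3, l4, l5⟩ := ((Filter.eventually_gt_atTop (0:ℝ)).and ((ev_small D skp).and ((ev_small D' skp).and ((ev_small D'' skp).and
    ((ev_small (κ ^ (2 * r)) (show 0 < s ^ 2 by positivity)).and (ev_small 2 η0)))))).exists
  have conv : ∀ {a b : ℝ}, a * (1 / lam) ≤ b → a ≤ b * lam := by
    intro a b h
    rw [mul_one_div, div_le_iff₀ lp] at h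
    exact h
  have S0 : St Y.H0 g σ M r κ s lam u ν ϑ :=
    ⟨κ1, s0, lp, S.us, fun k a => (S.nb k a).smo, fun k a => (S.tb k a).smo, S.un, S.nn, S.ut,
      fun i a x => (bu i a x).trans (by rw [hM]; linarith), fun l a x => (bt l a x).trans (by rw [hM]; linarith),
      fun i j a x => (hD i j a x).trans (conv l1), fun j k a x => (hD' j k a x).trans (conv l2),
      fun j k a x => (hD'' j k a x).trans (conv l3), er, sa, conv l4⟩
  obtain ⟨v, v1, v2, v3, v4, v5⟩ := iter F hr (le_max_left _ _) κ2 h0 h1 hr2 S0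
  refine ⟨v, v1, v2, v3, ?_⟩
  refine hη (fun a x => v x a) (fun a x _ => (v4 x a).trans (by rw [mul_one_div] at l5; exact l5)) (fun l x _ y _ => ?_)
  have vd : Differentiable ℝ v := v1.differentiable (by norm_num)
  have vda : ∀ a, Differentiable ℝ (fun x => v x a) := fun a => differentiable_pi.1 vd a
  have pv : ∀ i a x, pder i (fun x => v x a) x = pder i v x a := by
    intro i a x
    unfold pder
    have := (hasFDerivAt_pi'.1 (vd x).hasFDerivAt) a
    rw [this.fderiv]; rfl
  have lip : ∀ a, |(v x a - u a x) - (v y a - u a y)| ≤ n * (2 * κ * s) * ‖x - y‖ := by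
    intro a
    refine lip_of_pder (f := fun x => v x a - u a x) ((vda a).sub (fun x => (S.us a).diffAt x)) (fun i x => ?_) x y
    have : pder i (fun x => v x a - u a x) x = pder i v x a - pder i (u a) x := by
      rw [← pv]
      unfold pder
      rw [fderiv_fun_sub (vda a x) ((S.us a).diffAt x)]; rfl
    rw [this]
    exact v5 i a x
  refine (abs_sum_le' fun a => abs_mul_le' (lip a) (tM l a y)).trans ?_
  have := mul_le_mul_of_nonneg_right sc (norm_nonneg (x - y))
  linarith
end CI

namespace CI
open scoped ContDiff

lemma ext_metric {n : ℕ} {K : Set (Fin n → ℝ)} (hK : IsCompact K) (g : (Fin n → ℝ) → Matrix (Fin n) (Fin n) ℝ) (hg : ContDiff ℝ 1 g)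
    (hp : ∀ x ∈ K, (g x).PosDef) :
    ∃ (G : Fin n → Fin n → (Fin n → ℝ) → ℝ) (A B c : ℝ), (∀ i j, Continuous (G i j)) ∧ (∀ i j x, G i j x = G j i x) ∧ 0 ≤ A ∧
      (∀ i j x y, |G i j x - G i j y| ≤ A * ‖x - y‖) ∧ 0 ≤ B ∧ (∀ i j x, |G i j x| ≤ B) ∧ 0 < c ∧
      (∀ x (v : Fin n → ℝ), 2 * c ^ 2 * ∑ i, v i ^ 2 ≤ ∑ i, ∑ j, G i j x * (v i * v j)) ∧
      (∀ x ∈ K, ∀ i j, G i j x = g x i j) := by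
  have ge : ∀ i j, ContDiff ℝ 1 (fun x => g x i j) := fun i j => contDiff_pi.1 (contDiff_pi.1 hg i) j
  let S : Fin n → Fin n → (Fin n → ℝ) → ℝ := fun i j x => (g x i j + g x j i) / 2
  have Sc : ∀ i j, ContDiff ℝ 1 (S i j) := fun i j => ((ge i j).add (ge j i)).div_const 2
  have SK : ∀ x ∈ K, ∀ i j, S i j x = g x i j := by
    intro x hx i j
    have := (hp x hx).1.apply i j
    simp only [star_trivial] at this
    simp only [S, this]; ring
  let Φ : (Fin n → ℝ) × (Fin n → ℝ) → ℝ := fun z => ∑ i, ∑ j, S i j z.1 * (z.2 i * z.2 j)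
  have Φc : Continuous Φ := by
    refine continuous_finsetSum _ fun i _ => continuous_finsetSum _ fun j _ => ?_
    have := (Sc i j).continuous
    fun_prop
  let T : Set (Fin n → ℝ) := {v | ∑ i, v i ^ 2 = 1}
  have Tc : IsCompact T := by
    refine Metric.isCompact_of_isClosed_isBounded (isClosed_eq (by fun_prop) continuous_const) ?_
    refine (Metric.isBounded_closedBall (x := (0 : Fin n → ℝ)) (r := 1)).subset fun v hv => ?_
    rw [mem_closedBall_zero_iff, pi_norm_le_iff_of_nonneg zero_le_one]
    intro i
    have h1 : v i ^ 2 ≤ ∑ i, v i ^ 2 := Finset.single_le_sum (f := fun i => v i ^ 2) (fun i _ => sq_nonneg _) (Finset.mem_univ i)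
    have h2 : ∑ i, v i ^ 2 = 1 := hv
    exact abs_le_of_sq_le_sq (by nlinarith) zero_le_one
  have Φp : ∀ z ∈ K ×ˢ T, 0 < Φ z := by
    rintro ⟨x, v⟩ ⟨hx, hv⟩
    have hv' : ∑ i, v i ^ 2 = 1 := hv
    have v0 : v ≠ 0 := by rintro rfl; simp at hv'
    have := (Matrix.posDef_iff_dotProduct_mulVec.1 (hp x hx)).2 v0
    refine this.trans_le (le_of_eq ?_)
    simp only [dotProduct, Matrix.mulVec, Finset.mul_sum, Pi.star_apply, star_trivial, Φ, SK x hx]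
    exact Finset.sum_congr rfl fun i _ => Finset.sum_congr rfl fun j _ => by ring
  obtain ⟨m, m0, hm⟩ : ∃ m > 0, ∀ z ∈ K ×ˢ T, m < Φ z := by
    by_cases he : (K ×ˢ T).Nonempty
    · obtain ⟨z, hz, hmin⟩ := (hK.prod Tc).exists_isMinOn he Φc.continuousOn
      refine ⟨Φ z / 2, by linarith [Φp z hz], fun y hy => ?_⟩
      have h1 : Φ z ≤ Φ y := hmin hy
      linarith [Φp z hz]
    · rw [Set.not_nonempty_iff_eq_empty] at he
      exact ⟨1, one_pos, fun z hz => by rw [he] at hz; exact hz.elim⟩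
  obtain ⟨U, V, hU, hV, KU, TV, hUV⟩ := generalized_tube_lemma hK Tc (n := {z | m < Φ z}) (isOpen_lt continuous_const Φc) hm
  have lower : ∀ x ∈ U, ∀ v : Fin n → ℝ, m * ∑ i, v i ^ 2 ≤ ∑ i, ∑ j, S i j x * (v i * v j) := by
    intro x hx v
    by_cases hv : ∑ i, v i ^ 2 = 0
    · have : v = 0 := by
        funext i
        have := (Finset.sum_eq_zero_iff_of_nonneg (fun i _ => sq_nonneg (v i))).1 hv i (Finset.mem_univ i)
        exact pow_eq_zero_iff (two_ne_zero) |>.1 this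
      subst this
      simp
    · have vp : 0 < ∑ i, v i ^ 2 := lt_of_le_of_ne (Finset.sum_nonneg fun i _ => sq_nonneg _) (Ne.symm hv)
      set q := ∑ i, v i ^ 2 with hq
      have sq : √q ^ 2 = q := Real.sq_sqrt vp.le
      have wT : (fun i => v i / √q) ∈ T := by
        show ∑ i, (v i / √q) ^ 2 = 1
        simp only [div_pow, sq, ← Finset.sum_div]
        rw [← hq]; exact div_self vp.ne'
      have h1 : m < Φ (x, fun i => v i / √q) := hUV (Set.mk_mem_prod hx (TV wT))
      have h2 : Φ (x, fun i => v i / √q) = (∑ i, ∑ j, S i j x * (v i * v j)) / q := by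
        simp only [Φ, Finset.sum_div]
        refine Finset.sum_congr rfl fun i _ => Finset.sum_congr rfl fun j _ => ?_
        rw [div_mul_div_comm, ← pow_two (√q), sq]; ring
      rw [h2, lt_div_iff₀ vp] at h1
      exact h1.le
  obtain ⟨R, hR⟩ := hK.isBounded.subset_ball (0 : Fin n → ℝ)
  obtain ⟨χ, χ0, χ1, χr⟩ := exists_contMDiffMap_zero_one_of_isClosed (n := 1) (modelWithCornersSelf ℝ (Fin n → ℝ))
    (s := (U ∩ Metric.ball 0 R)ᶜ) (t := K) (hU.inter Metric.isOpen_ball).isClosed_compl hK.isClosed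
    (Set.disjoint_left.2 fun x h1 h2 => h1 ⟨KU h2, hR h2⟩)
  have χc : ContDiff ℝ 1 χ := χ.contMDiff.contDiff
  let δ : Fin n → Fin n → ℝ := fun i j => if i = j then 1 else 0
  let E : Fin n → Fin n → (Fin n → ℝ) → ℝ := fun i j x => χ x * (S i j x - δ i j)
  have Ec : ∀ i j, ContDiff ℝ 1 (E i j) := fun i j => χc.mul ((Sc i j).sub contDiff_const)
  have Es : ∀ i j, HasCompactSupport (E i j) := by
    intro i j
    refine HasCompactSupport.of_support_subset_isCompact (isCompact_closedBall (0 : Fin n → ℝ) R) fun x hx => ?_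
    by_contra hcon
    have : χ x = 0 := χ0 (fun h => hcon (Metric.ball_subset_closedBall h.2))
    exact hx (by simp [E, this])
  choose LA hLA using fun i j => ContDiff.lipschitzWith_of_hasCompactSupport (𝕂 := ℝ) (Es i j) (Ec i j) (by norm_num)
  choose LB hLB using fun i j => (Es i j).exists_bound_of_continuous (Ec i j).continuous
  let G : Fin n → Fin n → (Fin n → ℝ) → ℝ := fun i j x => δ i j + E i j x
  have sumle : ∀ (f : Fin n → Fin n → ℝ), (∀ i j, 0 ≤ f i j) → ∀ i j, f i j ≤ ∑ i, ∑ j, f i j := by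
    intro f hf i j
    refine (Finset.single_le_sum (f := fun j => f i j) (fun j _ => hf i j) (Finset.mem_univ j)).trans ?_
    exact Finset.single_le_sum (f := fun i => ∑ j, f i j) (fun i _ => Finset.sum_nonneg fun j _ => hf i j) (Finset.mem_univ i)
  set μ := min m 1 with hμ
  have μ0 : 0 < μ := lt_min m0 one_pos
  refine ⟨G, ∑ i, ∑ j, (LA i j : ℝ), 1 + ∑ i, ∑ j, |LB i j|, √(μ / 2), fun i j => continuous_const.add (Ec i j).continuous, fun i j x => ?_,
    Finset.sum_nonneg fun i _ => Finset.sum_nonneg fun j _ => NNReal.coe_nonneg _, fun i j x y => ?_,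
    add_nonneg zero_le_one (Finset.sum_nonneg fun i _ => Finset.sum_nonneg fun j _ => abs_nonneg _), fun i j x => ?_,
    Real.sqrt_pos.2 (by linarith), fun x v => ?_, fun x hx i j => ?_⟩
  · have e1 : S i j x = S j i x := by simp only [S, add_comm]
    have e2 : δ i j = δ j i := by simp only [δ, eq_comm]
    simp only [G, E, e1, e2]
  · have h1 := (hLA i j).dist_le_mul x y
    rw [Real.dist_eq, dist_eq_norm] at h1
    simp only [G, add_sub_add_left_eq_sub]
    exact h1.trans (mul_le_mul_of_nonneg_right (sumle (fun i j => (LA i j : ℝ)) (fun i j => NNReal.coe_nonneg _) i j) (norm_nonneg _))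
  · refine (abs_add_le _ _).trans (add_le_add ?_ ?_)
    · simp only [δ]; split_ifs <;> simp
    · exact (hLB i j x).trans ((le_abs_self _).trans (sumle (fun i j => |LB i j|) (fun i j => abs_nonneg _) i j))
  · rw [Real.sq_sqrt (by linarith)]
    have v0 : 0 ≤ ∑ i, v i ^ 2 := Finset.sum_nonneg fun i _ => sq_nonneg _
    have e3 : ∑ i, v i ^ 2 = ∑ i, ∑ j, δ i j * (v i * v j) := by simp [δ, pow_two]
    have e : ∑ i, ∑ j, G i j x * (v i * v j) = (1 - χ x) * (∑ i, v i ^ 2) + χ x * ∑ i, ∑ j, S i j x * (v i * v j) := by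
      rw [e3]
      simp only [Finset.mul_sum, ← Finset.sum_add_distrib]
      exact Finset.sum_congr rfl fun i _ => Finset.sum_congr rfl fun j _ => by simp only [G, E]; ring
    rw [e]
    have μm : μ ≤ m := min_le_left _ _
    have μ1 : μ ≤ 1 := min_le_right _ _
    have a1 := mul_le_mul_of_nonneg_right μ1 v0
    have a2 := mul_le_mul_of_nonneg_right μm v0
    obtain ⟨r0, r1⟩ := χr x
    have b1 := mul_le_mul_of_nonneg_left a1 (sub_nonneg.2 r1)
    by_cases hx : x ∈ U
    · have b2 := mul_le_mul_of_nonneg_left (a2.trans (lower x hx v)) r0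
      linarith
    · have : χ x = 0 := χ0 (fun h => hx h.1)
      rw [this]; linarith
  · have h1 : χ x = 1 := χ1 hx
    simp only [G, E, h1, SK x hx]; ring
end CI

namespace CI
open scoped ContDiff

lemma pder_add_const {n d : ℕ} (v : (Fin n → ℝ) → (Fin d → ℝ)) (t : Fin d → ℝ) (i : Fin n) : pder i (fun x => v x + t) = pder i v := by
  funext x
  unfold pder
  rw [fderiv_add_const]

theorem final (n : ℕ) (hn : 3 ≤ n) (Ω : Set (Fin n → ℝ)) (hb : Bornology.IsBounded Ω) (hne : Ω.Nonempty)
    (g : (Fin n → ℝ) → Matrix (Fin n) (Fin n) ℝ) (hg : ContDiff ℝ 1 g) (hp : ∀ x ∈ closure Ω, (g x).PosDef)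
    (ε : ℝ) (h0 : 0 < ε) (h1 : ε < 1 / (2 * (n + 1))) :
    Set.Infinite {v : ↥(closure Ω) → (Fin (2 * n) → ℝ) |
      ∃ u : (Fin n → ℝ) → (Fin (2 * n) → ℝ),
        MemC1Holder (closure Ω) (thetaExp n ε) u ∧
        Set.InjOn u (closure Ω) ∧
        (∀ x ∈ closure Ω, pullback u x = g x) ∧
        v = fun x => u x.1} := by
  have hK : IsCompact (closure Ω) := hb.isCompact_closure
  obtain ⟨G, A, B, c, G1, G2, G3, G4, G5, G6, G7, G8, G9⟩ := ext_metric hK g hg hp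
  obtain ⟨N, N1, N2, θ0, θ1, hθ⟩ : ∃ N : ℕ, 1 ≤ N ∧ n * (n - 1) ≤ 2 * (N * n) ∧ 0 ≤ thetaExp n ε ∧ thetaExp n ε ≤ 1 ∧
      thetaExp n ε * (2 * N + 1) < 1 := by
    have n3 : (3:ℝ) ≤ n := by exact_mod_cast hn
    have key : ∀ m : ℝ, n ≤ m → m ≤ n + 1 → 0 ≤ 1 / m - ε ∧ 1 / m - ε ≤ 1 ∧ (1 / m - ε) * m < 1 := by
      intro m m1 m2
      have mp : 0 < m := by linarith
      have a1 : 1 / (2 * ((n:ℝ) + 1)) ≤ 1 / m := one_div_le_one_div_of_le mp (by linarith)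
      have a2 : 1 / m ≤ 1 := by rw [div_le_one mp]; linarith
      refine ⟨by linarith, by linarith, ?_⟩
      rw [sub_mul, one_div_mul_cancel mp.ne']
      have := mul_pos h0 mp
      linarith
    by_cases ho : Odd n
    · obtain ⟨N, hN⟩ := ho
      have ht : thetaExp n ε = 1 / n - ε := by unfold thetaExp; rw [if_pos ⟨N, hN⟩]
      obtain ⟨k1, k2, k3⟩ := key n le_rfl (by linarith)
      have e : (n:ℝ) = 2 * N + 1 := by rw [hN]; push_cast; ring
      refine ⟨N, by omega, ?_, ht ▸ k1, ht ▸ k2, ?_⟩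
      · have : n - 1 = 2 * N := by omega
        rw [this]; exact le_of_eq (by ring)
      · rw [ht, ← e]; exact k3
    · have ht : thetaExp n ε = 1 / (n + 1) - ε := by unfold thetaExp; rw [if_neg ho]
      obtain ⟨N, hN⟩ := Nat.not_odd_iff_even.1 ho
      obtain ⟨k1, k2, k3⟩ := key (n + 1) (by linarith) le_rfl
      have e : (n:ℝ) + 1 = 2 * N + 1 := by rw [hN]; push_cast; ring
      refine ⟨N, by omega, ?_, ht ▸ k1, ht ▸ k2, ?_⟩
      · have : n - 1 ≤ 2 * N := by omega
        calc n * (n - 1) ≤ n * (2 * N) := Nat.mul_le_mul_left _ this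
          _ = _ := by ring
      · rw [ht, ← e]; exact k3
  obtain ⟨v, v1, ⟨C, v2⟩, v3, v4⟩ := embed (n := n) (d := 2 * n) (N := N) (k0 := ⟨0, by omega⟩) (k1 := ⟨1, by omega⟩) (by simp)
    (fun i => ⟨i, by omega⟩) (fun i => ⟨n + i, by omega⟩) (fun i j h => by simpa [Fin.ext_iff] using h)
    (fun i j h => by simpa [Fin.ext_iff] using h) (fun i k h => by simp [Fin.ext_iff] at h; omega) hK (by omega) N2 N1 G G1 G2 G3 G4 G5 G6
    G7 G8 θ0 θ1 hθ
  obtain ⟨x0, hx0⟩ := hne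
  refine Set.infinite_of_injective_forall_mem (α := ℕ) (f := fun t => fun x : ↥(closure Ω) => v x.1 + fun _ => (t:ℝ)) ?_ fun t => ?_
  · intro s t h
    have := congrFun (congrFun h ⟨x0, subset_closure hx0⟩) ⟨0, by omega⟩
    simpa using this
  · refine ⟨fun x => v x + fun _ => (t:ℝ), ⟨v1.add contDiff_const, C, fun i x _ y _ => ?_⟩, fun x hx y hy hxy => ?_, fun x hx => ?_, rfl⟩
    · rw [pder_add_const]; exact v2 i x y
    · exact v4 hx hy (add_right_cancel hxy)
    · ext i j
      simp only [pullback, Matrix.of_apply, pder_add_const]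
      rw [v3, G9 x hx]
end CI

/-- Corollary 1.3: infinitely many `C^{1,θ}` isometric embeddings. -/
theorem statement2 (n : ℕ) (hn : 3 ≤ n) :
    ∃ ε₀ : ℝ, 0 < ε₀ ∧ ε₀ < 1 / (n + 1) ∧
    ∀ Ω : Set (Fin n → ℝ), IsOpen Ω → Bornology.IsBounded Ω → Ω.Nonempty →
    SimplyConnectedSpace Ω →
    (∃ ρ : (Fin n → ℝ) → ℝ, ContDiff ℝ (⊤ : ℕ∞) ρ ∧ Ω = {x | ρ x < 0} ∧
      ∀ x ∈ frontier Ω, fderiv ℝ ρ x ≠ 0) →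
    ∀ g : (Fin n → ℝ) → Matrix (Fin n) (Fin n) ℝ, ContDiff ℝ 1 g →
    (∀ x ∈ closure Ω, (g x).PosDef) →
    ∀ ε : ℝ, 0 < ε → ε < ε₀ →
    Set.Infinite {v : ↥(closure Ω) → (Fin (2 * n) → ℝ) |
      ∃ u : (Fin n → ℝ) → (Fin (2 * n) → ℝ),
        MemC1Holder (closure Ω) (thetaExp n ε) u ∧
        Set.InjOn u (closure Ω) ∧
        (∀ x ∈ closure Ω, pullback u x = g x) ∧
        v = fun x => u x.1} := by
  refine ⟨1 / (2 * (n + 1)), by positivity, ?_, ?_⟩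
  · exact one_div_lt_one_div_of_lt (by positivity) (by nlinarith [(Nat.cast_nonneg n : (0:ℝ) ≤ n)])
  · intro Ω _ hb hne _ _ g hg hp ε h0 h1
    exact CI.final n hn Ω hb hne g hg hp ε h0 h1
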